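/- Assume g is C³ and satisfies (A1), (A2), (A3). Let R > 0, E > 0, ℓ ∈ 𝒱, and let ψ_n be classical solutions of the equivariant wave map equation (WM) on [−1,1] × (0,∞) such that: (1) E(ψ⃗_n(t)) ≤ E for all n, t; (2) ψ_n(0,R) → ℓ; (3) sup_{0<λ≤1} (1/λ) ∫_{−λ}^{λ} ∫₀^R |∂ₜψ_n(t,r)|² r dr dt → 0; (4) for every t ∈ [−1,1] and every r > 0, E(ψ⃗_n(t); r, R) → 0. Then there exist a subsequence ψ_{σ(n)}, an integer J ≥ 0, scales 0 < λ_{J,n} ≪ ⋯ ≪ λ_{1,n} ≪ 1, and harmonic maps Q_1, …, Q_J with Q_{j+1}(∞) = Q_j(0) for 1 ≤ j < J and Q_1(∞) = ℓ, such that ‖ψ⃗_{σ(n)}(0) − (ℓ,0) − Σ_{j=1}^{J} (Q_j(·/λ_{j,n}) − Q_j(∞), 0)‖_{H×L²([0,R])} → 0 as n → ∞. -/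

import Mathlib

open MeasureTheory Filter Topology Set
open scoped ENNReal

noncomputable section

/-- `G(x) = ∫₀ˣ |g(y)| dy`. -/
def Gfun (g : ℝ → ℝ) (x : ℝ) : ℝ := ∫ y in (0:ℝ)..x, |g y|

/-- Assumption (A1): `G(x) → ±∞` as `x → ±∞`. -/
def A1 (g : ℝ → ℝ) : Prop := Tendsto (Gfun g) atTop atTop ∧ Tendsto (Gfun g) atBot atBot

/-- Assumption (A2): the zero set `𝒱` of `g` is discrete. -/
def A2 (g : ℝ → ℝ) : Prop :=
  ∀ ℓ : ℝ, g ℓ = 0 → ∃ ε > 0, ∀ x : ℝ, g x = 0 → |x - ℓ| < ε → x = ℓ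

/-- Assumption (A3): `g'(ℓ) ∈ {−1,1}` for every zero `ℓ` of `g`. -/
def A3 (g : ℝ → ℝ) : Prop := ∀ ℓ : ℝ, g ℓ = 0 → deriv g ℓ = 1 ∨ deriv g ℓ = -1

/-- Time derivative `∂ₜψ(t,r)`. -/
def pdt (ψ : ℝ → ℝ → ℝ) (t r : ℝ) : ℝ := deriv (fun s => ψ s r) t
/-- Radial derivative `∂ᵣψ(t,r)`. -/
def pdr (ψ : ℝ → ℝ → ℝ) (t r : ℝ) : ℝ := deriv (fun ρ => ψ t ρ) r
/-- Second time derivative `∂ₜₜψ(t,r)`. -/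
def pdtt (ψ : ℝ → ℝ → ℝ) (t r : ℝ) : ℝ := deriv (fun s => pdt ψ s r) t
/-- Second radial derivative `∂ᵣᵣψ(t,r)`. -/
def pdrr (ψ : ℝ → ℝ → ℝ) (t r : ℝ) : ℝ := deriv (fun ρ => pdr ψ t ρ) r

/-- Energy of a pair `(φ₀, φ₁)` on a set `s ⊆ (0,∞)` of radii:
`∫_s (φ₁² + (∂ᵣφ₀)² + g(φ₀)²/r²) r dr`. -/
def energyOn (g : ℝ → ℝ) (φ₀ φ₁ : ℝ → ℝ) (s : Set ℝ) : ℝ≥0∞ :=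
  ∫⁻ r in s, ENNReal.ofReal (((φ₁ r)^2 + (deriv φ₀ r)^2 + (g (φ₀ r))^2 / r^2) * r)

/-- Squared `H × L²` norm of a pair `(φ₀, φ₁)` on a set `s ⊆ (0,∞)` of radii:
`∫_s (φ₁² + (∂ᵣφ₀)² + φ₀²/r²) r dr`. -/
def HLnormSqOn (φ₀ φ₁ : ℝ → ℝ) (s : Set ℝ) : ℝ≥0∞ :=
  ∫⁻ r in s, ENNReal.ofReal (((φ₁ r)^2 + (deriv φ₀ r)^2 + (φ₀ r)^2 / r^2) * r)

/-- Squared `H` norm of a single function on a set `s ⊆ (0,∞)` of radii. -/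
def HnormSqOn (φ : ℝ → ℝ) (s : Set ℝ) : ℝ≥0∞ :=
  ∫⁻ r in s, ENNReal.ofReal (((deriv φ r)^2 + (φ r)^2 / r^2) * r)

/-- `ψ` is a classical solution of the equivariant wave map equation (WM) on `I × (0,∞)`. -/
def IsWaveMapOn (g : ℝ → ℝ) (ψ : ℝ → ℝ → ℝ) (I : Set ℝ) : Prop :=
  ContDiffOn ℝ 2 (fun p : ℝ × ℝ => ψ p.1 p.2) (I ×ˢ Ioi (0:ℝ)) ∧
  ∀ t ∈ I, ∀ r ∈ Ioi (0:ℝ),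
    pdtt ψ t r - pdrr ψ t r - pdr ψ t r / r + g (ψ t r) * deriv g (ψ t r) / r^2 = 0

/-- `φ` is a classical solution of the linearized equation (LW) with coefficient `k²` on
`I × (0,∞)`. -/
def IsLinWaveOn (k : ℝ) (φ : ℝ → ℝ → ℝ) (I : Set ℝ) : Prop :=
  ContDiffOn ℝ 2 (fun p : ℝ × ℝ => φ p.1 p.2) (I ×ˢ Ioi (0:ℝ)) ∧
  ∀ t ∈ I, ∀ r ∈ Ioi (0:ℝ),
    pdtt φ t r - pdrr φ t r - pdr φ t r / r + k^2 * φ t r / r^2 = 0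

/-- A finite-energy classical solution of the linearized equation (LW), defined for all times. -/
def IsFiniteEnergyLinWave (k : ℝ) (φ : ℝ → ℝ → ℝ) : Prop :=
  IsLinWaveOn k φ univ ∧ ∃ C : ℝ≥0∞, C < ⊤ ∧ ∀ t : ℝ, HLnormSqOn (φ t) (pdt φ t) (Ioi 0) ≤ C

/-- A (possibly constant) harmonic map: a finite-energy `C²` solution of
`Q'' + Q'/r = f(Q)/r²` on `(0,∞)`, together with its limits at `r = 0` and `r = ∞`,
which belong to the zero set `𝒱` of `g`. -/
structure HarmonicMap (g : ℝ → ℝ) where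
  Q : ℝ → ℝ
  Q0 : ℝ
  Qinf : ℝ
  smooth : ContDiffOn ℝ 2 Q (Ioi 0)
  eqn : ∀ r ∈ Ioi (0:ℝ), deriv (deriv Q) r + deriv Q r / r = g (Q r) * deriv g (Q r) / r^2
  finiteEnergy : energyOn g Q (fun _ => 0) (Ioi 0) < ⊤
  lim_zero : Tendsto Q (𝓝[>] (0:ℝ)) (𝓝 Q0)
  lim_infty : Tendsto Q atTop (𝓝 Qinf)
  zero_mem : g Q0 = 0
  infty_mem : g Qinf = 0

/-- The interval `[r₁, r₂] ∩ (0,∞)`, where `r₂` may be `+∞` (an extended real). -/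
def sIcc (r₁ : ℝ) (r₂ : EReal) : Set ℝ := {r : ℝ | r₁ ≤ r ∧ (r : EReal) ≤ r₂} ∩ Ioi 0

/-- The open interval `(r₁, r₂)`, where `r₂` may be `+∞` (an extended real). -/
def sIoo (r₁ : ℝ) (r₂ : EReal) : Set ℝ := {r : ℝ | r₁ < r ∧ (r : EReal) < r₂}

/-- The filter of approach to the (possibly infinite) point `b` within the set `s ⊆ ℝ`. -/
def approach (s : Set ℝ) (b : EReal) : Filter ℝ :=
  Filter.comap (fun r : ℝ => (r : EReal)) (𝓝 b) ⊓ Filter.principal s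

end

section RectangleCalculus

lemma continuous_integral_slice {f : ℝ × ℝ → ℝ} (hf : Continuous f) (a b : ℝ) :
    Continuous fun z => ∫ x in a..b, f (z, x) :=
  intervalIntegral.continuous_parametric_intervalIntegral_of_continuous'
    (f := fun z x => f (z, x)) (by exact hf) a b

lemma intervalIntegral_swap_of_continuous {f : ℝ × ℝ → ℝ} (hf : Continuous f) (a b c d : ℝ) :
    ∫ z in c..d, ∫ x in a..b, f (z, x) = ∫ x in a..b, ∫ z in c..d, f (z, x) := by
  apply intervalIntegral_intervalIntegral_swap (F := fun z x => f (z, x))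
  have : IntegrableOn f (uIcc c d ×ˢ uIcc a b) :=
    hf.continuousOn.integrableOn_compact (isCompact_uIcc.prod isCompact_uIcc)
  exact this.mono_set (prod_mono uIoc_subset_uIcc uIoc_subset_uIcc)

/-- The fundamental theorem of calculus integrated over a transversal variable. -/
lemma integral_sub_integral_of_hasDerivAt {F Fz : ℝ × ℝ → ℝ} (hF : Continuous F)
    (hFz : Continuous Fz) {z₀ z₁ a b : ℝ} (hz : z₀ ≤ z₁) (hab : a ≤ b)
    (hd : ∀ z ∈ Ioo z₀ z₁, ∀ x ∈ Ioo a b, HasDerivAt (fun s => F (s, x)) (Fz (z, x)) z) :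
    (∫ x in a..b, F (z₁, x)) - ∫ x in a..b, F (z₀, x) =
      ∫ z in z₀..z₁, ∫ x in a..b, Fz (z, x) := by
  rw [← intervalIntegral.integral_sub (Continuous.intervalIntegrable (by fun_prop) _ _)
    (Continuous.intervalIntegrable (by fun_prop) _ _), intervalIntegral_swap_of_continuous hFz]
  apply intervalIntegral.integral_congr_Ioo_of_le hab
  intro x hx
  symm
  apply intervalIntegral.integral_eq_sub_of_hasDerivAt_of_le hz
  · exact Continuous.continuousOn (by fun_prop)
  · intro z hz'
    exact hd z hz' x hx
  · exact Continuous.intervalIntegrable (by fun_prop) _ _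

/-- Divergence theorem on a rectangle. -/
lemma rectangle_divergence {F Fz G Gx H : ℝ × ℝ → ℝ} (hF : Continuous F) (hFz : Continuous Fz)
    (hG : Continuous G) (hGx : Continuous Gx) {z₀ z₁ a b : ℝ} (hz : z₀ ≤ z₁) (hab : a ≤ b)
    (hdF : ∀ z ∈ Ioo z₀ z₁, ∀ x ∈ Ioo a b, HasDerivAt (fun s => F (s, x)) (Fz (z, x)) z)
    (hdG : ∀ z ∈ Ioo z₀ z₁, ∀ x ∈ Ioo a b, HasDerivAt (fun y => G (z, y)) (Gx (z, x)) x)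
    (hH : ∀ z ∈ Icc z₀ z₁, ∀ x ∈ Icc a b, Fz (z, x) + Gx (z, x) = H (z, x)) :
    (∫ x in a..b, F (z₁, x)) - (∫ x in a..b, F (z₀, x)) +
      ∫ z in z₀..z₁, (G (z, b) - G (z, a)) = ∫ z in z₀..z₁, ∫ x in a..b, H (z, x) := by
  rw [integral_sub_integral_of_hasDerivAt hF hFz hz hab hdF]
  have h2 : ∫ z in z₀..z₁, (G (z, b) - G (z, a)) = ∫ z in z₀..z₁, ∫ x in a..b, Gx (z, x) := by
    apply intervalIntegral.integral_congr_Ioo_of_le hz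
    intro z hz'
    symm
    apply intervalIntegral.integral_eq_sub_of_hasDerivAt_of_le hab
    · exact Continuous.continuousOn (by fun_prop)
    · intro x hx
      exact hdG z hz' x hx
    · exact Continuous.intervalIntegrable (by fun_prop) _ _
  rw [h2, ← intervalIntegral.integral_add
    ((continuous_integral_slice hFz a b).intervalIntegrable _ _)
    ((continuous_integral_slice hGx a b).intervalIntegrable _ _)]
  apply intervalIntegral.integral_congr
  intro z hz'
  rw [uIcc_of_le hz] at hz'
  simp only
  rw [← intervalIntegral.integral_add (Continuous.intervalIntegrable (by fun_prop) _ _)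
    (Continuous.intervalIntegrable (by fun_prop) _ _)]
  apply intervalIntegral.integral_congr
  intro x hx
  rw [uIcc_of_le hab] at hx
  exact hH z hz' x hx

/-- Pointwise comparison of integrals of continuous functions. -/
lemma integral_mono_of_continuous {f h : ℝ → ℝ} (hf : Continuous f) (hh : Continuous h) {a b : ℝ}
    (hab : a ≤ b) (hle : ∀ x ∈ Icc a b, f x ≤ h x) :
    ∫ x in a..b, f x ≤ ∫ x in a..b, h x :=
  intervalIntegral.integral_mono_on hab (hf.intervalIntegrable _ _) (hh.intervalIntegrable _ _) hle

lemma integral_le_add_of_continuous {f h k : ℝ → ℝ} (hf : Continuous f) (hh : Continuous h)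
    (hk : Continuous k) {a b : ℝ} (c d : ℝ)
    (hab : a ≤ b) (hle : ∀ x ∈ Icc a b, f x ≤ c * h x + d * k x) :
    ∫ x in a..b, f x ≤ c * (∫ x in a..b, h x) + d * ∫ x in a..b, k x := by
  refine (integral_mono_of_continuous hf (h := fun x => c * h x + d * k x) (by fun_prop)
    hab hle).trans (le_of_eq ?_)
  rw [intervalIntegral.integral_add (Continuous.intervalIntegrable (by fun_prop) _ _)
    (Continuous.intervalIntegrable (by fun_prop) _ _), intervalIntegral.integral_const_mul,
    intervalIntegral.integral_const_mul]

lemma integral_nonneg_of_continuous {f : ℝ → ℝ} {a b : ℝ}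
    (hab : a ≤ b) (hle : ∀ x ∈ Icc a b, 0 ≤ f x) : 0 ≤ ∫ x in a..b, f x :=
  intervalIntegral.integral_nonneg hab hle

end RectangleCalculus

section ExponentialAverage

/-- The exponential average `x ↦ ∫ₓᵇ e^{x-y} h(y) dy`. -/
noncomputable def expAvg (b : ℝ) (h : ℝ → ℝ) (x : ℝ) : ℝ :=
  Real.exp x * ∫ y in x..b, Real.exp (-y) * h y

lemma hasDerivAt_expAvg {b : ℝ} {h : ℝ → ℝ} (hh : Continuous h) (x : ℝ) :
    HasDerivAt (expAvg b h) (expAvg b h x - h x) x := by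
  have hc : Continuous fun y => Real.exp (-y) * h y := by fun_prop
  have h1 : HasDerivAt (fun x => ∫ y in x..b, Real.exp (-y) * h y) (-(Real.exp (-x) * h x)) x :=
    intervalIntegral.integral_hasDerivAt_left (hc.intervalIntegrable _ _)
      hc.aestronglyMeasurable.stronglyMeasurableAtFilter hc.continuousAt
  have h2 := (Real.hasDerivAt_exp x).mul h1
  refine h2.congr_deriv ?_
  have : Real.exp x * Real.exp (-x) = 1 := by rw [← Real.exp_add]; simp
  unfold expAvg
  linear_combination (-(h x)) * this

lemma expAvg_right (b : ℝ) (h : ℝ → ℝ) : expAvg b h b = 0 := by simp [expAvg]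

lemma continuous_expAvg {b : ℝ} {h : ℝ → ℝ} (hh : Continuous h) : Continuous (expAvg b h) :=
  continuous_iff_continuousAt.2 fun x => (hasDerivAt_expAvg hh x).continuousAt

lemma continuous_expAvg_slice {f : ℝ × ℝ → ℝ} (hf : Continuous f) (b : ℝ) :
    Continuous fun p : ℝ × ℝ => expAvg b (fun y => f (p.1, y)) p.2 := by
  unfold expAvg
  have : Continuous fun p : ℝ × ℝ => ∫ y in p.2..b, Real.exp (-y) * f (p.1, y) := by
    have h := intervalIntegral.continuous_parametric_intervalIntegral_of_continuous
      (μ := volume) (a₀ := b) (f := fun (p : ℝ × ℝ) y => Real.exp (-y) * f (p.1, y))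
      (by unfold Function.uncurry; fun_prop) (s := fun p : ℝ × ℝ => p.2) continuous_snd
    have h' := Continuous.fun_neg h
    refine h'.congr fun p => ?_
    exact (intervalIntegral.integral_symm _ _).symm
  fun_prop

/-- Weighted energy identity for the exponential average. -/
lemma integral_weight_expAvg {b : ℝ} {h w w' : ℝ → ℝ} (hh : Continuous h) {a : ℝ}
    (hw : ∀ x, HasDerivAt w (w' x) x) (hw' : Continuous w') :
    ∫ x in a..b, (w' x * expAvg b h x ^ 2 + 2 * w x * expAvg b h x * (expAvg b h x - h x)) =
      - (w a * expAvg b h a ^ 2) := by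
  have hwc : Continuous w := continuous_iff_continuousAt.2 fun x => (hw x).continuousAt
  have hκ := continuous_expAvg (b := b) hh
  rw [intervalIntegral.integral_eq_sub_of_hasDerivAt (f := fun x => w x * expAvg b h x ^ 2)]
  · simp [expAvg_right]
  · intro x _
    refine ((hw x).mul ((hasDerivAt_expAvg (b := b) hh x).pow 2)).congr_deriv ?_
    simp
    ring
  · exact Continuous.intervalIntegrable (by fun_prop) _ _

lemma integral_expAvg_sq_le {a b : ℝ} (hab : a ≤ b) {h : ℝ → ℝ} (hh : Continuous h) :
    ∫ x in a..b, expAvg b h x ^ 2 ≤ ∫ x in a..b, h x ^ 2 := by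
  have hκ := continuous_expAvg (b := b) hh
  have h1 := integral_weight_expAvg (b := b) (a := a) hh (w := fun _ => 1) (w' := fun _ => 0)
    (fun x => hasDerivAt_const _ _) continuous_const
  have h2 := integral_le_add_of_continuous (f := fun x => expAvg b h x ^ 2)
    (h := fun x => 0 * expAvg b h x ^ 2 + 2 * 1 * expAvg b h x * (expAvg b h x - h x))
    (k := fun x => h x ^ 2) (by fun_prop) (by fun_prop) (by fun_prop) 1 1 hab
    (fun x _ => by nlinarith [sq_nonneg (expAvg b h x - h x)])
  rw [h1] at h2
  nlinarith [sq_nonneg (expAvg b h a)]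

lemma integral_exp_expAvg_sq_le {a b : ℝ} (hab : a ≤ b) {h : ℝ → ℝ} (hh : Continuous h) :
    ∫ x in a..b, Real.exp (x - b) * expAvg b h x ^ 2 ≤
      1 / 2 * ∫ x in a..b, Real.exp (x - b) * h x ^ 2 := by
  have hκ := continuous_expAvg (b := b) hh
  have h1 := integral_weight_expAvg (b := b) (a := a) hh (w := fun x => Real.exp (x - b))
    (w' := fun x => Real.exp (x - b))
    (fun x => by simpa using ((hasDerivAt_id x).sub_const b).exp) (by fun_prop)
  have h2 := integral_le_add_of_continuous (f := fun x => Real.exp (x - b) * expAvg b h x ^ 2)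
    (h := fun x => Real.exp (x - b) * expAvg b h x ^ 2 +
      2 * Real.exp (x - b) * expAvg b h x * (expAvg b h x - h x))
    (k := fun x => Real.exp (x - b) * h x ^ 2) (by fun_prop) (by fun_prop) (by fun_prop)
    1 (1 / 2) hab
    (fun x _ => by
      have := mul_nonneg (Real.exp_pos (x - b)).le (sq_nonneg (2 * expAvg b h x - h x))
      nlinarith)
  rw [h1] at h2
  nlinarith [mul_nonneg (Real.exp_pos (a - b)).le (sq_nonneg (expAvg b h a))]

lemma expAvg_left_sq_le {a b : ℝ} (hab : a ≤ b) {h : ℝ → ℝ} (hh : Continuous h) :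
    expAvg b h a ^ 2 ≤ ∫ x in a..b, Real.exp (a - x) * h x ^ 2 := by
  have hκ := continuous_expAvg (b := b) hh
  have h1 := integral_weight_expAvg (b := b) (a := a) hh (w := fun x => Real.exp (a - x))
    (w' := fun x => - Real.exp (a - x))
    (fun x => by simpa using ((hasDerivAt_id x).const_sub a).exp) (by fun_prop)
  have h2 := integral_le_add_of_continuous (f := fun x => 0)
    (h := fun x => - Real.exp (a - x) * expAvg b h x ^ 2 +
      2 * Real.exp (a - x) * expAvg b h x * (expAvg b h x - h x))
    (k := fun x => Real.exp (a - x) * h x ^ 2) (by fun_prop) (by fun_prop) (by fun_prop)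
    1 1 hab
    (fun x _ => by
      have := mul_nonneg (Real.exp_pos (a - x)).le (sq_nonneg (expAvg b h x - h x))
      nlinarith)
  rw [h1] at h2
  simp at h2
  linarith

lemma expAvg_deriv {a b : ℝ} {h h' : ℝ → ℝ} (hh : Continuous h) (hh' : Continuous h')
    (hd : ∀ x ∈ Ioo a b, HasDerivAt h (h' x) x) {x : ℝ} (hx : x ∈ Icc a b) :
    expAvg b h' x = expAvg b h x - h x + Real.exp (x - b) * h b := by
  have h1 : ∫ y in x..b, (Real.exp (-y) * h' y - Real.exp (-y) * h y) =
      Real.exp (-b) * h b - Real.exp (-x) * h x := by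
    apply intervalIntegral.integral_eq_sub_of_hasDerivAt_of_le (f := fun y => Real.exp (-y) * h y)
      hx.2
    · exact Continuous.continuousOn (by fun_prop)
    · intro y hy
      refine (((hasDerivAt_id y).neg.exp).mul (hd y ⟨hx.1.trans_lt hy.1, hy.2⟩)).congr_deriv ?_
      simp; ring
    · exact Continuous.intervalIntegrable (by fun_prop) _ _
  rw [intervalIntegral.integral_sub (Continuous.intervalIntegrable (by fun_prop) _ _)
    (Continuous.intervalIntegrable (by fun_prop) _ _)] at h1
  have e1 : Real.exp x * Real.exp (-x) = 1 := by rw [← Real.exp_add]; simp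
  have e2 : Real.exp (x - b) = Real.exp x * Real.exp (-b) := by
    rw [← Real.exp_add, sub_eq_add_neg]
  unfold expAvg
  rw [e2]
  linear_combination Real.exp x * h1 - h x * e1

/-- Differentiation of the exponential average in a parameter. -/
lemma hasDerivAt_expAvg_param {F Fz : ℝ × ℝ → ℝ} (hF : Continuous F) (hFz : Continuous Fz)
    {z₀ z₁ a b : ℝ} (hd : ∀ z ∈ Ioo z₀ z₁, ∀ x ∈ Ioo a b,
      HasDerivAt (fun s => F (s, x)) (Fz (z, x)) z) {z x : ℝ} (hz : z ∈ Ioo z₀ z₁)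
    (hx : x ∈ Icc a b) :
    HasDerivAt (fun s => expAvg b (fun y => F (s, y)) x) (expAvg b (fun y => Fz (z, y)) x) z := by
  unfold expAvg
  apply HasDerivAt.const_mul
  have hc : Continuous fun s => ∫ y in x..b, Real.exp (-y) * Fz (s, y) :=
    continuous_integral_slice (f := fun p => Real.exp (-p.2) * Fz p) (by fun_prop) x b
  obtain ⟨c, hc1, hc2⟩ := exists_between hz.1
  have h1 : HasDerivAt (fun s => (∫ y in x..b, Real.exp (-y) * F (c, y)) +
      ∫ r in c..s, ∫ y in x..b, Real.exp (-y) * Fz (r, y))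
      (∫ y in x..b, Real.exp (-y) * Fz (z, y)) z := by
    apply HasDerivAt.const_add
    exact intervalIntegral.integral_hasDerivAt_right (hc.intervalIntegrable _ _)
      hc.aestronglyMeasurable.stronglyMeasurableAtFilter hc.continuousAt
  apply h1.congr_of_eventuallyEq
  filter_upwards [Ioo_mem_nhds hc2 hz.2] with s hs
  have := integral_sub_integral_of_hasDerivAt (F := fun p => Real.exp (-p.2) * F p)
    (Fz := fun p => Real.exp (-p.2) * Fz p) (by fun_prop) (by fun_prop) hs.1.le hx.2
    (fun r hr y hy => (hd r ⟨hc1.trans hr.1, hr.2.trans hs.2⟩ y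
      ⟨hx.1.trans_lt hy.1, hy.2⟩).const_mul (Real.exp (-y)))
  simp only at this
  linarith

end ExponentialAverage

/-- A solution of the wave equation in the self-similar coordinates `(z, x)`, `t = z e^x`,
`r = e^x`, on the rectangle `[0,1] × [a,b]`, written with its first and second derivatives.
`N` is the nonlinear part of the force and `W` its potential energy. -/
structure Sector (a b : ℝ) where
  (Φ P X Pz Y Xx N W : ℝ × ℝ → ℝ)
  hab : a ≤ b
  cΦ : Continuous Φ
  cP : Continuous P
  cX : Continuous X
  cPz : Continuous Pz
  cY : Continuous Y
  cXx : Continuous Xx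
  cN : Continuous N
  cW : Continuous W
  dΦz : ∀ z ∈ Ioo (0:ℝ) 1, ∀ x ∈ Ioo a b, HasDerivAt (fun s => Φ (s, x)) (P (z, x)) z
  dΦx : ∀ z ∈ Icc (0:ℝ) 1, ∀ x ∈ Ioo a b, HasDerivAt (fun y => Φ (z, y)) (X (z, x)) x
  dPz : ∀ z ∈ Ioo (0:ℝ) 1, ∀ x ∈ Ioo a b, HasDerivAt (fun s => P (s, x)) (Pz (z, x)) z
  dPx : ∀ z ∈ Icc (0:ℝ) 1, ∀ x ∈ Ioo a b, HasDerivAt (fun y => P (z, y)) (Y (z, x)) x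
  dXz : ∀ z ∈ Ioo (0:ℝ) 1, ∀ x ∈ Ioo a b, HasDerivAt (fun s => X (s, x)) (Y (z, x)) z
  dXx : ∀ z ∈ Icc (0:ℝ) 1, ∀ x ∈ Ioo a b, HasDerivAt (fun y => X (z, y)) (Xx (z, x)) x
  dW : ∀ z ∈ Ioo (0:ℝ) 1, ∀ x ∈ Ioo a b,
    HasDerivAt (fun s => W (s, x)) (2 * P (z, x) * (Φ (z, x) + N (z, x))) z
  eqn : ∀ z ∈ Icc (0:ℝ) 1, ∀ x ∈ Icc a b,
    (1 - z ^ 2) * Pz (z, x) - z * P (z, x) + 2 * z * Y (z, x) - Xx (z, x) + Φ (z, x) +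
      N (z, x) = 0

namespace Sector

variable {a b : ℝ} (S : Sector a b)

attribute [fun_prop] cΦ cP cX cPz cY cXx cN cW

/-- Energy identity in self-similar coordinates. -/
lemma energy_identity {z₁ : ℝ} (h0 : 0 ≤ z₁) (h1 : z₁ ≤ 1) :
    (∫ x in a..b, ((1 - z₁ ^ 2) * S.P (z₁, x) ^ 2 + S.X (z₁, x) ^ 2 + S.W (z₁, x))) -
      (∫ x in a..b, (S.P (0, x) ^ 2 + S.X (0, x) ^ 2 + S.W (0, x))) +
      ∫ z in (0:ℝ)..z₁, ((2 * z * S.P (z, b) ^ 2 - 2 * S.P (z, b) * S.X (z, b)) -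
        (2 * z * S.P (z, a) ^ 2 - 2 * S.P (z, a) * S.X (z, a))) = 0 := by
  have := rectangle_divergence (z₀ := 0) (z₁ := z₁) (a := a) (b := b)
    (F := fun p => (1 - p.1 ^ 2) * S.P p ^ 2 + S.X p ^ 2 + S.W p)
    (Fz := fun p => -2 * p.1 * S.P p ^ 2 + (1 - p.1 ^ 2) * (2 * S.P p * S.Pz p) +
      2 * S.X p * S.Y p + 2 * S.P p * (S.Φ p + S.N p))
    (G := fun p => 2 * p.1 * S.P p ^ 2 - 2 * S.P p * S.X p)
    (Gx := fun p => 2 * p.1 * (2 * S.P p * S.Y p) - 2 * (S.Y p * S.X p + S.P p * S.Xx p))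
    (H := fun _ => 0) (by fun_prop) (by fun_prop) (by fun_prop) (by fun_prop) h0 S.hab
    (fun z hz x hx => by
      have hz' : z ∈ Ioo (0:ℝ) 1 := ⟨hz.1, hz.2.trans_le h1⟩
      refine (((((hasDerivAt_id z).pow 2).const_sub 1).mul ((S.dPz z hz' x hx).pow 2)).add
        ((S.dXz z hz' x hx).pow 2)).add (S.dW z hz' x hx) |>.congr_deriv ?_
      simp)
    (fun z hz x hx => by
      have hz' : z ∈ Icc (0:ℝ) 1 := ⟨hz.1.le, hz.2.le.trans h1⟩
      refine ((((S.dPx z hz' x hx).pow 2).const_mul (2 * z)).sub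
        (((S.dPx z hz' x hx).const_mul 2).mul (S.dXx z hz' x hx))).congr_deriv ?_
      simp; ring)
    (fun z hz x hx => by
      have := S.eqn z ⟨hz.1, hz.2.trans h1⟩ x hx
      simp only
      linear_combination 2 * S.P (z, x) * this)
  simpa using this

/-- Smallness conditions on a sector solution: `η` measures the size of the nonlinearity, `ε` the
kinetic and boundary terms, and `E` bounds the energy of the initial data. -/
structure Small (η ε E : ℝ) : Prop where
  η_pos : 0 < η
  η_le : η ≤ 1 / 4
  N_le : ∀ z ∈ Icc (0:ℝ) 1, ∀ x ∈ Icc a b, |S.N (z, x)| ≤ η * |S.Φ (z, x)|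
  W_le : ∀ z ∈ Icc (0:ℝ) 1, ∀ x ∈ Icc a b, |S.W (z, x) - S.Φ (z, x) ^ 2| ≤ η * S.Φ (z, x) ^ 2
  initial : ∫ x in a..b, S.P (0, x) ^ 2 ≤ ε
  kin_left : ∫ z in (0:ℝ)..1, ∫ x in a..b, Real.exp (a - x) * S.P (z, x) ^ 2 ≤ ε
  kin_right : ∫ z in (0:ℝ)..1, ∫ x in a..b, Real.exp (x - b) * S.P (z, x) ^ 2 ≤ ε
  bdry_left : ∫ z in (0:ℝ)..1, (S.P (z, a) ^ 2 + S.X (z, a) ^ 2 + S.Φ (z, a) ^ 2) ≤ ε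
  bdry_right : ∫ z in (0:ℝ)..1, (S.P (z, b) ^ 2 + S.X (z, b) ^ 2 + S.Φ (z, b) ^ 2) ≤ ε
  energy : ∫ x in a..b, (S.X (0, x) ^ 2 + S.W (0, x)) ≤ E

end Sector

lemma abs_integral_le_of_abs_le {f h : ℝ → ℝ} (hf : Continuous f) (hh : Continuous h) {z₁ : ℝ}
    (h0 : 0 ≤ z₁) (h1 : z₁ ≤ 1) (hle : ∀ z ∈ Icc (0:ℝ) 1, |f z| ≤ h z) :
    |∫ z in (0:ℝ)..z₁, f z| ≤ ∫ z in (0:ℝ)..1, h z := by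
  refine (intervalIntegral.abs_integral_le_integral_abs h0).trans ?_
  refine (integral_mono_of_continuous hf.abs hh h0
    fun z hz => hle z ⟨hz.1, hz.2.trans h1⟩).trans ?_
  apply intervalIntegral.integral_mono_interval le_rfl h0 h1 _ (hh.intervalIntegrable _ _)
  filter_upwards [ae_restrict_mem measurableSet_Ioc] with z hz
  exact (abs_nonneg _).trans (hle z ⟨hz.1.le, hz.2⟩)

namespace Sector

variable {a b : ℝ} {S : Sector a b} {η ε E : ℝ}

lemma Small.ε_nonneg (h : S.Small η ε E) : 0 ≤ ε :=
  (integral_nonneg_of_continuous S.hab fun _ _ => sq_nonneg _).trans h.initial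

lemma Small.W_lower (h : S.Small η ε E) {z x : ℝ} (hz : z ∈ Icc (0:ℝ) 1) (hx : x ∈ Icc a b) :
    3 / 4 * S.Φ (z, x) ^ 2 ≤ S.W (z, x) := by
  have h1 := abs_le.1 (h.W_le z hz x hx)
  nlinarith [h.η_le, sq_nonneg (S.Φ (z, x))]

lemma Small.abs_flux_le (h : S.Small η ε E) {z₁ : ℝ} (h0 : 0 ≤ z₁) (h1 : z₁ ≤ 1) :
    |∫ z in (0:ℝ)..z₁, ((2 * z * S.P (z, b) ^ 2 - 2 * S.P (z, b) * S.X (z, b)) -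
        (2 * z * S.P (z, a) ^ 2 - 2 * S.P (z, a) * S.X (z, a)))| ≤ 6 * ε := by
  refine (abs_integral_le_of_abs_le
    (h := fun z => 3 * (S.P (z, b) ^ 2 + S.X (z, b) ^ 2 + S.Φ (z, b) ^ 2) +
      3 * (S.P (z, a) ^ 2 + S.X (z, a) ^ 2 + S.Φ (z, a) ^ 2))
    (by fun_prop) (by fun_prop) h0 h1 fun z hz => ?_).trans ?_
  · rw [abs_le]
    constructor <;> nlinarith [hz.1, hz.2, sq_nonneg (S.P (z, b) + S.X (z, b)),
      sq_nonneg (S.P (z, b) - S.X (z, b)), sq_nonneg (S.P (z, a) + S.X (z, a)),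
      sq_nonneg (S.P (z, a) - S.X (z, a)), mul_nonneg hz.1 (sq_nonneg (S.P (z, a))),
      mul_nonneg hz.1 (sq_nonneg (S.P (z, b))),
      mul_nonneg (sub_nonneg.2 hz.2) (sq_nonneg (S.P (z, a))),
      mul_nonneg (sub_nonneg.2 hz.2) (sq_nonneg (S.P (z, b))),
      sq_nonneg (S.Φ (z, a)), sq_nonneg (S.Φ (z, b)), sq_nonneg (S.X (z, a)),
      sq_nonneg (S.X (z, b))]
  · rw [intervalIntegral.integral_add (Continuous.intervalIntegrable (by fun_prop) _ _)
      (Continuous.intervalIntegrable (by fun_prop) _ _), intervalIntegral.integral_const_mul,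
      intervalIntegral.integral_const_mul]
    linarith [h.bdry_left, h.bdry_right]

lemma Small.energy_le (h : S.Small η ε E) {z : ℝ} (hz : z ∈ Icc (0:ℝ) 1) :
    ∫ x in a..b, ((1 - z ^ 2) * S.P (z, x) ^ 2 + S.X (z, x) ^ 2 + S.W (z, x)) ≤ E + 7 * ε := by
  have h1 := S.energy_identity hz.1 hz.2
  have h2 := abs_le.1 (h.abs_flux_le hz.1 hz.2)
  have h3 : (∫ x in a..b, (S.P (0, x) ^ 2 + S.X (0, x) ^ 2 + S.W (0, x))) =
      (∫ x in a..b, S.P (0, x) ^ 2) + ∫ x in a..b, (S.X (0, x) ^ 2 + S.W (0, x)) := by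
    rw [← intervalIntegral.integral_add (Continuous.intervalIntegrable (by fun_prop) _ _)
      (Continuous.intervalIntegrable (by fun_prop) _ _)]
    congr 1; ext x; ring
  linarith [h.initial, h.energy]

lemma Small.energy_nonneg (h : S.Small η ε E) : 0 ≤ E := by
  refine le_trans (integral_nonneg_of_continuous S.hab fun x hx => ?_) h.energy
  nlinarith [h.W_lower (z := 0) (by simp) hx, sq_nonneg (S.X (0, x)), sq_nonneg (S.Φ (0, x))]

lemma Small.integral_quad_le (h : S.Small η ε E) {z : ℝ} (hz : z ∈ Icc (0:ℝ) 1) :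
    ∫ x in a..b, ((1 - z ^ 2) * S.P (z, x) ^ 2 + S.X (z, x) ^ 2 + S.Φ (z, x) ^ 2) ≤
      2 * (E + 7 * ε) := by
  have := integral_mono_of_continuous (a := a) (b := b)
    (f := fun x => (1 - z ^ 2) * S.P (z, x) ^ 2 + S.X (z, x) ^ 2 + S.Φ (z, x) ^ 2)
    (h := fun x => 2 * ((1 - z ^ 2) * S.P (z, x) ^ 2 + S.X (z, x) ^ 2 + S.W (z, x)))
    (by fun_prop) (by fun_prop) S.hab fun x hx => by
      have hz2 : 0 ≤ 1 - z ^ 2 := by nlinarith [hz.1, hz.2]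
      nlinarith [h.W_lower hz hx, sq_nonneg (S.X (z, x)), sq_nonneg (S.Φ (z, x)),
        mul_nonneg hz2 (sq_nonneg (S.P (z, x)))]
  rw [intervalIntegral.integral_const_mul] at this
  linarith [h.energy_le hz]

lemma Small.integral_Φ_le (h : S.Small η ε E) {z : ℝ} (hz : z ∈ Icc (0:ℝ) 1) :
    ∫ x in a..b, S.Φ (z, x) ^ 2 ≤ 2 * (E + 7 * ε) := by
  refine (integral_mono_of_continuous (by fun_prop) (by fun_prop) S.hab fun x hx => ?_).trans
    (h.integral_quad_le hz)
  have hz2 : 0 ≤ 1 - z ^ 2 := by nlinarith [hz.1, hz.2]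
  nlinarith [sq_nonneg (S.X (z, x)), mul_nonneg hz2 (sq_nonneg (S.P (z, x)))]

lemma Small.integral_P_le (h : S.Small η ε E) {z : ℝ} (hz : z ∈ Icc (0:ℝ) 1) :
    (1 - z) * ∫ x in a..b, S.P (z, x) ^ 2 ≤ 2 * (E + 7 * ε) := by
  rw [← intervalIntegral.integral_const_mul]
  refine (integral_mono_of_continuous (by fun_prop) (by fun_prop) S.hab fun x hx => ?_).trans
    (h.integral_quad_le hz)
  have hz2 : 0 ≤ z * (1 - z) := by nlinarith [hz.1, hz.2]
  nlinarith [sq_nonneg (S.X (z, x)), sq_nonneg (S.Φ (z, x)), mul_nonneg hz2 (sq_nonneg (S.P (z, x)))]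

/-- Lower bound for the quadratic energy on the light cone. -/
lemma Small.quad_cone_lower (h : S.Small η ε E) :
    (∫ x in a..b, S.X (0, x) ^ 2) + (∫ x in a..b, S.Φ (0, x) ^ 2) - 6 * ε -
      4 * η * (E + 7 * ε) ≤
      (∫ x in a..b, S.X (1, x) ^ 2) + ∫ x in a..b, S.Φ (1, x) ^ 2 := by
  have h1 := S.energy_identity zero_le_one le_rfl
  have h2 := abs_le.1 (h.abs_flux_le zero_le_one le_rfl)
  have h3 := integral_le_add_of_continuous (a := a) (b := b)
    (f := fun x => (1 - (1:ℝ) ^ 2) * S.P (1, x) ^ 2 + S.X (1, x) ^ 2 + S.W (1, x))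
    (h := fun x => S.X (1, x) ^ 2) (k := fun x => S.Φ (1, x) ^ 2)
    (by fun_prop) (by fun_prop) (by fun_prop) 1 (1 + η) S.hab (fun x hx => by
      have := abs_le.1 (h.W_le 1 (by simp) x hx)
      nlinarith)
  have h4 := integral_le_add_of_continuous (a := a) (b := b)
    (f := fun x => S.X (0, x) ^ 2) (k := fun x => S.Φ (0, x) ^ 2)
    (h := fun x => S.P (0, x) ^ 2 + S.X (0, x) ^ 2 + S.W (0, x))
    (by fun_prop) (by fun_prop) (by fun_prop) 1 (-(1 - η)) S.hab (fun x hx => by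
      have := abs_le.1 (h.W_le 0 (by simp) x hx)
      nlinarith [sq_nonneg (S.P (0, x))])
  nlinarith [mul_le_mul_of_nonneg_left (h.integral_Φ_le (z := 0) (by simp)) h.η_pos.le,
    mul_le_mul_of_nonneg_left (h.integral_Φ_le (z := 1) (by simp)) h.η_pos.le]

end Sector

namespace Sector

variable {a b : ℝ} (S : Sector a b)

/-- The exponential average of `P` minus `P`. -/
noncomputable def A (p : ℝ × ℝ) : ℝ := expAvg b (fun y => S.P (p.1, y)) p.2 - S.P p

/-- The exponential average of `Pz` minus `Pz`: the `z`-derivative of `A`. -/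
noncomputable def Az (p : ℝ × ℝ) : ℝ := expAvg b (fun y => S.Pz (p.1, y)) p.2 - S.Pz p

/-- The nonlinear error in the equation for `A`. -/
noncomputable def NA (p : ℝ × ℝ) : ℝ := S.N p - expAvg b (fun y => S.N (p.1, y)) p.2

/-- The boundary error in the equation for `A`. -/
def β (z : ℝ) : ℝ := -2 * z * S.P (z, b) + S.X (z, b) + S.Φ (z, b)

@[fun_prop] lemma continuous_A : Continuous S.A := (continuous_expAvg_slice S.cP b).sub S.cP
@[fun_prop] lemma continuous_Az : Continuous S.Az := (continuous_expAvg_slice S.cPz b).sub S.cPz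
@[fun_prop] lemma continuous_NA : Continuous S.NA := S.cN.sub (continuous_expAvg_slice S.cN b)
@[fun_prop] lemma continuous_β : Continuous S.β := by unfold β; fun_prop

lemma hasDerivAt_A_z {z : ℝ} (hz : z ∈ Ioo (0:ℝ) 1) {x : ℝ} (hx : x ∈ Ioo a b) :
    HasDerivAt (fun s => S.A (s, x)) (S.Az (z, x)) z :=
  (hasDerivAt_expAvg_param S.cP S.cPz S.dPz hz (Ioo_subset_Icc_self hx)).sub (S.dPz z hz x hx)

lemma hasDerivAt_A_x {z : ℝ} (hz : z ∈ Icc (0:ℝ) 1) {x : ℝ} (hx : x ∈ Ioo a b) :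
    HasDerivAt (fun y => S.A (z, y)) (S.A (z, x) - S.Y (z, x)) x :=
  (hasDerivAt_expAvg (b := b) (h := fun y => S.P (z, y)) (by fun_prop) x).sub (S.dPx z hz x hx)

lemma A_right (z : ℝ) : S.A (z, b) = - S.P (z, b) := by simp [A, expAvg_right]

lemma expAvg_lin {b : ℝ} {h₁ h₂ h₃ h₄ h₅ h₆ : ℝ → ℝ} (c₁ : Continuous h₁) (c₂ : Continuous h₂)
    (c₃ : Continuous h₃) (c₄ : Continuous h₄) (c₅ : Continuous h₅) (c₆ : Continuous h₆)
    (k₁ k₂ k₃ : ℝ) {x : ℝ} (hx : x ≤ b)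
    (h : ∀ y ∈ Icc x b, k₁ * h₁ y - k₂ * h₂ y + k₃ * h₃ y - h₄ y + h₅ y + h₆ y = 0) :
    k₁ * expAvg b h₁ x - k₂ * expAvg b h₂ x + k₃ * expAvg b h₃ x - expAvg b h₄ x +
      expAvg b h₅ x + expAvg b h₆ x = 0 := by
  have hI : ∀ {u : ℝ → ℝ}, Continuous u →
      IntervalIntegrable (fun y => Real.exp (-y) * u y) volume x b :=
    fun hu => Continuous.intervalIntegrable (by fun_prop) _ _
  have h0 : ∫ y in x..b, ((((((k₁ * (Real.exp (-y) * h₁ y) - k₂ * (Real.exp (-y) * h₂ y)) +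
      k₃ * (Real.exp (-y) * h₃ y)) - Real.exp (-y) * h₄ y) + Real.exp (-y) * h₅ y) +
      Real.exp (-y) * h₆ y)) = 0 := by
    rw [intervalIntegral.integral_congr (g := fun _ => (0:ℝ))]
    · simp
    · intro y hy
      rw [uIcc_of_le hx] at hy
      linear_combination Real.exp (-y) * h y hy
  have i1 := (hI c₁).const_mul k₁
  have i2 := (hI c₂).const_mul k₂
  have i3 := (hI c₃).const_mul k₃
  rw [intervalIntegral.integral_add ((((i1.sub i2).add i3).sub (hI c₄)).add (hI c₅)) (hI c₆),
    intervalIntegral.integral_add (((i1.sub i2).add i3).sub (hI c₄)) (hI c₅),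
    intervalIntegral.integral_sub ((i1.sub i2).add i3) (hI c₄),
    intervalIntegral.integral_add (i1.sub i2) i3,
    intervalIntegral.integral_sub i1 i2, intervalIntegral.integral_const_mul,
    intervalIntegral.integral_const_mul, intervalIntegral.integral_const_mul] at h0
  unfold expAvg
  linear_combination Real.exp x * h0

/-- The equation satisfied by `A`. -/
lemma A_eqn {z : ℝ} (hz : z ∈ Icc (0:ℝ) 1) {x : ℝ} (hx : x ∈ Icc a b) :
    (1 - z ^ 2) * S.Az (z, x) = z * S.A (z, x) - 2 * z * (S.A (z, x) - S.Y (z, x)) - S.X (z, x) -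
      S.Xx (z, x) + Real.exp (x - b) * S.β z + S.NA (z, x) := by
  have h1 := expAvg_lin (b := b) (h₁ := fun y => S.Pz (z, y)) (h₂ := fun y => S.P (z, y))
    (h₃ := fun y => S.Y (z, y)) (h₄ := fun y => S.Xx (z, y)) (h₅ := fun y => S.Φ (z, y))
    (h₆ := fun y => S.N (z, y)) (by fun_prop) (by fun_prop) (by fun_prop) (by fun_prop)
    (by fun_prop) (by fun_prop) (1 - z ^ 2) z (2 * z) hx.2
    (fun y hy => S.eqn z hz y ⟨hx.1.trans hy.1, hy.2⟩)
  have hY := expAvg_deriv (h := fun y => S.P (z, y)) (h' := fun y => S.Y (z, y)) (by fun_prop)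
    (by fun_prop) (S.dPx z hz) hx
  have hXx := expAvg_deriv (h := fun y => S.X (z, y)) (h' := fun y => S.Xx (z, y)) (by fun_prop)
    (by fun_prop) (S.dXx z hz) hx
  have hX := expAvg_deriv (h := fun y => S.Φ (z, y)) (h' := fun y => S.X (z, y)) (by fun_prop)
    (by fun_prop) (S.dΦx z hz) hx
  have h2 := S.eqn z hz x hx
  unfold Az A NA β
  simp only
  linear_combination h1 - h2 - 2 * z * hY + hXx + hX

/-- Energy identity for `A`. -/
lemma A_identity {z₁ : ℝ} (h0 : 0 ≤ z₁) (h1 : z₁ ≤ 1) :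
    (∫ x in a..b, ((1 - z₁ ^ 2) * S.A (z₁, x) ^ 2 + S.X (z₁, x) ^ 2)) -
      (∫ x in a..b, ((1 - (0:ℝ) ^ 2) * S.A (0, x) ^ 2 + S.X (0, x) ^ 2)) +
      ∫ z in (0:ℝ)..z₁, ((2 * z * S.A (z, b) ^ 2 + 2 * S.A (z, b) * S.X (z, b)) -
        (2 * z * S.A (z, a) ^ 2 + 2 * S.A (z, a) * S.X (z, a))) =
    ∫ z in (0:ℝ)..z₁, ∫ x in a..b,
      2 * S.A (z, x) * (Real.exp (x - b) * S.β z + S.NA (z, x)) := by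
  exact rectangle_divergence (z₀ := 0) (z₁ := z₁) (a := a) (b := b)
    (F := fun p => (1 - p.1 ^ 2) * S.A p ^ 2 + S.X p ^ 2)
    (Fz := fun p => -2 * p.1 * S.A p ^ 2 + (1 - p.1 ^ 2) * (2 * S.A p * S.Az p) +
      2 * S.X p * S.Y p)
    (G := fun p => 2 * p.1 * S.A p ^ 2 + 2 * S.A p * S.X p)
    (Gx := fun p => 2 * p.1 * (2 * S.A p * (S.A p - S.Y p)) + 2 * (S.A p - S.Y p) * S.X p +
      2 * S.A p * S.Xx p)
    (H := fun p => 2 * S.A p * (Real.exp (p.2 - b) * S.β p.1 + S.NA p))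
    (by fun_prop) (by fun_prop) (by fun_prop) (by fun_prop) h0 S.hab
    (fun z hz x hx => by
      have hz' : z ∈ Ioo (0:ℝ) 1 := ⟨hz.1, hz.2.trans_le h1⟩
      refine (((((hasDerivAt_id z).pow 2).const_sub 1).mul ((S.hasDerivAt_A_z hz' hx).pow 2)).add
        ((S.dXz z hz' x hx).pow 2)) |>.congr_deriv ?_
      simp)
    (fun z hz x hx => by
      have hz' : z ∈ Icc (0:ℝ) 1 := ⟨hz.1.le, hz.2.le.trans h1⟩
      refine ((((S.hasDerivAt_A_x hz' hx).pow 2).const_mul (2 * z)).add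
        (((S.hasDerivAt_A_x hz' hx).const_mul 2).mul (S.dXx z hz' x hx))).congr_deriv ?_
      simp; ring)
    (fun z hz x hx => by
      have := S.A_eqn ⟨hz.1, hz.2.trans h1⟩ hx
      simp only
      linear_combination 2 * S.A (z, x) * this)

lemma integral_A_sq_le (z : ℝ) :
    ∫ x in a..b, S.A (z, x) ^ 2 ≤ 4 * ∫ x in a..b, S.P (z, x) ^ 2 := by
  have hc : Continuous fun x => expAvg b (fun y => S.P (z, y)) x :=
    continuous_expAvg (by fun_prop)
  have h1 := integral_expAvg_sq_le S.hab (h := fun y => S.P (z, y)) (by fun_prop)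
  have h2 := integral_le_add_of_continuous (a := a) (b := b) (f := fun x => S.A (z, x) ^ 2)
    (h := fun x => expAvg b (fun y => S.P (z, y)) x ^ 2) (k := fun x => S.P (z, x) ^ 2)
    (by fun_prop) (by fun_prop) (by fun_prop) 2 2 S.hab (fun x _ => by
      unfold A
      nlinarith [sq_nonneg (expAvg b (fun y => S.P (z, y)) x + S.P (z, x))])
  linarith

lemma integral_NA_sq_le (z : ℝ) :
    ∫ x in a..b, S.NA (z, x) ^ 2 ≤ 4 * ∫ x in a..b, S.N (z, x) ^ 2 := by
  have hc : Continuous fun x => expAvg b (fun y => S.N (z, y)) x :=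
    continuous_expAvg (by fun_prop)
  have h1 := integral_expAvg_sq_le S.hab (h := fun y => S.N (z, y)) (by fun_prop)
  have h2 := integral_le_add_of_continuous (a := a) (b := b) (f := fun x => S.NA (z, x) ^ 2)
    (h := fun x => expAvg b (fun y => S.N (z, y)) x ^ 2) (k := fun x => S.N (z, x) ^ 2)
    (by fun_prop) (by fun_prop) (by fun_prop) 2 2 S.hab (fun x _ => by
      unfold NA
      nlinarith [sq_nonneg (expAvg b (fun y => S.N (z, y)) x + S.N (z, x))])
  linarith

lemma integral_exp_A_sq_le (z : ℝ) :
    ∫ x in a..b, Real.exp (x - b) * S.A (z, x) ^ 2 ≤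
      3 * ∫ x in a..b, Real.exp (x - b) * S.P (z, x) ^ 2 := by
  have hc : Continuous fun x => expAvg b (fun y => S.P (z, y)) x :=
    continuous_expAvg (by fun_prop)
  have h1 := integral_exp_expAvg_sq_le S.hab (h := fun y => S.P (z, y)) (by fun_prop)
  have h2 := integral_le_add_of_continuous (a := a) (b := b)
    (f := fun x => Real.exp (x - b) * S.A (z, x) ^ 2)
    (h := fun x => Real.exp (x - b) * expAvg b (fun y => S.P (z, y)) x ^ 2)
    (k := fun x => Real.exp (x - b) * S.P (z, x) ^ 2)
    (by fun_prop) (by fun_prop) (by fun_prop) 2 2 S.hab (fun x _ => by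
      unfold A
      have := mul_nonneg (Real.exp_pos (x - b)).le
        (sq_nonneg (expAvg b (fun y => S.P (z, y)) x + S.P (z, x)))
      nlinarith)
  linarith

lemma A_left_sq_le (z : ℝ) :
    S.A (z, a) ^ 2 ≤ 2 * (∫ x in a..b, Real.exp (a - x) * S.P (z, x) ^ 2) +
      2 * S.P (z, a) ^ 2 := by
  have h1 := expAvg_left_sq_le S.hab (h := fun y => S.P (z, y)) (by fun_prop)
  unfold A
  nlinarith [sq_nonneg (expAvg b (fun y => S.P (z, y)) a + S.P (z, a))]

variable {S} {η ε E : ℝ}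

lemma Small.abs_A_flux_le (h : S.Small η ε E) {z₁ : ℝ} (h0 : 0 ≤ z₁) (h1 : z₁ ≤ 1) :
    |∫ z in (0:ℝ)..z₁, ((2 * z * S.A (z, b) ^ 2 + 2 * S.A (z, b) * S.X (z, b)) -
        (2 * z * S.A (z, a) ^ 2 + 2 * S.A (z, a) * S.X (z, a)))| ≤ 15 * ε := by
  have hk : Continuous fun z => ∫ x in a..b, Real.exp (a - x) * S.P (z, x) ^ 2 :=
    continuous_integral_slice (f := fun p => Real.exp (a - p.2) * S.P p ^ 2) (by fun_prop) a b
  refine (abs_integral_le_of_abs_le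
    (h := fun z => (3 * (S.P (z, b) ^ 2 + S.X (z, b) ^ 2 + S.Φ (z, b) ^ 2) +
      6 * (S.P (z, a) ^ 2 + S.X (z, a) ^ 2 + S.Φ (z, a) ^ 2)) +
      6 * ∫ x in a..b, Real.exp (a - x) * S.P (z, x) ^ 2)
    (by fun_prop) (by fun_prop) h0 h1 fun z hz => ?_).trans ?_
  · have hA := S.A_left_sq_le z
    rw [S.A_right, abs_le]
    constructor <;> nlinarith [hz.1, hz.2, sq_nonneg (S.P (z, b) + S.X (z, b)),
      sq_nonneg (S.P (z, b) - S.X (z, b)), sq_nonneg (S.A (z, a) + S.X (z, a)),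
      sq_nonneg (S.A (z, a) - S.X (z, a)), mul_nonneg hz.1 (sq_nonneg (S.A (z, a))),
      mul_nonneg hz.1 (sq_nonneg (S.P (z, b))),
      mul_nonneg (sub_nonneg.2 hz.2) (sq_nonneg (S.A (z, a))),
      mul_nonneg (sub_nonneg.2 hz.2) (sq_nonneg (S.P (z, b))),
      sq_nonneg (S.Φ (z, a)), sq_nonneg (S.Φ (z, b)), sq_nonneg (S.X (z, a)),
      sq_nonneg (S.X (z, b))]
  · rw [intervalIntegral.integral_add (Continuous.intervalIntegrable (by fun_prop) _ _)
      (Continuous.intervalIntegrable (by fun_prop) _ _),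
      intervalIntegral.integral_add (Continuous.intervalIntegrable (by fun_prop) _ _)
      (Continuous.intervalIntegrable (by fun_prop) _ _), intervalIntegral.integral_const_mul,
      intervalIntegral.integral_const_mul, intervalIntegral.integral_const_mul]
    linarith [h.bdry_left, h.bdry_right, h.kin_left]

lemma integral_exp_sub_le (a b : ℝ) : ∫ x in a..b, Real.exp (x - b) ≤ 1 := by
  rw [intervalIntegral.integral_comp_sub_right (fun x => Real.exp x), integral_exp]
  simp [Real.exp_nonneg]

lemma Small.abs_β_term_le (h : S.Small η ε E) {z₁ : ℝ} (h0 : 0 ≤ z₁) (h1 : z₁ ≤ 1) :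
    |∫ z in (0:ℝ)..z₁, ∫ x in a..b, 2 * S.A (z, x) * (Real.exp (x - b) * S.β z)| ≤ 15 * ε := by
  have hk : Continuous fun z => ∫ x in a..b, Real.exp (x - b) * S.P (z, x) ^ 2 :=
    continuous_integral_slice (f := fun p => Real.exp (p.2 - b) * S.P p ^ 2) (by fun_prop) a b
  have hc : Continuous fun z => ∫ x in a..b, 2 * S.A (z, x) * (Real.exp (x - b) * S.β z) :=
    continuous_integral_slice
      (f := fun p => 2 * S.A p * (Real.exp (p.2 - b) * S.β p.1)) (by fun_prop) a b
  refine (abs_integral_le_of_abs_le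
    (h := fun z => 3 * (∫ x in a..b, Real.exp (x - b) * S.P (z, x) ^ 2) +
      12 * (S.P (z, b) ^ 2 + S.X (z, b) ^ 2 + S.Φ (z, b) ^ 2))
    hc (by fun_prop) h0 h1 fun z hz => ?_).trans ?_
  · refine (intervalIntegral.abs_integral_le_integral_abs S.hab).trans ?_
    refine (integral_le_add_of_continuous (h := fun x => Real.exp (x - b) * S.A (z, x) ^ 2)
      (k := fun x => Real.exp (x - b)) (by fun_prop) (by fun_prop) (by fun_prop) 1 (S.β z ^ 2)
      S.hab (fun x _ => ?_)).trans ?_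
    · have e := (Real.exp_pos (x - b)).le
      rw [abs_le]
      constructor <;> nlinarith [mul_nonneg e (sq_nonneg (S.A (z, x) + S.β z)),
        mul_nonneg e (sq_nonneg (S.A (z, x) - S.β z))]
    · have h2 := integral_exp_sub_le a b
      have h3 := S.integral_exp_A_sq_le z
      have h4 : S.β z ^ 2 ≤ 12 * (S.P (z, b) ^ 2 + S.X (z, b) ^ 2 + S.Φ (z, b) ^ 2) := by
        have h5 : S.β z ^ 2 ≤
            3 * (4 * (z ^ 2 * S.P (z, b) ^ 2) + S.X (z, b) ^ 2 + S.Φ (z, b) ^ 2) := by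
          unfold β
          nlinarith [sq_nonneg (-2 * z * S.P (z, b) - S.X (z, b)),
            sq_nonneg (-2 * z * S.P (z, b) - S.Φ (z, b)), sq_nonneg (S.X (z, b) - S.Φ (z, b))]
        have h6 : z ^ 2 ≤ 1 := by nlinarith [hz.1, hz.2]
        nlinarith [mul_le_mul_of_nonneg_right h6 (sq_nonneg (S.P (z, b))), sq_nonneg (S.X (z, b)),
          sq_nonneg (S.Φ (z, b))]
      nlinarith [mul_le_mul_of_nonneg_left h2 (sq_nonneg (S.β z))]
  · rw [intervalIntegral.integral_add (Continuous.intervalIntegrable (by fun_prop) _ _)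
      (Continuous.intervalIntegrable (by fun_prop) _ _), intervalIntegral.integral_const_mul,
      intervalIntegral.integral_const_mul]
    linarith [h.bdry_right, h.kin_right]

end Sector

lemma abs_integral_le_of_le_inv_sqrt {f : ℝ → ℝ} (hf : Continuous f) {c z₁ : ℝ} (hc : 0 ≤ c)
    (h0 : 0 ≤ z₁) (h1 : z₁ < 1) (hle : ∀ z ∈ Icc (0:ℝ) z₁, |f z| ≤ c / √(1 - z)) :
    |∫ z in (0:ℝ)..z₁, f z| ≤ 2 * c := by
  have hco : ContinuousOn (fun z => c / √(1 - z)) (uIcc 0 z₁) := by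
    apply ContinuousOn.div continuousOn_const (Continuous.continuousOn (by fun_prop))
    intro z hz
    rw [uIcc_of_le h0] at hz
    exact (Real.sqrt_pos.2 (by linarith [hz.2])).ne'
  have h2 : ∫ z in (0:ℝ)..z₁, c / √(1 - z) = -2 * c * √(1 - z₁) - -2 * c * √(1 - 0) := by
    apply intervalIntegral.integral_eq_sub_of_hasDerivAt (f := fun z => -2 * c * √(1 - z))
    · intro z hz
      rw [uIcc_of_le h0] at hz
      have hz1 : 0 < 1 - z := by linarith [hz.2]
      refine ((((hasDerivAt_id z).const_sub 1).sqrt hz1.ne').const_mul (-2 * c)).congr_deriv ?_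
      have := (Real.sqrt_pos.2 hz1).ne'
      simp only [id]
      field_simp
    · exact hco.intervalIntegrable
  refine (intervalIntegral.abs_integral_le_integral_abs h0).trans ?_
  refine (intervalIntegral.integral_mono_on h0 (hf.abs.intervalIntegrable _ _)
    hco.intervalIntegrable hle).trans ?_
  rw [h2]
  simp
  positivity

namespace Sector

variable {a b : ℝ} {S : Sector a b} {η ε E : ℝ}

lemma Small.abs_N_term_le (h : S.Small η ε E) {z₁ : ℝ} (h0 : 0 ≤ z₁) (h1 : z₁ < 1) :
    |∫ z in (0:ℝ)..z₁, ∫ x in a..b, 2 * S.A (z, x) * S.NA (z, x)| ≤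
      32 * η * (E + 7 * ε) := by
  have hη := h.η_pos
  have hM : 0 ≤ E + 7 * ε := by linarith [h.energy_nonneg, h.ε_nonneg]
  have hc : Continuous fun z => ∫ x in a..b, 2 * S.A (z, x) * S.NA (z, x) :=
    continuous_integral_slice (f := fun p => 2 * S.A p * S.NA p) (by fun_prop) a b
  have := abs_integral_le_of_le_inv_sqrt (c := 16 * η * (E + 7 * ε)) hc (by positivity) h0 h1 ?_
  · linarith
  intro z hz
  have hz' : z ∈ Icc (0:ℝ) 1 := ⟨hz.1, hz.2.trans h1.le⟩
  have hs : 0 < √(1 - z) := Real.sqrt_pos.2 (by linarith [hz.2])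
  have hss : √(1 - z) ^ 2 = 1 - z := Real.sq_sqrt (by linarith [hz.2])
  set s := √(1 - z)
  refine (intervalIntegral.abs_integral_le_integral_abs S.hab).trans ?_
  refine (integral_le_add_of_continuous (h := fun x => S.A (z, x) ^ 2)
      (k := fun x => S.NA (z, x) ^ 2) (by fun_prop) (by fun_prop) (by fun_prop) (η * s)
      (1 / (η * s)) S.hab (fun x _ => ?_)).trans ?_
  · have hηs : 0 < η * s := by positivity
    have e1 : η * s * S.A (z, x) ^ 2 + 1 / (η * s) * S.NA (z, x) ^ 2 -
        2 * S.A (z, x) * S.NA (z, x) = (η * s * S.A (z, x) - S.NA (z, x)) ^ 2 / (η * s) := by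
      field_simp; ring
    have e2 : η * s * S.A (z, x) ^ 2 + 1 / (η * s) * S.NA (z, x) ^ 2 +
        2 * S.A (z, x) * S.NA (z, x) = (η * s * S.A (z, x) + S.NA (z, x)) ^ 2 / (η * s) := by
      field_simp; ring
    have p1 : 0 ≤ (η * s * S.A (z, x) - S.NA (z, x)) ^ 2 / (η * s) := by positivity
    have p2 : 0 ≤ (η * s * S.A (z, x) + S.NA (z, x)) ^ 2 / (η * s) := by positivity
    rw [abs_le]
    constructor <;> linarith
  · have hA := S.integral_A_sq_le z
    have hP := h.integral_P_le hz'
    have hN := S.integral_NA_sq_le z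
    have hΦ := h.integral_Φ_le hz'
    have hN2 : ∫ x in a..b, S.N (z, x) ^ 2 ≤ η ^ 2 * ∫ x in a..b, S.Φ (z, x) ^ 2 := by
      rw [← intervalIntegral.integral_const_mul]
      refine integral_mono_of_continuous (by fun_prop) (by fun_prop) S.hab fun x hx => ?_
      have := h.N_le z hz' x hx
      rw [← sq_abs (S.N (z, x)), ← sq_abs (S.Φ (z, x)), ← mul_pow]
      gcongr
    set IA := ∫ x in a..b, S.A (z, x) ^ 2
    set IN := ∫ x in a..b, S.NA (z, x) ^ 2
    have t1 : IA ≤ 8 * (E + 7 * ε) / s ^ 2 := by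
      rw [le_div_iff₀ (by positivity), hss]
      nlinarith [mul_le_mul_of_nonneg_left hA (sub_nonneg.2 hz'.2)]
    have t2 : IN ≤ 8 * η ^ 2 * (E + 7 * ε) := by
      nlinarith [mul_le_mul_of_nonneg_left hΦ (sq_nonneg η)]
    calc η * s * IA + 1 / (η * s) * IN
        ≤ η * s * (8 * (E + 7 * ε) / s ^ 2) + 1 / (η * s) * (8 * η ^ 2 * (E + 7 * ε)) := by
          gcongr
      _ = 16 * η * (E + 7 * ε) / s := by field_simp; ring

/-- Almost conservation of the energy of `A`. -/
lemma Small.abs_A_energy_sub_le (h : S.Small η ε E) {z : ℝ} (hz : z ∈ Icc (0:ℝ) 1) :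
    |(∫ x in a..b, ((1 - z ^ 2) * S.A (z, x) ^ 2 + S.X (z, x) ^ 2)) -
      (∫ x in a..b, ((1 - (0:ℝ) ^ 2) * S.A (0, x) ^ 2 + S.X (0, x) ^ 2))| ≤
      30 * ε + 32 * η * (E + 7 * ε) := by
  have hlt : ∀ z ∈ Ico (0:ℝ) 1,
      |(∫ x in a..b, ((1 - z ^ 2) * S.A (z, x) ^ 2 + S.X (z, x) ^ 2)) -
      (∫ x in a..b, ((1 - (0:ℝ) ^ 2) * S.A (0, x) ^ 2 + S.X (0, x) ^ 2))| ≤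
      30 * ε + 32 * η * (E + 7 * ε) := by
    intro z hz
    have h1 := S.A_identity hz.1 hz.2.le
    have h2 := abs_le.1 (h.abs_A_flux_le hz.1 hz.2.le)
    have h3 := abs_le.1 (h.abs_β_term_le hz.1 hz.2.le)
    have h4 := abs_le.1 (h.abs_N_term_le hz.1 hz.2)
    have h5 : ∫ z in (0:ℝ)..z, ∫ x in a..b,
        2 * S.A (z, x) * (Real.exp (x - b) * S.β z + S.NA (z, x)) =
        (∫ z in (0:ℝ)..z, ∫ x in a..b, 2 * S.A (z, x) * (Real.exp (x - b) * S.β z)) +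
        ∫ z in (0:ℝ)..z, ∫ x in a..b, 2 * S.A (z, x) * S.NA (z, x) := by
      rw [← intervalIntegral.integral_add
        ((continuous_integral_slice (f := fun p => 2 * S.A p * (Real.exp (p.2 - b) * S.β p.1))
          (by fun_prop) a b).intervalIntegrable _ _)
        ((continuous_integral_slice (f := fun p => 2 * S.A p * S.NA p)
          (by fun_prop) a b).intervalIntegrable _ _)]
      congr 1; ext z
      rw [← intervalIntegral.integral_add (Continuous.intervalIntegrable (by fun_prop) _ _)
        (Continuous.intervalIntegrable (by fun_prop) _ _)]
      congr 1; ext x; ring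
    rw [abs_le]
    constructor <;> linarith
  have hc : Continuous fun z : ℝ =>
      |(∫ x in a..b, ((1 - z ^ 2) * S.A (z, x) ^ 2 + S.X (z, x) ^ 2)) -
      (∫ x in a..b, ((1 - (0:ℝ) ^ 2) * S.A (0, x) ^ 2 + S.X (0, x) ^ 2))| :=
    ((continuous_integral_slice (f := fun p => (1 - p.1 ^ 2) * S.A p ^ 2 + S.X p ^ 2)
      (by fun_prop) a b).sub continuous_const).abs
  have hcl : closure (Ico (0:ℝ) 1) ⊆ {z | |(∫ x in a..b, ((1 - z ^ 2) * S.A (z, x) ^ 2 +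
      S.X (z, x) ^ 2)) - (∫ x in a..b, ((1 - (0:ℝ) ^ 2) * S.A (0, x) ^ 2 + S.X (0, x) ^ 2))| ≤
      30 * ε + 32 * η * (E + 7 * ε)} :=
    closure_minimal hlt (isClosed_le hc continuous_const)
  rw [closure_Ico (by norm_num)] at hcl
  exact hcl hz

lemma Small.integral_X_le (h : S.Small η ε E) {z : ℝ} (hz : z ∈ Icc (0:ℝ) 1) :
    ∫ x in a..b, S.X (z, x) ^ 2 ≤
      (∫ x in a..b, S.X (0, x) ^ 2) + 34 * ε + 32 * η * (E + 7 * ε) := by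
  have h1 := abs_le.1 (h.abs_A_energy_sub_le hz)
  have h2 : ∫ x in a..b, S.X (z, x) ^ 2 ≤
      ∫ x in a..b, ((1 - z ^ 2) * S.A (z, x) ^ 2 + S.X (z, x) ^ 2) :=
    integral_mono_of_continuous (by fun_prop) (by fun_prop) S.hab fun x _ => by
      have : 0 ≤ 1 - z ^ 2 := by nlinarith [hz.1, hz.2]
      nlinarith [mul_nonneg this (sq_nonneg (S.A (z, x)))]
  have h3 : ∫ x in a..b, ((1 - (0:ℝ) ^ 2) * S.A (0, x) ^ 2 + S.X (0, x) ^ 2) =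
      (∫ x in a..b, S.A (0, x) ^ 2) + ∫ x in a..b, S.X (0, x) ^ 2 := by
    rw [← intervalIntegral.integral_add (Continuous.intervalIntegrable (by fun_prop) _ _)
        (Continuous.intervalIntegrable (by fun_prop) _ _)]
    congr 1; ext x; ring
  linarith [S.integral_A_sq_le 0, h.initial]

lemma Small.integral_X_one_ge (h : S.Small η ε E) :
    (∫ x in a..b, S.X (0, x) ^ 2) - 30 * ε - 32 * η * (E + 7 * ε) ≤
      ∫ x in a..b, S.X (1, x) ^ 2 := by
  have h1 := abs_le.1 (h.abs_A_energy_sub_le (z := 1) (by simp))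
  have h2 : ∫ x in a..b, S.X (0, x) ^ 2 ≤
      ∫ x in a..b, ((1 - (0:ℝ) ^ 2) * S.A (0, x) ^ 2 + S.X (0, x) ^ 2) :=
    integral_mono_of_continuous (by fun_prop) (by fun_prop) S.hab fun x _ => by
      nlinarith [sq_nonneg (S.A (0, x))]
  have h3 : ∫ x in a..b, ((1 - (1:ℝ) ^ 2) * S.A (1, x) ^ 2 + S.X (1, x) ^ 2) =
      ∫ x in a..b, S.X (1, x) ^ 2 := by
    congr 1; ext x; ring
  linarith

end Sector

lemma hasDerivAt_quartic (c₀ c₁ c₂ c₃ c₄ z : ℝ) :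
    HasDerivAt (fun z => c₀ + c₁ * z + c₂ * z ^ 2 + c₃ * z ^ 3 + c₄ * z ^ 4)
      (c₁ + 2 * c₂ * z + 3 * c₃ * z ^ 2 + 4 * c₄ * z ^ 3) z := by
  refine ((((((hasDerivAt_id z).const_mul c₁).const_add c₀).add
    (((hasDerivAt_id z).pow 2).const_mul c₂)).add
    (((hasDerivAt_id z).pow 3).const_mul c₃)).add
    (((hasDerivAt_id z).pow 4).const_mul c₄)).congr_deriv ?_
  simp; ring

lemma abs_mul_mul_le {c C u v : ℝ} (hc : |c| ≤ C) : |c * u * v| ≤ C / 2 * (u ^ 2 + v ^ 2) := by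
  have h1 : |u| * |v| ≤ (u ^ 2 + v ^ 2) / 2 := by
    nlinarith [sq_nonneg (|u| - |v|), sq_abs u, sq_abs v]
  have hC : 0 ≤ C := (abs_nonneg c).trans hc
  calc |c * u * v| = |c| * (|u| * |v|) := by rw [abs_mul, abs_mul, mul_assoc]
    _ ≤ C * ((u ^ 2 + v ^ 2) / 2) := by gcongr
    _ = _ := by ring

/-- Polynomial weight in front of `Φ` in the multiplier of the multiplier identity. -/
def weightM (z : ℝ) : ℝ := 3 + 6 * z + 9 * z ^ 2 + (-8) * z ^ 3 + 0 * z ^ 4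
/-- Polynomial weight in front of `X` in the multiplier of the multiplier identity. -/
def weightN (z : ℝ) : ℝ := 18 + 0 * z + 6 * z ^ 2 + (-4) * z ^ 3 + 0 * z ^ 4
/-- Polynomial weight in front of `Φ ^ 2` in the density of the multiplier identity. -/
def weightS (z : ℝ) : ℝ :=
  6 + 15 * z + (-36) * z ^ 2 + (-27) * z ^ 3 + 32 * z ^ 4
/-- Polynomial weight in front of the energy density in the multiplier identity. -/
def weightE (z : ℝ) : ℝ :=
  7 + (-3) * z + (-3) * z ^ 2 + (-3) * z ^ 3 + 2 * z ^ 4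

@[fun_prop] lemma continuous_weightM : Continuous weightM := by unfold weightM; fun_prop
@[fun_prop] lemma continuous_weightN : Continuous weightN := by unfold weightN; fun_prop
@[fun_prop] lemma continuous_weightS : Continuous weightS := by unfold weightS; fun_prop
@[fun_prop] lemma continuous_weightE : Continuous weightE := by unfold weightE; fun_prop

lemma weightM_bounds {z : ℝ} (hz : z ∈ Icc (0:ℝ) 1) : |weightM z| ≤ 18 := by
  obtain ⟨h0, h1⟩ := hz
  have h2 : 0 ≤ z ^ 2 * (1 - z) := by have := sub_nonneg.2 h1; positivity
  have h3 : z ^ 2 ≤ 1 := by nlinarith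
  have h4 : 0 ≤ z ^ 3 := by positivity
  rw [abs_le]; unfold weightM
  constructor <;> nlinarith

lemma weightN_bounds {z : ℝ} (hz : z ∈ Icc (0:ℝ) 1) : |weightN z| ≤ 24 := by
  obtain ⟨h0, h1⟩ := hz
  have h2 : 0 ≤ z ^ 2 * (1 - z) := by have := sub_nonneg.2 h1; positivity
  have h3 : z ^ 2 ≤ 1 := by nlinarith
  have h4 : 0 ≤ z ^ 3 := by positivity
  rw [abs_le]; unfold weightN
  constructor <;> nlinarith

lemma weightE_bounds {z : ℝ} (hz : z ∈ Icc (0:ℝ) 1) : |weightE z| ≤ 12 * (1 - z) := by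
  obtain ⟨h0, h1⟩ := hz
  have h3 : z ^ 2 ≤ 1 := by nlinarith
  have h2 : 0 ≤ z ^ 2 * (1 - z) := by have := sub_nonneg.2 h1; positivity
  have h4 : 0 ≤ z ^ 3 := by positivity
  have e : weightE z = (7 + 4 * z + z ^ 2 - 2 * z ^ 3) * (1 - z) := by unfold weightE; ring
  rw [e, abs_mul, abs_of_nonneg (sub_nonneg.2 h1)]
  refine mul_le_mul_of_nonneg_right ?_ (sub_nonneg.2 h1)
  rw [abs_le]
  constructor <;> nlinarith

namespace Sector

variable {a b : ℝ} (S : Sector a b)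

/-- The density in the multiplier identity. -/
noncomputable def multF (p : ℝ × ℝ) : ℝ :=
  weightM p.1 * (1 - p.1 ^ 2) * (S.Φ p * S.P p) - 1 / 2 * (weightS p.1 * S.Φ p ^ 2) +
  weightN p.1 * (1 - p.1 ^ 2) * (S.X p * S.P p) + weightN p.1 * p.1 * S.X p ^ 2 +
  weightE p.1 * ((1 - p.1 ^ 2) * S.P p ^ 2 + S.X p ^ 2 + S.Φ p ^ 2)

/-- The flux in the multiplier identity. -/
noncomputable def multG (p : ℝ × ℝ) : ℝ :=
  2 * weightM p.1 * p.1 * (S.Φ p * S.P p) - weightM p.1 * (S.Φ p * S.X p) -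
  weightN p.1 * (1 - p.1 ^ 2) / 2 * S.P p ^ 2 - weightN p.1 / 2 * S.X p ^ 2 +
  weightN p.1 / 2 * S.Φ p ^ 2 + weightE p.1 * (2 * p.1 * S.P p ^ 2 - 2 * (S.P p * S.X p))

/-- The bulk term in the multiplier identity. -/
noncomputable def multH (p : ℝ × ℝ) : ℝ :=
  -(27 / 2 - 24 * p.1 - 45 / 2 * p.1 ^ 2 + 48 * p.1 ^ 3) * S.Φ p ^ 2 + 12 * (1 - p.1) * S.X p ^ 2 -
  (weightM p.1 * S.Φ p + weightN p.1 * S.X p + 2 * weightE p.1 * S.P p) * S.N p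

@[fun_prop] lemma continuous_multF : Continuous S.multF := by unfold multF; fun_prop
@[fun_prop] lemma continuous_multG : Continuous S.multG := by unfold multG; fun_prop
@[fun_prop] lemma continuous_multH : Continuous S.multH := by unfold multH; fun_prop

lemma mult_identity :
    (∫ x in a..b, S.multF (1, x)) - (∫ x in a..b, S.multF (0, x)) +
      ∫ z in (0:ℝ)..1, (S.multG (z, b) - S.multG (z, a)) =
    ∫ z in (0:ℝ)..1, ∫ x in a..b, S.multH (z, x) := by
  refine rectangle_divergence (F := S.multF) (G := S.multG) (H := S.multH)
    (Fz := fun p =>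
      ((6 + 2 * 9 * p.1 + 3 * (-8) * p.1 ^ 2 + 4 * 0 * p.1 ^ 3) * (1 - p.1 ^ 2) +
        weightM p.1 * (-(2 * p.1))) * (S.Φ p * S.P p) +
      weightM p.1 * (1 - p.1 ^ 2) * (S.P p * S.P p + S.Φ p * S.Pz p) -
      1 / 2 * ((15 + 2 * (-36) * p.1 + 3 * (-27) * p.1 ^ 2 + 4 * 32 * p.1 ^ 3) * S.Φ p ^ 2 +
        weightS p.1 * (2 * S.Φ p * S.P p)) +
      (((0 + 2 * 6 * p.1 + 3 * (-4) * p.1 ^ 2 + 4 * 0 * p.1 ^ 3) * (1 - p.1 ^ 2) +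
        weightN p.1 * (-(2 * p.1))) * (S.X p * S.P p) +
      weightN p.1 * (1 - p.1 ^ 2) * (S.Y p * S.P p + S.X p * S.Pz p)) +
      (((0 + 2 * 6 * p.1 + 3 * (-4) * p.1 ^ 2 + 4 * 0 * p.1 ^ 3) * p.1 +
        weightN p.1) * S.X p ^ 2 + weightN p.1 * p.1 * (2 * S.X p * S.Y p)) +
      ((-3 + 2 * (-3) * p.1 + 3 * (-3) * p.1 ^ 2 + 4 * 2 * p.1 ^ 3) *
        ((1 - p.1 ^ 2) * S.P p ^ 2 + S.X p ^ 2 + S.Φ p ^ 2) +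
      weightE p.1 * (-(2 * p.1) * S.P p ^ 2 + (1 - p.1 ^ 2) * (2 * S.P p * S.Pz p) +
        2 * S.X p * S.Y p + 2 * S.Φ p * S.P p)))
    (Gx := fun p => 2 * weightM p.1 * p.1 * (S.X p * S.P p + S.Φ p * S.Y p) -
      weightM p.1 * (S.X p * S.X p + S.Φ p * S.Xx p) -
      weightN p.1 * (1 - p.1 ^ 2) / 2 * (2 * S.P p * S.Y p) -
      weightN p.1 / 2 * (2 * S.X p * S.Xx p) + weightN p.1 / 2 * (2 * S.Φ p * S.X p) +
      weightE p.1 * (2 * p.1 * (2 * S.P p * S.Y p) - 2 * (S.Y p * S.X p + S.P p * S.Xx p)))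
    (by fun_prop) (by fun_prop) (by fun_prop) (by fun_prop) zero_le_one S.hab ?_ ?_ ?_
  · intro z hz x hx
    have hΦ := S.dΦz z hz x hx
    have hP := S.dPz z hz x hx
    have hX := S.dXz z hz x hx
    have hM : HasDerivAt weightM _ z := hasDerivAt_quartic 3 6 9 (-8) 0 z
    have hN : HasDerivAt weightN _ z := hasDerivAt_quartic 18 0 6 (-4) 0 z
    have hS : HasDerivAt weightS _ z := hasDerivAt_quartic 6 15 (-36) (-27) 32 z
    have hE : HasDerivAt weightE _ z := hasDerivAt_quartic 7 (-3) (-3) (-3) 2 z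
    have hq : HasDerivAt (fun z : ℝ => 1 - z ^ 2) (-(2 * z)) z := by
      simpa using ((hasDerivAt_id z).pow 2).const_sub 1
    refine ((((((hM.mul hq).mul (hΦ.mul hP)).sub ((hS.mul (hΦ.pow 2)).const_mul (1 / 2))).add
      ((hN.mul hq).mul (hX.mul hP))).add ((hN.mul (hasDerivAt_id z)).mul (hX.pow 2))).add
      (hE.mul (((hq.mul (hP.pow 2)).add (hX.pow 2)).add (hΦ.pow 2)))).congr_deriv ?_
    simp
  · intro z hz x hx
    have hz' : z ∈ Icc (0:ℝ) 1 := ⟨hz.1.le, hz.2.le⟩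
    have hΦ := S.dΦx z hz' x hx
    have hP := S.dPx z hz' x hx
    have hX := S.dXx z hz' x hx
    refine (((((((hΦ.mul hP).const_mul (2 * weightM z * z)).sub
      ((hΦ.mul hX).const_mul (weightM z))).sub
      ((hP.pow 2).const_mul (weightN z * (1 - z ^ 2) / 2))).sub
      ((hX.pow 2).const_mul (weightN z / 2))).add
      ((hΦ.pow 2).const_mul (weightN z / 2))).add
      ((((hP.pow 2).const_mul (2 * z)).sub ((hP.mul hX).const_mul 2)).const_mul
        (weightE z))).congr_deriv ?_
    simp
  · intro z hz x hx
    have := S.eqn z hz x hx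
    unfold multH weightM weightN weightS weightE
    simp only
    linear_combination ((3 + 6 * z + 9 * z ^ 2 - 8 * z ^ 3) * S.Φ (z, x) +
      (18 + 6 * z ^ 2 - 4 * z ^ 3) * S.X (z, x) +
      2 * (7 - 3 * z - 3 * z ^ 2 - 3 * z ^ 3 + 2 * z ^ 4) * S.P (z, x)) * this

lemma abs_multG_le {z : ℝ} (hz : z ∈ Icc (0:ℝ) 1) (x : ℝ) :
    |S.multG (z, x)| ≤ 60 * (S.P (z, x) ^ 2 + S.X (z, x) ^ 2 + S.Φ (z, x) ^ 2) := by
  have hM := weightM_bounds hz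
  have hN := weightN_bounds hz
  have hE := weightE_bounds hz
  have hE' : |weightE z| ≤ 12 := hE.trans (by linarith [hz.1])
  have hz0 : |z| ≤ 1 := abs_le.2 ⟨by linarith [hz.1], hz.2⟩
  have hz2 : |1 - z ^ 2| ≤ 1 := abs_le.2 ⟨by nlinarith [hz.1, hz.2], by nlinarith [hz.1]⟩
  have c1 : |2 * weightM z * z| ≤ 36 := by
    rw [abs_mul, abs_mul, abs_of_pos (show (0:ℝ) < 2 by norm_num)]
    nlinarith [abs_nonneg z, abs_nonneg (weightM z)]
  have c2 : |weightN z * (1 - z ^ 2)| ≤ 24 := by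
    rw [abs_mul]; nlinarith [abs_nonneg (1 - z ^ 2), abs_nonneg (weightN z)]
  have c3 : |weightE z * z| ≤ 3 := by
    rw [abs_mul, abs_of_nonneg hz.1]
    nlinarith [mul_le_mul_of_nonneg_right hE hz.1, sq_nonneg (2 * z - 1)]
  have b1 := abs_le.1 (abs_mul_mul_le (u := S.Φ (z, x)) (v := S.P (z, x)) c1)
  have b2 := abs_le.1 (abs_mul_mul_le (u := S.Φ (z, x)) (v := S.X (z, x)) hM)
  have b3 := abs_le.1 (abs_mul_mul_le (u := S.P (z, x)) (v := S.P (z, x)) c2)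
  have b4 := abs_le.1 (abs_mul_mul_le (u := S.X (z, x)) (v := S.X (z, x)) hN)
  have b5 := abs_le.1 (abs_mul_mul_le (u := S.Φ (z, x)) (v := S.Φ (z, x)) hN)
  have b6 := abs_le.1 (abs_mul_mul_le (u := S.P (z, x)) (v := S.P (z, x)) c3)
  have b7 := abs_le.1 (abs_mul_mul_le (u := S.P (z, x)) (v := S.X (z, x)) hE')
  unfold multG
  rw [abs_le]
  constructor <;> nlinarith [sq_nonneg (S.P (z, x)), sq_nonneg (S.X (z, x)), sq_nonneg (S.Φ (z, x))]

variable {S} {η ε E : ℝ}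

lemma Small.multH_le (h : S.Small η ε E) {z x : ℝ} (hz : z ∈ Icc (0:ℝ) 1) (hx : x ∈ Icc a b) :
    S.multH (z, x) ≤ 12 * (1 - z) * S.X (z, x) ^ 2 +
      42 * η * ((1 - z ^ 2) * S.P (z, x) ^ 2 + S.X (z, x) ^ 2 + S.Φ (z, x) ^ 2) := by
  have hM := weightM_bounds hz
  have hN := weightN_bounds hz
  have hE := weightE_bounds hz
  have h1z := sub_nonneg.2 hz.2
  have hNl := h.N_le z hz x hx
  have hη := h.η_pos
  have hpoly : 0 ≤ 27 / 2 - 24 * z - 45 / 2 * z ^ 2 + 48 * z ^ 3 := by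
    nlinarith [mul_nonneg hz.1 (sq_nonneg (4 * z - 3)), mul_nonneg hz.1 (sq_nonneg (z - 3 / 5)),
      sq_nonneg (z - 3 / 5), hz.1, sq_nonneg (5 * z - 3)]
  have key : |(weightM z * S.Φ (z, x) + weightN z * S.X (z, x) + 2 * weightE z * S.P (z, x)) *
      S.N (z, x)| ≤ η * (42 *
        ((1 - z ^ 2) * S.P (z, x) ^ 2 + S.X (z, x) ^ 2 + S.Φ (z, x) ^ 2)) := by
    have t : |weightM z * S.Φ (z, x) + weightN z * S.X (z, x) + 2 * weightE z * S.P (z, x)| ≤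
        18 * |S.Φ (z, x)| + 24 * |S.X (z, x)| + 24 * (1 - z) * |S.P (z, x)| := by
      refine (abs_add_three _ _ _).trans ?_
      rw [abs_mul, abs_mul, abs_mul, abs_mul, abs_of_pos (show (0:ℝ) < 2 by norm_num)]
      have e1 := mul_le_mul_of_nonneg_right hM (abs_nonneg (S.Φ (z, x)))
      have e2 := mul_le_mul_of_nonneg_right hN (abs_nonneg (S.X (z, x)))
      have e3 := mul_le_mul_of_nonneg_right hE (abs_nonneg (S.P (z, x)))
      linarith
    rw [abs_mul]
    calc _ ≤ (18 * |S.Φ (z, x)| + 24 * |S.X (z, x)| + 24 * (1 - z) * |S.P (z, x)|) *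
          (η * |S.Φ (z, x)|) := by gcongr
      _ = η * ((18 * |S.Φ (z, x)| + 24 * |S.X (z, x)| + 24 * (1 - z) * |S.P (z, x)|) *
          |S.Φ (z, x)|) := by ring
      _ ≤ _ := by
        refine mul_le_mul_of_nonneg_left ?_ hη.le
        rw [← sq_abs (S.P (z, x)), ← sq_abs (S.X (z, x)), ← sq_abs (S.Φ (z, x))]
        generalize |S.P (z, x)| = p
        generalize |S.X (z, x)| = q
        generalize |S.Φ (z, x)| = r
        nlinarith [sq_nonneg (q - r), sq_nonneg ((1 - z) * p - r),
          mul_nonneg (mul_nonneg hz.1 h1z) (sq_nonneg p), sq_nonneg q]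
  have := abs_le.1 key
  unfold multH
  simp only
  nlinarith [mul_nonneg hpoly (sq_nonneg (S.Φ (z, x)))]

/-- The channel estimate: the initial data of a small sector solution with small time derivative
and small boundary terms are small. -/
theorem Small.initial_data_le (h : S.Small η ε E) :
    (∫ x in a..b, S.X (0, x) ^ 2) + (∫ x in a..b, S.Φ (0, x) ^ 2) ≤
      1300 * (ε + η * (E + 7 * ε)) := by
  have h1 := S.mult_identity
  have hη := h.η_pos
  have hM : 0 ≤ E + 7 * ε := by linarith [h.energy_nonneg, h.ε_nonneg]
  have hflux : |∫ z in (0:ℝ)..1, (S.multG (z, b) - S.multG (z, a))| ≤ 120 * ε := by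
    refine (abs_integral_le_of_abs_le
      (h := fun z => 60 * (S.P (z, b) ^ 2 + S.X (z, b) ^ 2 + S.Φ (z, b) ^ 2) +
        60 * (S.P (z, a) ^ 2 + S.X (z, a) ^ 2 + S.Φ (z, a) ^ 2))
      (by fun_prop) (by fun_prop) zero_le_one le_rfl fun z hz => ?_).trans ?_
    · exact (abs_sub _ _).trans (add_le_add (S.abs_multG_le hz b) (S.abs_multG_le hz a))
    · rw [intervalIntegral.integral_add (Continuous.intervalIntegrable (by fun_prop) _ _)
        (Continuous.intervalIntegrable (by fun_prop) _ _), intervalIntegral.integral_const_mul,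
        intervalIntegral.integral_const_mul]
      linarith [h.bdry_left, h.bdry_right]
  have hend : ∫ x in a..b, S.multF (1, x) =
      20 * (∫ x in a..b, S.X (1, x) ^ 2) + 5 * ∫ x in a..b, S.Φ (1, x) ^ 2 := by
    rw [← intervalIntegral.integral_const_mul, ← intervalIntegral.integral_const_mul,
      ← intervalIntegral.integral_add (Continuous.intervalIntegrable (by fun_prop) _ _)
        (Continuous.intervalIntegrable (by fun_prop) _ _)]
    congr 1; ext x
    unfold multF weightM weightN weightS weightE
    simp only
    ring
  have hstart : ∫ x in a..b, S.multF (0, x) ≤ 8 * (∫ x in a..b, S.X (0, x) ^ 2) +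
      17 / 4 * (∫ x in a..b, S.Φ (0, x) ^ 2) + 97 * ε := by
    refine (integral_le_add_of_continuous
      (h := fun x => 8 * S.X (0, x) ^ 2 + 17 / 4 * S.Φ (0, x) ^ 2)
      (k := fun x => S.P (0, x) ^ 2) (by fun_prop) (by fun_prop) (by fun_prop) 1 97 S.hab
      (fun x _ => ?_)).trans ?_
    · unfold multF weightM weightN weightS weightE
      simp only
      nlinarith [sq_nonneg (S.Φ (0, x) - 6 * S.P (0, x)), sq_nonneg (S.X (0, x) - 9 * S.P (0, x))]
    · rw [intervalIntegral.integral_add (Continuous.intervalIntegrable (by fun_prop) _ _)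
        (Continuous.intervalIntegrable (by fun_prop) _ _), intervalIntegral.integral_const_mul,
        intervalIntegral.integral_const_mul]
      linarith [h.initial]
  set X0 := ∫ x in a..b, S.X (0, x) ^ 2
  have hbulk : ∫ z in (0:ℝ)..1, ∫ x in a..b, S.multH (z, x) ≤
      6 * (X0 + 34 * ε + 32 * η * (E + 7 * ε)) + 84 * η * (E + 7 * ε) := by
    refine (integral_mono_of_continuous
      (h := fun z => 12 * (1 - z) * (X0 + 34 * ε + 32 * η * (E + 7 * ε)) +
        84 * η * (E + 7 * ε))
      (continuous_integral_slice S.continuous_multH a b) (by fun_prop) zero_le_one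
      fun z hz => ?_).trans ?_
    · refine (integral_le_add_of_continuous (h := fun x => S.X (z, x) ^ 2)
        (k := fun x => (1 - z ^ 2) * S.P (z, x) ^ 2 + S.X (z, x) ^ 2 + S.Φ (z, x) ^ 2)
        (by fun_prop) (by fun_prop) (by fun_prop) (12 * (1 - z)) (42 * η) S.hab
        (fun x hx => h.multH_le hz hx)).trans ?_
      have e1 := mul_le_mul_of_nonneg_left (h.integral_X_le hz)
        (show 0 ≤ 12 * (1 - z) by linarith [hz.2])
      have e2 := mul_le_mul_of_nonneg_left (h.integral_quad_le hz) (show 0 ≤ 42 * η by linarith)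
      linarith
    · have : ∀ c d : ℝ, ∫ z in (0:ℝ)..1, (12 * (1 - z) * c + d) = 6 * c + d := by
        intro c d
        rw [intervalIntegral.integral_eq_sub_of_hasDerivAt
          (f := fun z => 12 * c * z - 6 * c * z ^ 2 + d * z)]
        · ring
        · intro z _
          refine ((((hasDerivAt_id z).const_mul (12 * c)).sub
            (((hasDerivAt_id z).pow 2).const_mul (6 * c))).add
            ((hasDerivAt_id z).const_mul d)).congr_deriv ?_
          simp; ring
        · exact Continuous.intervalIntegrable (by fun_prop) _ _
      rw [this]
  have h2 := h.quad_cone_lower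
  have h3 := h.integral_X_one_ge
  have h4 : 0 ≤ X0 := integral_nonneg_of_continuous S.hab fun _ _ => sq_nonneg _
  have h5 : 0 ≤ η * (E + 7 * ε) := by positivity
  have h6 := abs_le.1 hflux
  linarith [h.ε_nonneg]

end Sector

lemma exists_le_integral_unit {h : ℝ → ℝ} (hh : Continuous h) (c : ℝ) :
    ∃ x ∈ Icc c (c + 1), h x ≤ ∫ y in c..(c + 1), h y := by
  obtain ⟨x, hx, hmin⟩ := isCompact_Icc.exists_isMinOn (nonempty_Icc.2 (by linarith : c ≤ c + 1))
    hh.continuousOn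
  refine ⟨x, hx, ?_⟩
  have := integral_mono_of_continuous (f := fun _ => h x) (h := h) (a := c) (b := c + 1)
    (by fun_prop) hh (by linarith) fun y hy => hmin hy
  simpa using this

lemma window_pointwise {r d φ m z θ : ℝ} (r1 : 0 ≤ r ^ 2) (r2 : r ^ 2 ≤ 6) (r3 : d ^ 2 ≤ 9)
    (hs : φ ^ 2 ≤ θ ^ 2) (hn : -(1 / 4 * φ ^ 2) ≤ φ * m) (z0 : 0 ≤ z) (z1 : z ≤ 1) (p q : ℝ) :
    r ^ 2 * ((1 - z ^ 2) * p ^ 2 - φ ^ 2 / 2 + 2 * z * q * p - q ^ 2 - φ * m) +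
      2 * r * d * (2 * z * φ * p - φ * q) ≤
      42 * p ^ 2 + 54 * θ ^ 2 - 1 / 2 * (r ^ 2 * q ^ 2) := by
  have zz : z ^ 2 ≤ 1 := by nlinarith
  have e1 : r ^ 2 * (2 * z * q * p) ≤ r ^ 2 * (q ^ 2 / 4 + 4 * p ^ 2) := by
    refine mul_le_mul_of_nonneg_left ?_ r1
    nlinarith [sq_nonneg (q / 2 - 2 * z * p), mul_le_mul_of_nonneg_right zz (sq_nonneg p)]
  have e2 : 2 * r * d * (2 * z * φ * p) ≤ 2 * (r ^ 2 * p ^ 2) + 2 * (d ^ 2 * φ ^ 2) := by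
    have h1 := sq_nonneg (r * p - z * d * φ)
    have h2 := mul_le_mul_of_nonneg_right zz (mul_nonneg (sq_nonneg d) (sq_nonneg φ))
    ring_nf at h1 h2 ⊢
    linarith
  have e3 : -(2 * r * d * (φ * q)) ≤ r ^ 2 * q ^ 2 / 4 + 4 * (d ^ 2 * φ ^ 2) := by
    have h1 := sq_nonneg (r * q / 2 + 2 * d * φ)
    ring_nf at h1 ⊢
    linarith
  have e4 : r ^ 2 * (-(φ * m)) ≤ r ^ 2 * (1 / 4 * φ ^ 2) :=
    mul_le_mul_of_nonneg_left (by linarith) r1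
  have e5 : r ^ 2 * ((1 - z ^ 2) * p ^ 2) ≤ r ^ 2 * p ^ 2 := by
    refine mul_le_mul_of_nonneg_left ?_ r1
    nlinarith [mul_nonneg (sq_nonneg z) (sq_nonneg p)]
  have e6 := mul_le_mul_of_nonneg_right r2 (sq_nonneg p)
  have e7 := mul_le_mul_of_nonneg_right r3 (sq_nonneg φ)
  have e8 := mul_nonneg r1 (sq_nonneg φ)
  ring_nf at e1 e2 e3 e4 e5 e6 e7 e8 ⊢
  linarith

namespace Sector

variable {y : ℝ} (S : Sector y (y + 3))

/-- Local multiplier identity with a cutoff vanishing at both ends of the window. -/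
lemma window_identity :
    (∫ x in y..(y + 3), ((x - y) * (y + 3 - x)) ^ 2 *
        ((1 - (1:ℝ) ^ 2) * S.Φ (1, x) * S.P (1, x) + 1 / 2 * S.Φ (1, x) ^ 2)) -
      (∫ x in y..(y + 3), ((x - y) * (y + 3 - x)) ^ 2 *
        ((1 - (0:ℝ) ^ 2) * S.Φ (0, x) * S.P (0, x) + 0 / 2 * S.Φ (0, x) ^ 2)) =
    ∫ z in (0:ℝ)..1, ∫ x in y..(y + 3), (((x - y) * (y + 3 - x)) ^ 2 *
      ((1 - z ^ 2) * S.P (z, x) ^ 2 - S.Φ (z, x) ^ 2 / 2 + 2 * z * S.X (z, x) * S.P (z, x) -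
        S.X (z, x) ^ 2 - S.Φ (z, x) * S.N (z, x)) +
      2 * ((x - y) * (y + 3 - x)) * (2 * y + 3 - 2 * x) *
        (2 * z * S.Φ (z, x) * S.P (z, x) - S.Φ (z, x) * S.X (z, x))) := by
  have := rectangle_divergence (z₀ := 0) (z₁ := 1) (a := y) (b := y + 3)
    (F := fun p => ((p.2 - y) * (y + 3 - p.2)) ^ 2 *
      ((1 - p.1 ^ 2) * S.Φ p * S.P p + p.1 / 2 * S.Φ p ^ 2))
    (Fz := fun p => ((p.2 - y) * (y + 3 - p.2)) ^ 2 *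
      ((-(2 * p.1) * S.Φ p + (1 - p.1 ^ 2) * S.P p) * S.P p + (1 - p.1 ^ 2) * S.Φ p * S.Pz p +
        (1 / 2 * S.Φ p ^ 2 + p.1 / 2 * (2 * S.Φ p * S.P p))))
    (G := fun p => ((p.2 - y) * (y + 3 - p.2)) ^ 2 *
      (2 * p.1 * (S.Φ p * S.P p) - S.Φ p * S.X p))
    (Gx := fun p => 2 * ((p.2 - y) * (y + 3 - p.2)) * ((y + 3 - p.2) - (p.2 - y)) *
      (2 * p.1 * (S.Φ p * S.P p) - S.Φ p * S.X p) + ((p.2 - y) * (y + 3 - p.2)) ^ 2 *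
      (2 * p.1 * (S.X p * S.P p + S.Φ p * S.Y p) - (S.X p * S.X p + S.Φ p * S.Xx p)))
    (H := fun p => ((p.2 - y) * (y + 3 - p.2)) ^ 2 *
      ((1 - p.1 ^ 2) * S.P p ^ 2 - S.Φ p ^ 2 / 2 + 2 * p.1 * S.X p * S.P p -
        S.X p ^ 2 - S.Φ p * S.N p) +
      2 * ((p.2 - y) * (y + 3 - p.2)) * (2 * y + 3 - 2 * p.2) *
        (2 * p.1 * S.Φ p * S.P p - S.Φ p * S.X p))
    (by fun_prop) (by fun_prop) (by fun_prop) (by fun_prop) zero_le_one S.hab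
    (fun z hz x hx => by
      have hΦ := S.dΦz z hz x hx
      have hP := S.dPz z hz x hx
      have hq : HasDerivAt (fun z : ℝ => 1 - z ^ 2) (-(2 * z)) z := by
        simpa using ((hasDerivAt_id z).pow 2).const_sub 1
      refine ((((hq.mul hΦ).mul hP).add
        (((hasDerivAt_id z).div_const 2).mul (hΦ.pow 2))).const_mul
        (((x - y) * (y + 3 - x)) ^ 2)).congr_deriv ?_
      simp)
    (fun z hz x hx => by
      have hz' : z ∈ Icc (0:ℝ) 1 := ⟨hz.1.le, hz.2.le⟩
      have hΦ := S.dΦx z hz' x hx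
      have hP := S.dPx z hz' x hx
      have hX := S.dXx z hz' x hx
      have hρ : HasDerivAt (fun x => (x - y) * (y + 3 - x)) ((y + 3 - x) - (x - y)) x := by
        refine (((hasDerivAt_id x).sub_const y).mul
          ((hasDerivAt_id x).const_sub (y + 3))).congr_deriv ?_
        simp only [id]
        ring
      refine ((hρ.pow 2).mul (((hΦ.mul hP).const_mul (2 * z)).sub (hΦ.mul hX))).congr_deriv ?_
      simp only [Pi.mul_apply, Pi.pow_apply, Pi.sub_apply]
      push_cast
      ring)
    (fun z hz x hx => by
      have := S.eqn z hz x hx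
      simp only
      linear_combination ((x - y) * (y + 3 - x)) ^ 2 * S.Φ (z, x) * this)
  simpa using this

/-- A good point in the window: control of all first derivatives on a ray `x = const`. -/
lemma window_good_point {θ K ε : ℝ}
    (hΦ : ∀ z ∈ Icc (0:ℝ) 1, ∀ x ∈ Icc y (y + 3), |S.Φ (z, x)| ≤ θ)
    (hN : ∀ z ∈ Icc (0:ℝ) 1, ∀ x ∈ Icc y (y + 3), |S.N (z, x)| ≤ 1 / 4 * |S.Φ (z, x)|)
    (hK : ∫ z in (0:ℝ)..1, ∫ x in y..(y + 3), S.P (z, x) ^ 2 ≤ K)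
    (hε : ∫ x in y..(y + 3), S.P (0, x) ^ 2 ≤ ε) :
    ∃ x ∈ Icc (y + 1) (y + 2),
      ∫ z in (0:ℝ)..1, (S.P (z, x) ^ 2 + S.X (z, x) ^ 2 + S.Φ (z, x) ^ 2) ≤
        25 * K + 2 * ε + 100 * θ ^ 2 := by
  have hy : y ≤ y + 3 := by linarith
  have hsq : ∀ z ∈ Icc (0:ℝ) 1, ∀ x ∈ Icc y (y + 3), S.Φ (z, x) ^ 2 ≤ θ ^ 2 := by
    intro z hz x hx
    rw [← sq_abs]; gcongr; exact hΦ z hz x hx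
  have h1 := S.window_identity
  have hρ : ∀ x ∈ Icc y (y + 3), 0 ≤ ((x - y) * (y + 3 - x)) ^ 2 ∧
      ((x - y) * (y + 3 - x)) ^ 2 ≤ 6 ∧ (2 * y + 3 - 2 * x) ^ 2 ≤ 9 := by
    intro x hx
    have a1 : 0 ≤ (x - y) * (y + 3 - x) := mul_nonneg (by linarith [hx.1]) (by linarith [hx.2])
    have a2 : (x - y) * (y + 3 - x) ≤ 9 / 4 := by nlinarith [sq_nonneg (2 * (x - y) - 3)]
    exact ⟨sq_nonneg _, by nlinarith, by nlinarith [hx.1, hx.2]⟩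
  have hend : 0 ≤ ∫ x in y..(y + 3), ((x - y) * (y + 3 - x)) ^ 2 *
        ((1 - (1:ℝ) ^ 2) * S.Φ (1, x) * S.P (1, x) + 1 / 2 * S.Φ (1, x) ^ 2) :=
    integral_nonneg_of_continuous hy fun x hx => by
      have := (hρ x hx).1
      have e : ((1 - (1:ℝ) ^ 2) * S.Φ (1, x) * S.P (1, x) + 1 / 2 * S.Φ (1, x) ^ 2) =
        1 / 2 * S.Φ (1, x) ^ 2 := by ring
      rw [e]; positivity
  have hstart : ∫ x in y..(y + 3), ((x - y) * (y + 3 - x)) ^ 2 *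
        ((1 - (0:ℝ) ^ 2) * S.Φ (0, x) * S.P (0, x) + 0 / 2 * S.Φ (0, x) ^ 2) ≤
        3 * ε + 9 * θ ^ 2 := by
    refine (integral_le_add_of_continuous (h := fun x => S.P (0, x) ^ 2) (k := fun _ => θ ^ 2)
      (by fun_prop) (by fun_prop) (by fun_prop) 3 3 hy (fun x hx => ?_)).trans ?_
    · obtain ⟨r1, r2, -⟩ := hρ x hx
      generalize ((x - y) * (y + 3 - x)) ^ 2 = q at r1 r2
      have := hsq 0 (by simp) x hx
      nlinarith [mul_nonneg r1 (sq_nonneg (S.Φ (0, x) - S.P (0, x))),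
        mul_le_mul_of_nonneg_right r2 (sq_nonneg (S.Φ (0, x))),
        mul_le_mul_of_nonneg_right r2 (sq_nonneg (S.P (0, x)))]
    · rw [intervalIntegral.integral_const, smul_eq_mul]
      linarith
  have hbulk : ∫ z in (0:ℝ)..1, ∫ x in y..(y + 3), (((x - y) * (y + 3 - x)) ^ 2 *
      ((1 - z ^ 2) * S.P (z, x) ^ 2 - S.Φ (z, x) ^ 2 / 2 + 2 * z * S.X (z, x) * S.P (z, x) -
        S.X (z, x) ^ 2 - S.Φ (z, x) * S.N (z, x)) +
      2 * ((x - y) * (y + 3 - x)) * (2 * y + 3 - 2 * x) *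
        (2 * z * S.Φ (z, x) * S.P (z, x) - S.Φ (z, x) * S.X (z, x))) ≤
      42 * K + 162 * θ ^ 2 - 2 * ∫ z in (0:ℝ)..1, ∫ x in (y + 1)..(y + 1 + 1), S.X (z, x) ^ 2 := by
    have hcP := continuous_integral_slice (f := fun p => S.P p ^ 2) (by fun_prop) y (y + 3)
    have hcX := continuous_integral_slice (f := fun p => S.X p ^ 2) (by fun_prop) (y + 1) (y + 1 + 1)
    refine (integral_le_add_of_continuous
      (h := fun z => (∫ x in y..(y + 3), S.P (z, x) ^ 2))
      (k := fun z => 162 * θ ^ 2 - 2 * ∫ x in (y + 1)..(y + 1 + 1), S.X (z, x) ^ 2)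
      (continuous_integral_slice (f := fun p => ((p.2 - y) * (y + 3 - p.2)) ^ 2 *
      ((1 - p.1 ^ 2) * S.P p ^ 2 - S.Φ p ^ 2 / 2 + 2 * p.1 * S.X p * S.P p -
        S.X p ^ 2 - S.Φ p * S.N p) +
      2 * ((p.2 - y) * (y + 3 - p.2)) * (2 * y + 3 - 2 * p.2) *
        (2 * p.1 * S.Φ p * S.P p - S.Φ p * S.X p)) (by fun_prop) y (y + 3)) hcP
      (by fun_prop) 42 1 zero_le_one (fun z hz => ?_)).trans ?_
    · have hmid : 4 * ∫ x in (y + 1)..(y + 1 + 1), S.X (z, x) ^ 2 ≤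
          ∫ x in y..(y + 3), ((x - y) * (y + 3 - x)) ^ 2 * S.X (z, x) ^ 2 := by
        rw [← intervalIntegral.integral_const_mul]
        refine (integral_mono_of_continuous
          (h := fun x => ((x - y) * (y + 3 - x)) ^ 2 * S.X (z, x) ^ 2)
          (by fun_prop) (by fun_prop) (by linarith) fun x hx => ?_).trans ?_
        · have : 2 ≤ (x - y) * (y + 3 - x) := by nlinarith [hx.1, hx.2]
          have : 4 ≤ ((x - y) * (y + 3 - x)) ^ 2 := by nlinarith
          exact mul_le_mul_of_nonneg_right this (sq_nonneg _)
        · apply intervalIntegral.integral_mono_interval (by linarith) (by linarith) (by linarith)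
          · exact Eventually.of_forall fun x => by positivity
          · exact Continuous.intervalIntegrable (by fun_prop) _ _
      have hpt := integral_le_add_of_continuous
        (f := fun x => ((x - y) * (y + 3 - x)) ^ 2 *
          ((1 - z ^ 2) * S.P (z, x) ^ 2 - S.Φ (z, x) ^ 2 / 2 + 2 * z * S.X (z, x) * S.P (z, x) -
            S.X (z, x) ^ 2 - S.Φ (z, x) * S.N (z, x)) +
          2 * ((x - y) * (y + 3 - x)) * (2 * y + 3 - 2 * x) *
            (2 * z * S.Φ (z, x) * S.P (z, x) - S.Φ (z, x) * S.X (z, x)))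
        (h := fun x => 42 * S.P (z, x) ^ 2 + 54 * θ ^ 2)
        (k := fun x => ((x - y) * (y + 3 - x)) ^ 2 * S.X (z, x) ^ 2)
        (by fun_prop) (by fun_prop) (by fun_prop) 1 (-(1 / 2)) hy (fun x hx => by
          obtain ⟨r1, r2, r3⟩ := hρ x hx
          have hs := hsq z hz x hx
          have hn : |S.Φ (z, x) * S.N (z, x)| ≤ 1 / 4 * S.Φ (z, x) ^ 2 := by
            rw [abs_mul, ← sq_abs]
            nlinarith [hN z hz x hx, abs_nonneg (S.Φ (z, x))]
          have := window_pointwise (m := S.N (z, x)) r1 r2 r3 hs (abs_le.1 hn).1 hz.1 hz.2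
            (S.P (z, x)) (S.X (z, x))
          linarith)
      have hsum : ∫ x in y..(y + 3), (42 * S.P (z, x) ^ 2 + 54 * θ ^ 2) =
          42 * (∫ x in y..(y + 3), S.P (z, x) ^ 2) + 162 * θ ^ 2 := by
        rw [intervalIntegral.integral_add (Continuous.intervalIntegrable (by fun_prop) _ _)
          (Continuous.intervalIntegrable (by fun_prop) _ _), intervalIntegral.integral_const_mul,
          intervalIntegral.integral_const, smul_eq_mul]
        ring
      rw [hsum] at hpt
      simp only
      linarith
    · rw [intervalIntegral.integral_sub (Continuous.intervalIntegrable (by fun_prop) _ _)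
          (Continuous.intervalIntegrable (by fun_prop) _ _), intervalIntegral.integral_const,
          intervalIntegral.integral_const_mul, smul_eq_mul]
      linarith
  have hXmid : ∫ z in (0:ℝ)..1, ∫ x in (y + 1)..(y + 1 + 1), S.X (z, x) ^ 2 ≤
      (42 * K + 3 * ε + 171 * θ ^ 2) / 2 := by linarith
  have hK0 : 0 ≤ K := le_trans (intervalIntegral.integral_nonneg zero_le_one fun z _ =>
    integral_nonneg_of_continuous hy fun _ _ => sq_nonneg _) hK
  have hPmid : ∫ z in (0:ℝ)..1, ∫ x in (y + 1)..(y + 1 + 1), S.P (z, x) ^ 2 ≤ K := by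
    refine le_trans (integral_mono_of_continuous
      (continuous_integral_slice (f := fun p => S.P p ^ 2) (by fun_prop) _ _)
      (continuous_integral_slice (f := fun p => S.P p ^ 2) (by fun_prop) _ _)
      zero_le_one fun z _ => ?_) hK
    apply intervalIntegral.integral_mono_interval (by linarith) (by linarith) (by linarith)
    · exact Eventually.of_forall fun x => sq_nonneg _
    · exact Continuous.intervalIntegrable (by fun_prop) _ _
  have hc : Continuous fun x => ∫ z in (0:ℝ)..1,
      (S.P (z, x) ^ 2 + S.X (z, x) ^ 2 + S.Φ (z, x) ^ 2) :=
    continuous_integral_slice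
      (f := fun p => S.P (p.2, p.1) ^ 2 + S.X (p.2, p.1) ^ 2 + S.Φ (p.2, p.1) ^ 2)
      (by fun_prop) 0 1
  obtain ⟨x, hx, hle⟩ := exists_le_integral_unit hc (y + 1)
  refine ⟨x, ⟨hx.1, by linarith [hx.2]⟩, hle.trans ?_⟩
  rw [← intervalIntegral_swap_of_continuous
    (f := fun p => S.P p ^ 2 + S.X p ^ 2 + S.Φ p ^ 2) (by fun_prop)]
  refine (integral_le_add_of_continuous
    (h := fun z => ∫ x in (y + 1)..(y + 1 + 1), S.P (z, x) ^ 2)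
    (k := fun z => (∫ x in (y + 1)..(y + 1 + 1), S.X (z, x) ^ 2) + θ ^ 2)
    (continuous_integral_slice (f := fun p => S.P p ^ 2 + S.X p ^ 2 + S.Φ p ^ 2)
      (by fun_prop) _ _)
    (continuous_integral_slice (f := fun p => S.P p ^ 2) (by fun_prop) _ _)
    ((continuous_integral_slice (f := fun p => S.X p ^ 2) (by fun_prop) _ _).add
      continuous_const) 1 1 zero_le_one (fun z hz => ?_)).trans ?_
  · rw [intervalIntegral.integral_add (Continuous.intervalIntegrable (by fun_prop) _ _)
      (Continuous.intervalIntegrable (by fun_prop) _ _),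
      intervalIntegral.integral_add (Continuous.intervalIntegrable (by fun_prop) _ _)
      (Continuous.intervalIntegrable (by fun_prop) _ _)]
    have := integral_mono_of_continuous (f := fun x => S.Φ (z, x) ^ 2) (h := fun _ => θ ^ 2)
      (a := y + 1) (b := y + 1 + 1) (by fun_prop) (by fun_prop) (by linarith)
      fun x hx => hsq z hz x ⟨by linarith [hx.1], by linarith [hx.2]⟩
    simp at this
    linarith
  · rw [intervalIntegral.integral_add ((continuous_integral_slice (f := fun p => S.X p ^ 2)
      (by fun_prop) _ _).intervalIntegrable _ _) (Continuous.intervalIntegrable (by fun_prop) _ _)]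
    simp only [intervalIntegral.integral_const, smul_eq_mul]
    have hε0 : 0 ≤ ε := (integral_nonneg_of_continuous hy fun _ _ => sq_nonneg _).trans hε
    nlinarith [sq_nonneg θ]

end Sector

/-- Cauchy–Schwarz inequality against the constant function. -/
lemma sq_integral_le_of_continuous {h : ℝ → ℝ} (hh : Continuous h) {a b : ℝ} (hab : a ≤ b) :
    (∫ x in a..b, h x) ^ 2 ≤ (b - a) * ∫ x in a..b, h x ^ 2 := by
  rcases hab.eq_or_lt with rfl | hlt
  · simp
  set I := ∫ x in a..b, h x with hI
  have h1 := integral_le_add_of_continuous (f := fun _ => 2 * (b - a) * I * 0 - I ^ 2)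
    (h := fun x => h x ^ 2) (k := h) (by fun_prop) (by fun_prop) hh ((b - a) ^ 2)
    (-(2 * (b - a) * I)) hab (fun x _ => by nlinarith [sq_nonneg ((b - a) * h x - I)])
  rw [intervalIntegral.integral_const, smul_eq_mul, ← hI] at h1
  have h2 : (b - a) * I ^ 2 ≤ (b - a) * ((b - a) * ∫ x in a..b, h x ^ 2) := by nlinarith
  exact le_of_mul_le_mul_left h2 (by linarith)

/-- A finite-energy equivariant wave map in the coordinates `(t, x)`, `r = e^x`, on
`[0,T] × ℝ`, together with its first and second derivatives and bounds for its energy and for its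
time-averaged kinetic energy. -/
structure WaveSol (g : ℝ → ℝ) (T b₀ E ε : ℝ) where
  (u ut ux utt utx uxx : ℝ × ℝ → ℝ)
  T_pos : 0 < T
  cu : Continuous u
  cut : Continuous ut
  cux : Continuous ux
  cutt : Continuous utt
  cutx : Continuous utx
  cuxx : Continuous uxx
  grad_u : ∀ t ∈ Ioo 0 T, ∀ x, HasFDerivAt u
    (ut (t, x) • ContinuousLinearMap.fst ℝ ℝ ℝ + ux (t, x) • ContinuousLinearMap.snd ℝ ℝ ℝ) (t, x)
  grad_ut : ∀ t ∈ Ioo 0 T, ∀ x, HasFDerivAt ut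
    (utt (t, x) • ContinuousLinearMap.fst ℝ ℝ ℝ + utx (t, x) • ContinuousLinearMap.snd ℝ ℝ ℝ) (t, x)
  grad_ux : ∀ t ∈ Ioo 0 T, ∀ x, HasFDerivAt ux
    (utx (t, x) • ContinuousLinearMap.fst ℝ ℝ ℝ + uxx (t, x) • ContinuousLinearMap.snd ℝ ℝ ℝ) (t, x)
  dx_u : ∀ t x, HasDerivAt (fun y => u (t, y)) (ux (t, x)) x
  dx_ut : ∀ t x, HasDerivAt (fun y => ut (t, y)) (utx (t, x)) x
  dx_ux : ∀ t x, HasDerivAt (fun y => ux (t, y)) (uxx (t, x)) x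
  eqn : ∀ t ∈ Icc 0 T, ∀ x, Real.exp (2 * x) * utt (t, x) - uxx (t, x) +
    g (u (t, x)) * deriv g (u (t, x)) = 0
  energy : ∀ t ∈ Icc 0 T, ∀ a b, a ≤ b →
    ∫ x in a..b, (Real.exp (2 * x) * ut (t, x) ^ 2 + ux (t, x) ^ 2 + g (u (t, x)) ^ 2) ≤ E
  kin : ∀ μ, 0 < μ → μ ≤ T → ∀ a b, a ≤ b → b ≤ b₀ →
    ∫ t in (0:ℝ)..μ, ∫ x in a..b, Real.exp (2 * x) * ut (t, x) ^ 2 ≤ μ * ε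

lemma HasFDerivAt.hasDerivAt_comp_pair {F : ℝ × ℝ → ℝ} {α β s c' d' : ℝ} {c d : ℝ → ℝ}
    (hF : HasFDerivAt F (α • ContinuousLinearMap.fst ℝ ℝ ℝ + β • ContinuousLinearMap.snd ℝ ℝ ℝ)
      (c s, d s)) (hc : HasDerivAt c c' s) (hd : HasDerivAt d d' s) :
    HasDerivAt (fun s => F (c s, d s)) (α * c' + β * d') s := by
  have := hF.comp_hasDerivAt s (hc.prodMk hd)
  refine this.congr_deriv ?_
  simp

lemma HasFDerivAt.comp_scale_add {F : ℝ × ℝ → ℝ} {α β c y t x : ℝ}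
    (hF : HasFDerivAt F (α • ContinuousLinearMap.fst ℝ ℝ ℝ + β • ContinuousLinearMap.snd ℝ ℝ ℝ)
      (c * t, x + y)) :
    HasFDerivAt (fun p : ℝ × ℝ => F (c * p.1, p.2 + y))
      ((c * α) • ContinuousLinearMap.fst ℝ ℝ ℝ + β • ContinuousLinearMap.snd ℝ ℝ ℝ) (t, x) := by
  have h1 : HasFDerivAt (fun p : ℝ × ℝ => (c * p.1, p.2 + y))
      ((c • ContinuousLinearMap.fst ℝ ℝ ℝ).prod (ContinuousLinearMap.snd ℝ ℝ ℝ)) (t, x) :=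
    (hasFDerivAt_fst.const_mul c).prodMk (hasFDerivAt_snd.add_const y)
  have h2 := HasFDerivAt.comp (t, x) (g := F) hF h1
  refine h2.congr_fderiv ?_
  ext <;> simp [mul_comm]

namespace WaveSol

variable {g : ℝ → ℝ} {T b₀ E ε : ℝ}

attribute [fun_prop] cu cut cux cutt cutx cuxx

section

variable (S : WaveSol g T b₀ E ε)

lemma dt_u {t : ℝ} (ht : t ∈ Ioo 0 T) (x : ℝ) : HasDerivAt (fun s => S.u (s, x)) (S.ut (t, x)) t := by
  simpa using (S.grad_u t ht x).hasDerivAt_comp_pair (hasDerivAt_id t) (hasDerivAt_const t x)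

lemma dt_ut {t : ℝ} (ht : t ∈ Ioo 0 T) (x : ℝ) :
    HasDerivAt (fun s => S.ut (s, x)) (S.utt (t, x)) t := by
  simpa using (S.grad_ut t ht x).hasDerivAt_comp_pair (hasDerivAt_id t) (hasDerivAt_const t x)

lemma dt_ux {t : ℝ} (ht : t ∈ Ioo 0 T) (x : ℝ) :
    HasDerivAt (fun s => S.ux (s, x)) (S.utx (t, x)) t := by
  simpa using (S.grad_ux t ht x).hasDerivAt_comp_pair (hasDerivAt_id t) (hasDerivAt_const t x)

lemma exp_mul_mem_Icc {y t : ℝ} (ht : t ∈ Icc 0 (T * Real.exp (-y))) :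
    Real.exp y * t ∈ Icc 0 T := by
  have h : Real.exp y * (T * Real.exp (-y)) = T := by
    rw [mul_left_comm, ← Real.exp_add]; simp
  exact ⟨mul_nonneg (Real.exp_pos y).le ht.1,
    (mul_le_mul_of_nonneg_left ht.2 (Real.exp_pos y).le).trans h.le⟩

lemma exp_mul_mem_Ioo {y t : ℝ} (ht : t ∈ Ioo 0 (T * Real.exp (-y))) :
    Real.exp y * t ∈ Ioo 0 T := by
  have h : Real.exp y * (T * Real.exp (-y)) = T := by
    rw [mul_left_comm, ← Real.exp_add]; simp
  exact ⟨mul_pos (Real.exp_pos y) ht.1,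
    (mul_lt_mul_of_pos_left ht.2 (Real.exp_pos y)).trans_le h.le⟩

/-- Rescaling by `e^y`. -/
noncomputable def shift (y : ℝ) : WaveSol g (T * Real.exp (-y)) (b₀ - y) E ε where
  u p := S.u (Real.exp y * p.1, p.2 + y)
  ut p := Real.exp y * S.ut (Real.exp y * p.1, p.2 + y)
  ux p := S.ux (Real.exp y * p.1, p.2 + y)
  utt p := Real.exp y ^ 2 * S.utt (Real.exp y * p.1, p.2 + y)
  utx p := Real.exp y * S.utx (Real.exp y * p.1, p.2 + y)
  uxx p := S.uxx (Real.exp y * p.1, p.2 + y)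
  T_pos := mul_pos S.T_pos (Real.exp_pos _)
  cu := by fun_prop
  cut := by fun_prop
  cux := by fun_prop
  cutt := by fun_prop
  cutx := by fun_prop
  cuxx := by fun_prop
  grad_u t ht x := (S.grad_u _ (exp_mul_mem_Ioo ht) (x + y)).comp_scale_add
  grad_ut t ht x := by
    refine ((S.grad_ut _ (exp_mul_mem_Ioo ht) (x + y)).comp_scale_add.const_mul
      (Real.exp y)).congr_fderiv ?_
    ext <;> simp; ring
  grad_ux t ht x := (S.grad_ux _ (exp_mul_mem_Ioo ht) (x + y)).comp_scale_add
  dx_u t x := by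
    simpa using (S.dx_u (Real.exp y * t) (x + y)).comp_add_const x y
  dx_ut t x := by
    simpa using ((S.dx_ut (Real.exp y * t) (x + y)).comp_add_const x y).const_mul (Real.exp y)
  dx_ux t x := by
    simpa using (S.dx_ux (Real.exp y * t) (x + y)).comp_add_const x y
  eqn t ht x := by
    have := S.eqn _ (exp_mul_mem_Icc ht) (x + y)
    have e : Real.exp (2 * (x + y)) = Real.exp (2 * x) * Real.exp y ^ 2 := by
      rw [← Real.exp_nat_mul, ← Real.exp_add]; congr 1; push_cast; ring
    rw [e] at this
    linear_combination this
  energy t ht a b hab := by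
    have := S.energy _ (exp_mul_mem_Icc ht) (a + y) (b + y) (by linarith)
    rw [← intervalIntegral.integral_comp_add_right] at this
    refine le_trans (le_of_eq ?_) this
    congr 1 with x
    have e : Real.exp (2 * (x + y)) = Real.exp (2 * x) * Real.exp y ^ 2 := by
      rw [← Real.exp_nat_mul, ← Real.exp_add]; congr 1; push_cast; ring
    rw [e]; ring
  kin μ hμ hμT a b hab hb := by
    have h := S.kin (Real.exp y * μ) (by positivity) (exp_mul_mem_Icc ⟨hμ.le, hμT⟩).2 (a + y)
      (b + y) (by linarith) (by linarith)
    have h2 := intervalIntegral.mul_integral_comp_mul_left (a := 0) (b := μ)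
      (f := fun t => ∫ x in (a + y)..(b + y), Real.exp (2 * x) * S.ut (t, x) ^ 2) (Real.exp y)
    rw [mul_zero] at h2
    rw [← h2, mul_assoc] at h
    refine le_trans (le_of_eq ?_) (le_of_mul_le_mul_left h (Real.exp_pos y))
    congr 1 with t
    rw [← intervalIntegral.integral_comp_add_right]
    congr 1 with x
    have e : Real.exp (2 * (x + y)) = Real.exp (2 * x) * Real.exp y ^ 2 := by
      rw [← Real.exp_nat_mul, ← Real.exp_add]; congr 1; push_cast; ring
    rw [e]; ring

lemma integral_ux_sq_le {t a b : ℝ} (ht : t ∈ Icc 0 T) (hg : Continuous g) (hab : a ≤ b) :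
    ∫ x in a..b, S.ux (t, x) ^ 2 ≤ E := by
  refine (integral_mono_of_continuous
    (h := fun x => Real.exp (2 * x) * S.ut (t, x) ^ 2 + S.ux (t, x) ^ 2 + g (S.u (t, x)) ^ 2)
    (by fun_prop) (by fun_prop) hab fun x _ => ?_).trans
    (S.energy t ht a b hab)
  have := Real.exp_pos (2 * x)
  nlinarith [sq_nonneg (g (S.u (t, x))), mul_nonneg this.le (sq_nonneg (S.ut (t, x)))]

/-- Hölder continuity in space from the energy bound. -/
lemma sq_sub_le {t : ℝ} (ht : t ∈ Icc 0 T) (hg : Continuous g) {a b : ℝ} (hab : a ≤ b) :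
    (S.u (t, b) - S.u (t, a)) ^ 2 ≤ E * (b - a) := by
  have h1 : ∫ x in a..b, S.ux (t, x) = S.u (t, b) - S.u (t, a) :=
    intervalIntegral.integral_eq_sub_of_hasDerivAt (fun x _ => S.dx_u t x)
      (Continuous.intervalIntegrable (by fun_prop) _ _)
  rw [← h1]
  refine (sq_integral_le_of_continuous (by fun_prop) hab).trans ?_
  rw [mul_comm E]
  exact mul_le_mul_of_nonneg_left (S.integral_ux_sq_le ht hg hab) (by linarith)

lemma sq_sub_zero_le {t μ : ℝ} (h0 : 0 ≤ t) (htμ : t ≤ μ) (hμ : μ ≤ T) (x : ℝ) :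
    (S.u (t, x) - S.u (0, x)) ^ 2 ≤ μ * ∫ s in (0:ℝ)..μ, S.ut (s, x) ^ 2 := by
  have h1 : ∫ s in (0:ℝ)..t, S.ut (s, x) = S.u (t, x) - S.u (0, x) := by
    apply intervalIntegral.integral_eq_sub_of_hasDerivAt_of_le h0
    · exact Continuous.continuousOn (by fun_prop)
    · exact fun s hs => S.dt_u ⟨hs.1, hs.2.trans_le (htμ.trans hμ)⟩ x
    · exact Continuous.intervalIntegrable (by fun_prop) _ _
  rw [← h1]
  refine (sq_integral_le_of_continuous (by fun_prop) h0).trans ?_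
  rw [sub_zero]
  refine mul_le_mul htμ ?_ (intervalIntegral.integral_nonneg h0 fun _ _ => sq_nonneg _)
    (h0.trans htμ)
  apply intervalIntegral.integral_mono_interval le_rfl h0 htμ
  · exact Eventually.of_forall fun _ => sq_nonneg _
  · exact Continuous.intervalIntegrable (by fun_prop) _ _

/-- Oscillation in time at a fixed radius. -/
lemma sq_time_osc_le (hg : Continuous g) {t μ x h : ℝ} (h0 : 0 ≤ t) (htμ : t ≤ μ) (hμ0 : 0 < μ)
    (hμ : μ ≤ T) (hh : 0 < h) (hx : x + h ≤ b₀) :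
    (S.u (t, x) - S.u (0, x)) ^ 2 ≤ 3 * μ ^ 2 * Real.exp (-(2 * x)) * ε / h + 6 * E * h := by
  have hE : 0 ≤ E := le_trans (integral_nonneg_of_continuous le_rfl fun y _ => sq_nonneg _)
    (S.integral_ux_sq_le (t := 0) ⟨le_rfl, S.T_pos.le⟩ hg (le_refl (0:ℝ)))
  have hkey := integral_le_add_of_continuous (a := x) (b := x + h)
    (f := fun _ => (S.u (t, x) - S.u (0, x)) ^ 2 - 6 * E * h)
    (h := fun y => ∫ s in (0:ℝ)..μ, Real.exp (2 * y) * S.ut (s, y) ^ 2) (k := fun _ => 0)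
    (by fun_prop)
    (continuous_integral_slice (f := fun p => Real.exp (2 * p.1) * S.ut (p.2, p.1) ^ 2)
      (by fun_prop) 0 μ) (by fun_prop) (3 * μ * Real.exp (-(2 * x))) 0 (by linarith)
    (fun y hy => by
      have a1 := S.sq_sub_le (t := t) ⟨h0, htμ.trans hμ⟩ hg hy.1
      have a2 := S.sq_sub_le (t := 0) ⟨le_rfl, S.T_pos.le⟩ hg hy.1
      have a3 := S.sq_sub_zero_le h0 htμ hμ y
      have a4 : E * (y - x) ≤ E * h := mul_le_mul_of_nonneg_left (by linarith [hy.2]) hE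
      rw [intervalIntegral.integral_const_mul]
      have hI : 0 ≤ ∫ s in (0:ℝ)..μ, S.ut (s, y) ^ 2 :=
        intervalIntegral.integral_nonneg hμ0.le fun _ _ => sq_nonneg _
      set I := ∫ s in (0:ℝ)..μ, S.ut (s, y) ^ 2
      have a5 : 1 ≤ Real.exp (-(2 * x)) * Real.exp (2 * y) := by
        rw [← Real.exp_add]; exact Real.one_le_exp (by linarith [hy.1])
      have a6 : μ * I ≤ Real.exp (-(2 * x)) * Real.exp (2 * y) * (μ * I) :=
        le_mul_of_one_le_left (by positivity) a5
      have a7 : (S.u (t, x) - S.u (0, x)) ^ 2 ≤ 3 * (S.u (t, y) - S.u (t, x)) ^ 2 +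
          3 * (S.u (0, y) - S.u (0, x)) ^ 2 + 3 * (S.u (t, y) - S.u (0, y)) ^ 2 := by
        nlinarith [sq_nonneg ((S.u (t, y) - S.u (t, x)) + (S.u (0, y) - S.u (0, x))),
          sq_nonneg ((S.u (t, y) - S.u (t, x)) + (S.u (t, y) - S.u (0, y))),
          sq_nonneg ((S.u (0, y) - S.u (0, x)) - (S.u (t, y) - S.u (0, y)))]
      nlinarith)
  rw [← intervalIntegral_swap_of_continuous
    (f := fun p : ℝ × ℝ => Real.exp (2 * p.2) * S.ut p ^ 2) (by fun_prop),
    intervalIntegral.integral_const, smul_eq_mul] at hkey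
  have hk := S.kin μ hμ0 hμ x (x + h) (by linarith) hx
  have hk2 := mul_le_mul_of_nonneg_left hk
    (by positivity : 0 ≤ 3 * μ * Real.exp (-(2 * x)))
  have : ((S.u (t, x) - S.u (0, x)) ^ 2 - 6 * E * h) * h ≤
      3 * μ ^ 2 * Real.exp (-(2 * x)) * ε := by
    nlinarith
  rw [← le_div_iff₀ hh] at this
  linarith

end

end WaveSol

lemma le_of_forall_integral_le {k : ℝ → ℝ} (hk : Continuous k) {T ε : ℝ} (hT : 0 < T)
    (h : ∀ μ, 0 < μ → μ ≤ T → ∫ t in (0:ℝ)..μ, k t ≤ μ * ε) : k 0 ≤ ε := by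
  by_contra! hlt
  obtain ⟨δ, hδ, hball⟩ := Metric.eventually_nhds_iff.1
    (hk.continuousAt.eventually (lt_mem_nhds (by linarith : (k 0 + ε) / 2 < k 0)))
  have hμ : 0 < min T (δ / 2) := lt_min hT (by linarith)
  have h1 := h _ hμ (min_le_left _ _)
  have h2 := integral_mono_of_continuous (f := fun _ => (k 0 + ε) / 2) (h := k) (a := 0)
    (b := min T (δ / 2)) (by fun_prop) hk hμ.le fun t ht => (hball (by
      rw [Real.dist_eq, sub_zero, abs_of_nonneg ht.1]
      linarith [ht.2, min_le_right T (δ / 2)])).le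
  rw [intervalIntegral.integral_const, smul_eq_mul, sub_zero] at h2
  nlinarith

lemma integral_exp_neg_le_of_forall {p : ℝ → ℝ} (hp : Continuous p) {a b ε : ℝ} (hab : a ≤ b)
    (h : ∀ y ∈ Icc a b, ∫ x in a..y, Real.exp x * p x ≤ Real.exp y * ε) :
    ∫ x in a..b, Real.exp (a - x) * p x ≤ 3 * ε := by
  have hε : 0 ≤ ε := by
    have := h a ⟨le_rfl, hab⟩
    rw [intervalIntegral.integral_same] at this
    exact (mul_nonneg_iff_of_pos_left (Real.exp_pos a)).1 this
  have hc : Continuous fun x => Real.exp x * p x := by fun_prop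
  set I : ℝ → ℝ := fun y => ∫ x in a..y, Real.exp x * p x with hI
  have hdI : ∀ y, HasDerivAt I (Real.exp y * p y) y := fun y =>
    intervalIntegral.integral_hasDerivAt_right (hc.intervalIntegrable _ _)
      hc.aestronglyMeasurable.stronglyMeasurableAtFilter hc.continuousAt
  have hcI : Continuous I := continuous_iff_continuousAt.2 fun y => (hdI y).continuousAt
  have hftc : ∫ y in a..b, (Real.exp (a - y) * p y - 2 * (Real.exp (a - 2 * y) * I y)) =
      Real.exp (a - 2 * b) * I b - Real.exp (a - 2 * a) * I a := by
    apply intervalIntegral.integral_eq_sub_of_hasDerivAt (f := fun y => Real.exp (a - 2 * y) * I y)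
    · intro y _
      refine ((((hasDerivAt_id y).const_mul 2).const_sub a).exp.mul (hdI y)).congr_deriv ?_
      have : Real.exp (a - y) = Real.exp (a - 2 * y) * Real.exp y := by
        rw [← Real.exp_add]; congr 1; ring
      simp only [id]
      rw [this]; ring
    · exact Continuous.intervalIntegrable (by fun_prop) _ _
  have hIa : I a = 0 := by simp [hI]
  rw [hIa, mul_zero, sub_zero, intervalIntegral.integral_sub
    (Continuous.intervalIntegrable (by fun_prop) _ _)
    (Continuous.intervalIntegrable (by fun_prop) _ _)] at hftc
  have h1 : ∫ y in a..b, 2 * (Real.exp (a - 2 * y) * I y) ≤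
      ∫ y in a..b, 2 * ε * Real.exp (a - y) := by
    refine integral_mono_of_continuous (by fun_prop) (by fun_prop) hab fun y hy => ?_
    have := mul_le_mul_of_nonneg_left (h y hy) (Real.exp_pos (a - 2 * y)).le
    have e : Real.exp (a - 2 * y) * (Real.exp y * ε) = ε * Real.exp (a - y) := by
      rw [← mul_assoc, ← Real.exp_add, mul_comm]; congr 2; ring
    rw [e] at this
    linarith
  have h2 : ∫ y in a..b, Real.exp (a - y) = 1 - Real.exp (a - b) := by
    have := intervalIntegral.integral_eq_sub_of_hasDerivAt (a := a) (b := b)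
      (f := fun y => -Real.exp (a - y)) (f' := fun y => Real.exp (a - y))
      (fun y _ => by simpa using ((hasDerivAt_id y).const_sub a).exp.fun_neg)
      (Continuous.intervalIntegrable (by fun_prop) _ _)
    rw [this]; simp; ring
  rw [intervalIntegral.integral_const_mul (2 * ε), h2] at h1
  have h3 := mul_le_mul_of_nonneg_left (h b ⟨hab, le_rfl⟩) (Real.exp_pos (a - 2 * b)).le
  have e : Real.exp (a - 2 * b) * (Real.exp b * ε) = ε * Real.exp (a - b) := by
    rw [← mul_assoc, ← Real.exp_add, mul_comm]; congr 2; ring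
  rw [e] at h3
  have h4 : Real.exp (a - b) ≤ 1 := Real.exp_le_one_iff.2 (by linarith)
  have h5 := Real.exp_pos (a - b)
  change _ * I b ≤ _ at h3
  nlinarith

namespace WaveSol

variable {g : ℝ → ℝ} {T b₀ E ε : ℝ} (S : WaveSol g T b₀ E ε)

lemma integral_ut_zero_sq_le {a b : ℝ} (hab : a ≤ b) (hb : b ≤ b₀) :
    ∫ x in a..b, Real.exp (2 * x) * S.ut (0, x) ^ 2 ≤ ε :=
  le_of_forall_integral_le
    (k := fun t => ∫ x in a..b, Real.exp (2 * x) * S.ut (t, x) ^ 2)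
    (continuous_integral_slice (f := fun p => Real.exp (2 * p.2) * S.ut p ^ 2) (by fun_prop) a b)
    S.T_pos fun μ h0 h1 => S.kin μ h0 h1 a b hab hb

/-- The wave map in self-similar coordinates, centered at `ℓ`. -/
noncomputable def toSector (hg : ContDiff ℝ 3 g) (ℓ : ℝ) {a b : ℝ} (hab : a ≤ b)
    (hb : Real.exp b ≤ T) : Sector a b :=
  have hg1 : Continuous (deriv g) := hg.continuous_deriv (by norm_num)
  have hg0 : Continuous g := hg.continuous
  have hlt : ∀ {z x : ℝ}, z ∈ Icc (0:ℝ) 1 → x ∈ Ioo a b → z * Real.exp x < T := fun hz hx =>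
    (mul_le_of_le_one_left (Real.exp_pos _).le hz.2).trans_lt
      ((Real.exp_lt_exp.2 hx.2).trans_le hb)
  have hmem : ∀ {z x : ℝ}, z ∈ Ioo (0:ℝ) 1 → x ∈ Ioo a b → z * Real.exp x ∈ Ioo 0 T :=
    fun hz hx => ⟨mul_pos hz.1 (Real.exp_pos _), hlt ⟨hz.1.le, hz.2.le⟩ hx⟩
  have hdz : ∀ z x : ℝ, HasDerivAt (fun z => z * Real.exp x) (Real.exp x) z := fun z x => by
    simpa using (hasDerivAt_id z).mul_const (Real.exp x)
  have hdx : ∀ z x : ℝ, HasDerivAt (fun x => z * Real.exp x) (z * Real.exp x) x := fun z x =>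
    (Real.hasDerivAt_exp x).const_mul z
  have hcx : ∀ {F Ft Fx : ℝ × ℝ → ℝ},
      (∀ t ∈ Ioo 0 T, ∀ x, HasFDerivAt F (Ft (t, x) • ContinuousLinearMap.fst ℝ ℝ ℝ +
        Fx (t, x) • ContinuousLinearMap.snd ℝ ℝ ℝ) (t, x)) →
      (∀ t x, HasDerivAt (fun y => F (t, y)) (Fx (t, x)) x) →
      ∀ z ∈ Icc (0:ℝ) 1, ∀ x ∈ Ioo a b, HasDerivAt (fun y => F (z * Real.exp y, y))
        (Ft (z * Real.exp x, x) * (z * Real.exp x) + Fx (z * Real.exp x, x)) x := by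
    intro F Ft Fx hF hFx z hz x hx
    rcases hz.1.eq_or_lt with rfl | hpos
    · simpa using hFx 0 x
    · simpa using (hF _ ⟨mul_pos hpos (Real.exp_pos x), hlt hz hx⟩ x).hasDerivAt_comp_pair
        (hdx z x) (hasDerivAt_id x)
  { Φ := fun p => S.u (p.1 * Real.exp p.2, p.2) - ℓ
    P := fun p => Real.exp p.2 * S.ut (p.1 * Real.exp p.2, p.2)
    X := fun p => S.ux (p.1 * Real.exp p.2, p.2) +
      p.1 * Real.exp p.2 * S.ut (p.1 * Real.exp p.2, p.2)
    Pz := fun p => Real.exp p.2 * (S.utt (p.1 * Real.exp p.2, p.2) * Real.exp p.2)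
    Y := fun p => Real.exp p.2 * S.ut (p.1 * Real.exp p.2, p.2) + Real.exp p.2 *
      (S.utt (p.1 * Real.exp p.2, p.2) * (p.1 * Real.exp p.2) +
        S.utx (p.1 * Real.exp p.2, p.2))
    Xx := fun p => S.utx (p.1 * Real.exp p.2, p.2) * (p.1 * Real.exp p.2) +
      S.uxx (p.1 * Real.exp p.2, p.2) +
      (p.1 * Real.exp p.2 * S.ut (p.1 * Real.exp p.2, p.2) + p.1 * Real.exp p.2 *
      (S.utt (p.1 * Real.exp p.2, p.2) * (p.1 * Real.exp p.2) +
        S.utx (p.1 * Real.exp p.2, p.2)))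
    N := fun p => g (S.u (p.1 * Real.exp p.2, p.2)) * deriv g (S.u (p.1 * Real.exp p.2, p.2)) -
      (S.u (p.1 * Real.exp p.2, p.2) - ℓ)
    W := fun p => g (S.u (p.1 * Real.exp p.2, p.2)) ^ 2
    hab := hab
    cΦ := by fun_prop
    cP := by fun_prop
    cX := by fun_prop
    cPz := by fun_prop
    cY := by fun_prop
    cXx := by fun_prop
    cN := by fun_prop
    cW := by fun_prop
    dΦz := fun z hz x hx => by
      refine (((S.dt_u (hmem hz hx) x).comp z (hdz z x)).sub_const ℓ).congr_deriv ?_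
      ring
    dΦx := fun z hz x hx => by
      refine ((hcx S.grad_u S.dx_u z hz x hx).sub_const ℓ).congr_deriv ?_
      ring
    dPz := fun z hz x hx => by
      have h := (S.dt_ut (hmem hz hx) x).comp z (hdz z x)
      exact h.const_mul (Real.exp x)
    dPx := fun z hz x hx => (Real.hasDerivAt_exp x).mul (hcx S.grad_ut S.dx_ut z hz x hx)
    dXz := fun z hz x hx => by
      refine (((S.dt_ux (hmem hz hx) x).comp z (hdz z x)).add
        ((hdz z x).mul ((S.dt_ut (hmem hz hx) x).comp z (hdz z x)))).congr_deriv ?_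
      simp only [Function.comp]
      ring
    dXx := fun z hz x hx => (hcx S.grad_ux S.dx_ux z hz x hx).add
      ((hdx z x).mul (hcx S.grad_ut S.dx_ut z hz x hx))
    dW := fun z hz x hx => by
      have hgd : HasDerivAt g (deriv g (S.u (z * Real.exp x, x))) (S.u (z * Real.exp x, x)) :=
        ((hg.differentiable (by norm_num)) _).hasDerivAt
      have h1 := (S.dt_u (hmem hz hx) x).comp z (hdz z x)
      refine ((hgd.comp z h1).pow 2).congr_deriv ?_
      simp only [Function.comp]
      push_cast
      ring
    eqn := fun z hz x hx => by
      have := S.eqn (z * Real.exp x) ⟨mul_nonneg hz.1 (Real.exp_pos x).le,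
        (mul_le_of_le_one_left (Real.exp_pos _).le hz.2).trans
          ((Real.exp_le_exp.2 hx.2).trans hb)⟩ x
      have e : Real.exp (2 * x) = Real.exp x * Real.exp x := by rw [← Real.exp_add]; ring_nf
      rw [e] at this
      simp only
      linear_combination this }

lemma integral_exp_mul_kin_le {a y : ℝ} (hay : a ≤ y) (hy : Real.exp y ≤ T) (hyb : y ≤ b₀) :
    ∫ x in a..y, Real.exp x * ∫ z in (0:ℝ)..1,
      (Real.exp x * S.ut (z * Real.exp x, x)) ^ 2 ≤ Real.exp y * ε := by
  refine le_trans ?_ (S.kin (Real.exp y) (Real.exp_pos y) hy a y hay hyb)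
  rw [intervalIntegral_swap_of_continuous
    (f := fun p : ℝ × ℝ => Real.exp (2 * p.2) * S.ut p ^ 2) (by fun_prop)]
  refine integral_mono_of_continuous
    (f := fun x => Real.exp x * ∫ z in (0:ℝ)..1, (Real.exp x * S.ut (z * Real.exp x, x)) ^ 2)
    (h := fun x => ∫ t in (0:ℝ)..Real.exp y, Real.exp (2 * x) * S.ut (t, x) ^ 2)
    (Real.continuous_exp.mul (continuous_integral_slice
      (f := fun p => (Real.exp p.1 * S.ut (p.2 * Real.exp p.1, p.1)) ^ 2) (by fun_prop) 0 1))
    (continuous_integral_slice (f := fun p => Real.exp (2 * p.1) * S.ut (p.2, p.1) ^ 2)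
      (by fun_prop) 0 _) hay fun x hx => ?_
  have h1 : Real.exp x * ∫ z in (0:ℝ)..1, (Real.exp x * S.ut (z * Real.exp x, x)) ^ 2 =
      ∫ t in (0:ℝ)..Real.exp x, Real.exp (2 * x) * S.ut (t, x) ^ 2 := by
    have := intervalIntegral.mul_integral_comp_mul_right (a := 0) (b := 1)
      (f := fun t => Real.exp (2 * x) * S.ut (t, x) ^ 2) (Real.exp x)
    rw [zero_mul, one_mul] at this
    rw [← this]
    congr 2 with z
    rw [mul_pow, ← Real.exp_nat_mul]
    norm_num
  rw [h1]
  apply intervalIntegral.integral_mono_interval le_rfl (Real.exp_pos x).le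
    (Real.exp_le_exp.2 hx.2)
  · exact Eventually.of_forall fun _ => by positivity
  · exact Continuous.intervalIntegrable (by fun_prop) _ _

lemma kin_left_le {a b : ℝ} (hab : a ≤ b) (hb : Real.exp b ≤ T) (hbb : b ≤ b₀) :
    ∫ z in (0:ℝ)..1, ∫ x in a..b, Real.exp (a - x) *
      (Real.exp x * S.ut (z * Real.exp x, x)) ^ 2 ≤ 3 * ε := by
  rw [intervalIntegral_swap_of_continuous (f := fun p : ℝ × ℝ => Real.exp (a - p.2) *
      (Real.exp p.2 * S.ut (p.1 * Real.exp p.2, p.2)) ^ 2) (by fun_prop)]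
  simp only [intervalIntegral.integral_const_mul]
  exact integral_exp_neg_le_of_forall (continuous_integral_slice
      (f := fun p => (Real.exp p.1 * S.ut (p.2 * Real.exp p.1, p.1)) ^ 2) (by fun_prop) 0 1) hab
    fun y hy => S.integral_exp_mul_kin_le hy.1 ((Real.exp_le_exp.2 hy.2).trans hb)
      (hy.2.trans hbb)

lemma kin_right_le {a b : ℝ} (hab : a ≤ b) (hb : Real.exp b ≤ T) (hbb : b ≤ b₀) :
    ∫ z in (0:ℝ)..1, ∫ x in a..b, Real.exp (x - b) *
      (Real.exp x * S.ut (z * Real.exp x, x)) ^ 2 ≤ ε := by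
  rw [intervalIntegral_swap_of_continuous (f := fun p : ℝ × ℝ => Real.exp (p.2 - b) *
      (Real.exp p.2 * S.ut (p.1 * Real.exp p.2, p.2)) ^ 2) (by fun_prop)]
  simp only [intervalIntegral.integral_const_mul]
  have h := S.integral_exp_mul_kin_le hab hb hbb
  have e : ∀ x : ℝ, Real.exp (x - b) * (∫ z in (0:ℝ)..1,
      (Real.exp x * S.ut (z * Real.exp x, x)) ^ 2) = Real.exp (-b) * (Real.exp x *
      ∫ z in (0:ℝ)..1, (Real.exp x * S.ut (z * Real.exp x, x)) ^ 2) := fun x => by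
    rw [← mul_assoc, ← Real.exp_add]; ring_nf
  simp only [e, intervalIntegral.integral_const_mul]
  have := mul_le_mul_of_nonneg_left h (Real.exp_pos (-b)).le
  rwa [← mul_assoc, ← Real.exp_add, neg_add_cancel, Real.exp_zero, one_mul] at this

lemma kin_window_le {y : ℝ} (hb : Real.exp (y + 3) ≤ T) (hbb : y + 3 ≤ b₀) :
    ∫ z in (0:ℝ)..1, ∫ x in y..(y + 3), (Real.exp x * S.ut (z * Real.exp x, x)) ^ 2 ≤
      21 * ε := by
  have h := S.kin_right_le (a := y) (by linarith) hb hbb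
  have h3 : Real.exp 3 ≤ 21 := by
    have h1 := Real.exp_one_lt_d9
    have : Real.exp 3 = Real.exp 1 ^ 3 := by rw [← Real.exp_nat_mul]; norm_num
    rw [this]
    calc Real.exp 1 ^ 3 ≤ 2.7182818286 ^ 3 := by gcongr
      _ ≤ 21 := by norm_num
  have h4 := mul_le_mul_of_nonneg_left h (by norm_num : (0:ℝ) ≤ 21)
  refine le_trans ?_ h4
  rw [← intervalIntegral.integral_const_mul]
  refine integral_mono_of_continuous
    (continuous_integral_slice (f := fun p => (Real.exp p.2 *
      S.ut (p.1 * Real.exp p.2, p.2)) ^ 2) (by fun_prop) _ _)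
    (continuous_const.mul (continuous_integral_slice (f := fun p => Real.exp (p.2 - (y + 3)) *
      (Real.exp p.2 * S.ut (p.1 * Real.exp p.2, p.2)) ^ 2) (by fun_prop) _ _)) zero_le_one
    fun z _ => ?_
  simp only [Pi.mul_apply]
  rw [← intervalIntegral.integral_const_mul]
  refine integral_mono_of_continuous (by fun_prop) (by fun_prop) (by linarith) fun x hx => ?_
  rw [← mul_assoc]
  refine le_mul_of_one_le_left (sq_nonneg _) ?_
  have h5 : Real.exp 3 * Real.exp (x - (y + 3)) = Real.exp (x - y) := by
    rw [← Real.exp_add]; ring_nf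
  have h6 : 1 ≤ Real.exp (x - y) := Real.one_le_exp (by linarith [hx.1])
  have h7 := Real.exp_pos (x - (y + 3))
  nlinarith

end WaveSol

/-- Quadratic Taylor control of the force `g g'` and of the potential `g²` at a zero `ℓ` of `g`
with `g'(ℓ) = ±1`. -/
def QuadBound (g : ℝ → ℝ) (ℓ C : ℝ) : Prop :=
  ∀ x, |x - ℓ| ≤ 1 → |g x * deriv g x - (x - ℓ)| ≤ C * (x - ℓ) ^ 2 ∧
    |g x ^ 2 - (x - ℓ) ^ 2| ≤ C * |x - ℓ| ^ 3

namespace WaveSol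

variable {g : ℝ → ℝ} {T b₀ E ε : ℝ} (S : WaveSol g T b₀ E ε)

lemma abs_sector_osc_le (hg : Continuous g) (hε : 0 < ε) (hε1 : ε ≤ 1) {ω : ℝ} (hω0 : 0 ≤ ω)
    (hω : (3 + 6 * E) * √ε ≤ ω ^ 2) {x z : ℝ} (hx : Real.exp x ≤ T) (hxb : x + 1 ≤ b₀)
    (hz : z ∈ Icc (0:ℝ) 1) : |S.u (z * Real.exp x, x) - S.u (0, x)| ≤ ω := by
  have hs : 0 < √ε := Real.sqrt_pos.2 hε
  have hs1 : √ε ≤ 1 := Real.sqrt_le_one.2 hε1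
  have h := S.sq_time_osc_le hg (t := z * Real.exp x) (x := x)
    (mul_nonneg hz.1 (Real.exp_pos x).le)
    (mul_le_of_le_one_left (Real.exp_pos x).le hz.2) (Real.exp_pos x) hx hs (by linarith)
  have e : 3 * Real.exp x ^ 2 * Real.exp (-(2 * x)) * ε / √ε = 3 * √ε := by
    have e1 : Real.exp x ^ 2 * Real.exp (-(2 * x)) = 1 := by
      rw [← Real.exp_nat_mul, ← Real.exp_add]; simp
    rw [mul_assoc 3, e1, mul_one, mul_div_assoc, Real.div_sqrt]
  rw [e] at h
  exact abs_le_of_sq_le_sq (by linarith) hω0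

/-- Away from bubbles the solution is close to `ℓ` in the energy space: if `u(0)` is uniformly
close to `ℓ` then its `H` norm is small. -/
lemma integral_neck_le (hg : ContDiff ℝ 3 g) (hε : 0 < ε) (hε1 : ε ≤ 1) {ω : ℝ} (hω0 : 0 ≤ ω)
    (hω : (3 + 6 * E) * √ε ≤ ω ^ 2) {ℓ C s θ : ℝ} (hC : QuadBound g ℓ C) (hC0 : 0 < C)
    (hθ : s + ω ≤ θ) (hθ0 : 0 < θ) (hθ1 : θ ≤ 1) (hCθ : C * θ ≤ 1 / 4) {a b : ℝ} (hab : a ≤ b)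
    (hb : Real.exp (b + 3) ≤ T) (hbb : b + 4 ≤ b₀)
    (hs : ∀ x ∈ Icc (a - 3) (b + 3), |S.u (0, x) - ℓ| ≤ s) :
    ∫ x in a..b, (S.ux (0, x) ^ 2 + (S.u (0, x) - ℓ) ^ 2) ≤
      1300 * ((527 * ε + 100 * θ ^ 2) + C * θ * (E + 7 * (527 * ε + 100 * θ ^ 2))) := by
  have hg0 := hg.continuous
  have hexp : ∀ x, x ≤ b + 3 → Real.exp x ≤ T := fun x hx => (Real.exp_le_exp.2 hx).trans hb
  have hΦ : ∀ z ∈ Icc (0:ℝ) 1, ∀ x ∈ Icc (a - 3) (b + 3), |S.u (z * Real.exp x, x) - ℓ| ≤ θ := by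
    intro z hz x hx
    have h1 := S.abs_sector_osc_le hg0 hε hε1 hω0 hω (hexp x hx.2) (by linarith [hx.2]) hz
    have h2 := hs x hx
    rw [abs_le] at h1 h2 ⊢
    exact ⟨by linarith, by linarith⟩
  have hN : ∀ z ∈ Icc (0:ℝ) 1, ∀ x ∈ Icc (a - 3) (b + 3),
      |g (S.u (z * Real.exp x, x)) * deriv g (S.u (z * Real.exp x, x)) -
        (S.u (z * Real.exp x, x) - ℓ)| ≤ C * θ * |S.u (z * Real.exp x, x) - ℓ| := by
    intro z hz x hx
    have h1 := hΦ z hz x hx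
    refine (hC _ (h1.trans hθ1)).1.trans ?_
    rw [← sq_abs, sq, ← mul_assoc]
    exact mul_le_mul_of_nonneg_right (mul_le_mul_of_nonneg_left h1 hC0.le) (abs_nonneg _)
  have hW : ∀ z ∈ Icc (0:ℝ) 1, ∀ x ∈ Icc (a - 3) (b + 3),
      |g (S.u (z * Real.exp x, x)) ^ 2 - (S.u (z * Real.exp x, x) - ℓ) ^ 2| ≤
        C * θ * (S.u (z * Real.exp x, x) - ℓ) ^ 2 := by
    intro z hz x hx
    have h1 := hΦ z hz x hx
    refine (hC _ (h1.trans hθ1)).2.trans ?_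
    rw [← sq_abs (_ - ℓ), pow_succ' _ 2, ← mul_assoc]
    exact mul_le_mul_of_nonneg_right (mul_le_mul_of_nonneg_left h1 hC0.le) (sq_nonneg _)
  have hstart : ∀ c d, c ≤ d → d ≤ b₀ →
      ∫ x in c..d, (Real.exp x * S.ut (0 * Real.exp x, x)) ^ 2 ≤ ε := by
    intro c d hcd hd
    refine le_trans (le_of_eq ?_) (S.integral_ut_zero_sq_le hcd hd)
    congr 1 with x
    rw [mul_pow, ← Real.exp_nat_mul, zero_mul]; norm_num
  have hwin : ∀ y, a - 3 ≤ y → y ≤ b → ∃ x ∈ Icc (y + 1) (y + 2), ∫ z in (0:ℝ)..1,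
      ((Real.exp x * S.ut (z * Real.exp x, x)) ^ 2 + (S.ux (z * Real.exp x, x) +
        z * Real.exp x * S.ut (z * Real.exp x, x)) ^ 2 + (S.u (z * Real.exp x, x) - ℓ) ^ 2) ≤
        527 * ε + 100 * θ ^ 2 := by
    intro y h1 h2
    have hy : y ≤ y + 3 := by linarith
    obtain ⟨x, hx, h⟩ := (S.toSector hg ℓ hy (hexp _ (by linarith))).window_good_point
      (θ := θ) (K := 21 * ε) (ε := ε)
      (fun z hz x hx => hΦ z hz x ⟨by linarith [hx.1], by linarith [hx.2]⟩)
      (fun z hz x hx => (hN z hz x ⟨by linarith [hx.1], by linarith [hx.2]⟩).trans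
        (mul_le_mul_of_nonneg_right hCθ (abs_nonneg _)))
      (S.kin_window_le (hexp _ (by linarith)) (by linarith)) (hstart _ _ hy (by linarith))
    exact ⟨x, hx, h.trans (by linarith)⟩
  obtain ⟨a', ha', hba⟩ := hwin (a - 3) le_rfl (by linarith)
  obtain ⟨b', hb', hbb'⟩ := hwin b (by linarith) le_rfl
  have hab' : a' ≤ b' := by linarith [ha'.2, hb'.1]
  have hb'T : Real.exp b' ≤ T := hexp _ (by linarith [hb'.2])
  have hb'b : b' ≤ b₀ := by linarith [hb'.2]
  have hsub : ∀ x ∈ Icc a' b', x ∈ Icc (a - 3) (b + 3) := fun x hx =>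
    ⟨by linarith [hx.1, ha'.1], by linarith [hx.2, hb'.2]⟩
  have hε' : 3 * ε ≤ 527 * ε + 100 * θ ^ 2 := by nlinarith [sq_nonneg θ]
  have hsmall : (S.toSector hg ℓ hab' hb'T).Small (C * θ) (527 * ε + 100 * θ ^ 2) E :=
    { η_pos := by positivity
      η_le := hCθ
      N_le := fun z hz x hx => hN z hz x (hsub x hx)
      W_le := fun z hz x hx => hW z hz x (hsub x hx)
      initial := (hstart _ _ hab' hb'b).trans (by linarith)
      kin_left := (S.kin_left_le hab' hb'T hb'b).trans hε'
      kin_right := (S.kin_right_le hab' hb'T hb'b).trans (by linarith)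
      bdry_left := hba
      bdry_right := hbb'
      energy := by
        refine le_trans (integral_mono_of_continuous (Continuous.add
          (((S.toSector hg ℓ hab' hb'T).cX.comp (by fun_prop : Continuous fun x : ℝ =>
            ((0:ℝ), x))).pow 2) ((S.toSector hg ℓ hab' hb'T).cW.comp (by fun_prop)))
          (h := fun x => Real.exp (2 * x) * S.ut (0, x) ^ 2 + S.ux (0, x) ^ 2 +
            g (S.u (0, x)) ^ 2) (by fun_prop) hab' fun x _ => ?_)
          (S.energy 0 ⟨le_rfl, S.T_pos.le⟩ a' b' hab')
        simp only [toSector, Pi.add_apply, Function.comp, zero_mul, add_zero, Pi.pow_apply]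
        have : 0 ≤ Real.exp (2 * x) * S.ut (0, x) ^ 2 := by positivity
        linarith }
  have hres := hsmall.initial_data_le
  simp only [toSector, zero_mul, add_zero] at hres
  rw [← intervalIntegral.integral_add (Continuous.intervalIntegrable (by fun_prop) _ _)
    (Continuous.intervalIntegrable (by fun_prop) _ _)] at hres
  refine le_trans ?_ hres
  apply intervalIntegral.integral_mono_interval (by linarith [ha'.2]) hab (by linarith [hb'.1])
  · exact Eventually.of_forall fun _ => by positivity
  · exact Continuous.intervalIntegrable (by fun_prop) _ _

end WaveSol

namespace WaveSol

variable {g : ℝ → ℝ} {T b₀ E ε : ℝ} (S : WaveSol g T b₀ E ε)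

/-- Time averages of a solution solve the static equation up to an error. -/
lemma integral_bump_uxx (hg : ContDiff ℝ 3 g) (hT : 1 < T) (c x : ℝ) :
    ∫ t in (0:ℝ)..1, 30 * t ^ 2 * (1 - t) ^ 2 * S.uxx (t, x) =
      Real.exp (2 * x) * (∫ t in (0:ℝ)..1, (60 - 360 * t + 360 * t ^ 2) * (S.u (t, x) - c)) +
      ∫ t in (0:ℝ)..1, 30 * t ^ 2 * (1 - t) ^ 2 * (g (S.u (t, x)) * deriv g (S.u (t, x))) := by
  have hg1 : Continuous (deriv g) := hg.continuous_deriv (by norm_num)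
  have hg0 : Continuous g := hg.continuous
  have h1 : ∫ t in (0:ℝ)..1, (30 * t ^ 2 * (1 - t) ^ 2 * S.utt (t, x) -
      (60 - 360 * t + 360 * t ^ 2) * (S.u (t, x) - c)) = 0 := by
    rw [intervalIntegral.integral_eq_sub_of_hasDerivAt_of_le (f := fun t =>
      30 * t ^ 2 * (1 - t) ^ 2 * S.ut (t, x) -
        (60 * t - 180 * t ^ 2 + 120 * t ^ 3) * (S.u (t, x) - c)) zero_le_one]
    · norm_num
    · exact Continuous.continuousOn (by fun_prop)
    · intro t ht
      have ht' : t ∈ Ioo 0 T := ⟨ht.1, ht.2.trans hT⟩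
      have k1 : HasDerivAt (fun t : ℝ => 30 * t ^ 2 * (1 - t) ^ 2)
          (60 * t - 180 * t ^ 2 + 120 * t ^ 3) t := by
        refine ((((hasDerivAt_id t).pow 2).const_mul 30).mul
          (((hasDerivAt_id t).const_sub 1).pow 2)).congr_deriv ?_
        simp; ring
      have k2 : HasDerivAt (fun t : ℝ => 60 * t - 180 * t ^ 2 + 120 * t ^ 3)
          (60 - 360 * t + 360 * t ^ 2) t := by
        refine ((((hasDerivAt_id t).const_mul 60).sub (((hasDerivAt_id t).pow 2).const_mul 180)).add
          (((hasDerivAt_id t).pow 3).const_mul 120)).congr_deriv ?_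
        simp; ring
      refine ((k1.mul (S.dt_ut ht' x)).sub (k2.mul ((S.dt_u ht' x).sub_const c))).congr_deriv ?_
      ring
    · exact Continuous.intervalIntegrable (by fun_prop) _ _
  rw [intervalIntegral.integral_sub (Continuous.intervalIntegrable (by fun_prop) _ _)
    (Continuous.intervalIntegrable (by fun_prop) _ _), sub_eq_zero] at h1
  rw [← h1, ← intervalIntegral.integral_const_mul, ← intervalIntegral.integral_add
    (Continuous.intervalIntegrable (by fun_prop) _ _)
    (Continuous.intervalIntegrable (by fun_prop) _ _)]
  refine intervalIntegral.integral_congr fun t ht => ?_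
  rw [uIcc_of_le zero_le_one] at ht
  have := S.eqn t ⟨ht.1, ht.2.trans hT.le⟩ x
  linear_combination (-(30 * t ^ 2 * (1 - t) ^ 2)) * this

end WaveSol

/-- Taylor's formula with integral remainder at order two. -/
lemma taylor_two_integral {h h' h'' : ℝ → ℝ} (h1 : ∀ x, HasDerivAt h (h' x) x)
    (h2 : ∀ x, HasDerivAt h' (h'' x) x) (hc : Continuous h'') (x : ℝ) :
    h x - h 0 - x * h' 0 = ∫ s in (0:ℝ)..x, (x - s) * h'' s := by
  rw [intervalIntegral.integral_eq_sub_of_hasDerivAt (f := fun s => (x - s) * h' s + h s)]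
  · simp; ring
  · intro s _
    refine ((((hasDerivAt_id s).const_sub x).mul (h2 s)).add (h1 s)).congr_deriv ?_
    simp
  · exact Continuous.intervalIntegrable (by fun_prop) _ _

lemma integral_bump : ∫ t in (0:ℝ)..1, 30 * t ^ 2 * (1 - t) ^ 2 = 1 := by
  rw [intervalIntegral.integral_eq_sub_of_hasDerivAt
    (f := fun t => 10 * t ^ 3 - 15 * t ^ 4 + 6 * t ^ 5)]
  · norm_num
  · intro t _
    refine (((((hasDerivAt_id t).pow 3).const_mul 10).sub
      (((hasDerivAt_id t).pow 4).const_mul 15)).add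
      (((hasDerivAt_id t).pow 5).const_mul 6)).congr_deriv ?_
    simp; ring
  · exact Continuous.intervalIntegrable (by fun_prop) _ _

lemma abs_integral_bump_sub_le {h : ℝ → ℝ} (hh : Continuous h) {c δ : ℝ}
    (hle : ∀ t ∈ Icc (0:ℝ) 1, |h t - c| ≤ δ) :
    |(∫ t in (0:ℝ)..1, 30 * t ^ 2 * (1 - t) ^ 2 * h t) - c| ≤ δ := by
  have e : (∫ t in (0:ℝ)..1, 30 * t ^ 2 * (1 - t) ^ 2 * h t) - c =
      ∫ t in (0:ℝ)..1, 30 * t ^ 2 * (1 - t) ^ 2 * (h t - c) := by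
    simp only [mul_sub]
    rw [intervalIntegral.integral_sub (Continuous.intervalIntegrable (by fun_prop) _ _)
      (Continuous.intervalIntegrable (by fun_prop) _ _), intervalIntegral.integral_mul_const,
      integral_bump, one_mul]
  rw [e]
  refine (intervalIntegral.abs_integral_le_integral_abs zero_le_one).trans ?_
  have : ∫ t in (0:ℝ)..1, 30 * t ^ 2 * (1 - t) ^ 2 * δ = δ := by
    rw [intervalIntegral.integral_mul_const, integral_bump, one_mul]
  rw [← this]
  refine integral_mono_of_continuous (by fun_prop) (by fun_prop) zero_le_one fun t ht => ?_
  rw [abs_mul, abs_of_nonneg (by positivity : 0 ≤ 30 * t ^ 2 * (1 - t) ^ 2)]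
  exact mul_le_mul_of_nonneg_left (hle t ht) (by positivity)

namespace WaveSol

variable {g : ℝ → ℝ} {T b₀ E ε : ℝ} (S : WaveSol g T b₀ E ε)

/-- If `u` is close to a function of `x` alone, this function almost solves the static equation. -/
lemma exists_abs_sub_taylor_le (hg : ContDiff ℝ 3 g) (hT : 1 < T) {v : ℝ → ℝ} (hv : Continuous v)
    {A δ : ℝ} (hA : 0 ≤ A)
    (hδ : ∀ t ∈ Icc (0:ℝ) 1, ∀ x ∈ Icc (-A) A, |S.u (t, x) - v x| ≤ δ)
    (hδf : ∀ t ∈ Icc (0:ℝ) 1, ∀ x ∈ Icc (-A) A,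
      |g (S.u (t, x)) * deriv g (S.u (t, x)) - g (v x) * deriv g (v x)| ≤ δ) :
    ∃ c, ∀ x ∈ Icc (-A) A,
      |v x - v 0 - x * c - ∫ s in (0:ℝ)..x, (x - s) * (g (v s) * deriv g (v s))| ≤
        (2 + A * (A * (Real.exp (2 * A) * 60 + 1))) * δ := by
  have hg1 : Continuous (deriv g) := hg.continuous_deriv (by norm_num)
  have hg0 : Continuous g := hg.continuous
  set V : ℝ → ℝ := fun x => ∫ t in (0:ℝ)..1, 30 * t ^ 2 * (1 - t) ^ 2 * S.u (t, x) with hV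
  set q : ℝ → ℝ := fun s => ∫ t in (0:ℝ)..1, 30 * t ^ 2 * (1 - t) ^ 2 * S.uxx (t, s) with hq
  set c := ∫ t in (0:ℝ)..1, 30 * t ^ 2 * (1 - t) ^ 2 * S.ux (t, 0) with hc
  have hqc : Continuous q := continuous_integral_slice
    (f := fun p => 30 * p.2 ^ 2 * (1 - p.2) ^ 2 * S.uxx (p.2, p.1)) (by fun_prop) 0 1
  have hδ0 : 0 ≤ δ := (abs_nonneg _).trans (hδ 0 (by simp) 0 ⟨by linarith, hA⟩)
  have hVv : ∀ x ∈ Icc (-A) A, |V x - v x| ≤ δ := fun x hx =>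
    abs_integral_bump_sub_le (by fun_prop) fun t ht => hδ t ht x hx
  have htay : ∀ x, V x - V 0 - x * c = ∫ s in (0:ℝ)..x, (x - s) * q s := by
    intro x
    have e1 : V x - V 0 - x * c = ∫ t in (0:ℝ)..1, ∫ s in (0:ℝ)..x,
        (x - s) * (30 * t ^ 2 * (1 - t) ^ 2 * S.uxx (t, s)) := by
      rw [hV, hc, ← intervalIntegral.integral_const_mul, ← intervalIntegral.integral_sub
        (Continuous.intervalIntegrable (by fun_prop) _ _)
        (Continuous.intervalIntegrable (by fun_prop) _ _), ← intervalIntegral.integral_sub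
        (Continuous.intervalIntegrable (by fun_prop) _ _)
        (Continuous.intervalIntegrable (by fun_prop) _ _)]
      refine intervalIntegral.integral_congr fun t _ => ?_
      have := taylor_two_integral (S.dx_u t) (S.dx_ux t) (by fun_prop) x
      have e2 : ∀ s, (x - s) * (30 * t ^ 2 * (1 - t) ^ 2 * S.uxx (t, s)) =
        (30 * t ^ 2 * (1 - t) ^ 2) * ((x - s) * S.uxx (t, s)) := fun s => by ring
      simp only [e2, intervalIntegral.integral_const_mul]
      rw [← this]; ring
    rw [e1, intervalIntegral_swap_of_continuous (f := fun p : ℝ × ℝ =>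
      (x - p.2) * (30 * p.1 ^ 2 * (1 - p.1) ^ 2 * S.uxx p)) (by fun_prop)]
    simp only [intervalIntegral.integral_const_mul, hq]
  have hqf : ∀ s ∈ Icc (-A) A, |q s - g (v s) * deriv g (v s)| ≤
      (Real.exp (2 * A) * 60 + 1) * δ := by
    intro s hs
    rw [hq]
    simp only
    rw [S.integral_bump_uxx hg hT (v s) s]
    have a1 : |∫ t in (0:ℝ)..1, (60 - 360 * t + 360 * t ^ 2) * (S.u (t, s) - v s)| ≤ 60 * δ := by
      have := abs_integral_le_of_abs_le (h := fun _ => 60 * δ)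
        (f := fun t => (60 - 360 * t + 360 * t ^ 2) * (S.u (t, s) - v s)) (by fun_prop)
        (by fun_prop) zero_le_one le_rfl fun t ht => by
          rw [abs_mul]
          refine mul_le_mul ?_ (hδ t ht s hs) (abs_nonneg _) (by norm_num)
          rw [abs_le]
          constructor <;> nlinarith [ht.1, ht.2, sq_nonneg (2 * t - 1)]
      simpa using this
    have a2 := abs_integral_bump_sub_le (c := g (v s) * deriv g (v s))
      (h := fun t => g (S.u (t, s)) * deriv g (S.u (t, s))) (by fun_prop)
      fun t ht => hδf t ht s hs
    have a3 : Real.exp (2 * s) ≤ Real.exp (2 * A) := Real.exp_le_exp.2 (by linarith [hs.2])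
    have a4 : |Real.exp (2 * s) * ∫ t in (0:ℝ)..1, (60 - 360 * t + 360 * t ^ 2) *
        (S.u (t, s) - v s)| ≤ Real.exp (2 * A) * (60 * δ) := by
      rw [abs_mul, abs_of_pos (Real.exp_pos _)]
      exact mul_le_mul a3 a1 (abs_nonneg _) (Real.exp_pos _).le
    rw [add_sub_assoc]
    refine (abs_add_le _ _).trans ?_
    linarith
  refine ⟨c, fun x hx => ?_⟩
  have hsub : ∀ s ∈ uIoc 0 x, s ∈ Icc (-A) A ∧ |x - s| ≤ A := by
    intro s hs
    rw [mem_uIoc] at hs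
    rcases hs with hs | hs
    · exact ⟨⟨by linarith, by linarith [hx.2]⟩, abs_le.2 ⟨by linarith, by linarith [hx.2]⟩⟩
    · exact ⟨⟨by linarith [hx.1], by linarith [hx.1]⟩,
        abs_le.2 ⟨by linarith [hx.1], by linarith⟩⟩
  have hI : |(∫ s in (0:ℝ)..x, (x - s) * q s) -
      ∫ s in (0:ℝ)..x, (x - s) * (g (v s) * deriv g (v s))| ≤
      A * ((Real.exp (2 * A) * 60 + 1) * δ) * |x - 0| := by
    rw [← intervalIntegral.integral_sub (Continuous.intervalIntegrable (by fun_prop) _ _)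
        (Continuous.intervalIntegrable (by fun_prop) _ _)]
    rw [← Real.norm_eq_abs]
    refine intervalIntegral.norm_integral_le_of_norm_le_const fun s hs => ?_
    rw [Real.norm_eq_abs, ← mul_sub, abs_mul]
    exact mul_le_mul (hsub s hs).2 (hqf s (hsub s hs).1) (abs_nonneg _) hA
  rw [← htay x, sub_zero] at hI
  have hxA : |x| ≤ A := abs_le.2 hx
  have hI2 : A * ((Real.exp (2 * A) * 60 + 1) * δ) * |x| ≤
      A * ((Real.exp (2 * A) * 60 + 1) * δ) * A := mul_le_mul_of_nonneg_left hxA (by positivity)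
  have b1 := abs_le.1 (hVv x hx)
  have b2 := abs_le.1 (hVv 0 ⟨by linarith, hA⟩)
  have b3 := abs_le.1 (hI.trans hI2)
  rw [abs_le]
  constructor <;> nlinarith

end WaveSol

lemma localized_energy_pointwise {D K η t w N ρ r e y z q : ℝ} (hD : 0 < D) (hK : 1 ≤ K)
    (hη : 0 < η) (hη1 : η ≤ 1) (ht : t ∈ Icc (0:ℝ) 1) (h1 : |w| ≤ η) (h2 : |N| ≤ η)
    (h5 : ρ ≤ D) (h7 : 0 ≤ ρ) (hr : |r| ≤ 4 * D) (h6 : 1 ≤ K * e) (hx0 : 0 < e) :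
    ρ * (2 * (e * y ^ 2) + (2 * (1 - t) * y - w) * N) + r * (2 * (1 - t) * y - w) * (z - q) ≤
      24 * D * K / η * (e * y ^ 2) + 24 * D * K * η * (z ^ 2 + q ^ 2 + 1) := by
  have a1 : |2 * (1 - t) * y - w| ≤ 2 * |y| + η := by
    refine (abs_sub _ _).trans (add_le_add ?_ h1)
    rw [abs_mul, abs_mul, abs_two, abs_of_nonneg (by linarith [ht.2] : 0 ≤ 1 - t)]
    nlinarith [ht.1, abs_nonneg y]
  have a2 : (2 * (1 - t) * y - w) * N ≤ (2 * |y| + η) * η :=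
    (le_abs_self _).trans (by rw [abs_mul]; gcongr)
  have a3 : r * (2 * (1 - t) * y - w) * (z - q) ≤ 4 * D * (2 * |y| + η) * |z - q| :=
    (le_abs_self _).trans (by rw [abs_mul, abs_mul]; gcongr)
  have a4 : ρ * (2 * (e * y ^ 2) + (2 * (1 - t) * y - w) * N) ≤
      D * (2 * (e * y ^ 2) + (2 * |y| + η) * η) := by
    have : 0 ≤ 2 * (e * y ^ 2) + (2 * |y| + η) * η := by positivity
    calc _ ≤ ρ * (2 * (e * y ^ 2) + (2 * |y| + η) * η) := by gcongr
      _ ≤ _ := by gcongr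
  obtain ⟨k, hk⟩ : ∃ k, k = y ^ 2 / η := ⟨_, rfl⟩
  have hkη : k * η = y ^ 2 := by rw [hk]; field_simp
  have hk0 : 0 ≤ k := by rw [hk]; positivity
  have b1 : 2 * |y| * η ≤ k + η := by
    have : (2 * |y| * η) * η ≤ (k + η) * η := by
      rw [add_mul, hkη, ← sq_abs y]
      have h8 : |y| * η * η ≤ |y| * η := mul_le_of_le_one_right (by positivity) hη1
      linarith [sq_nonneg (|y| - η)]
    exact le_of_mul_le_mul_right this hη
  have b2 : 2 * |y| * |z - q| ≤ k + η * (z - q) ^ 2 := by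
    have : (2 * |y| * |z - q|) * η ≤ (k + η * (z - q) ^ 2) * η := by
      rw [add_mul, hkη, ← sq_abs y, ← sq_abs (z - q)]
      nlinarith [sq_nonneg (|y| - η * |z - q|)]
    exact le_of_mul_le_mul_right this hη
  have b3 : η * (2 * |z - q|) ≤ η * (1 + (z - q) ^ 2) := by
    gcongr; rw [← sq_abs (z - q)]; nlinarith [sq_nonneg (|z - q| - 1)]
  have b4 : η * (z - q) ^ 2 ≤ η * (2 * z ^ 2 + 2 * q ^ 2) := by
    gcongr; nlinarith [sq_nonneg (z + q)]
  have b5 : e * y ^ 2 ≤ e * k := by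
    rw [← hkη]; exact mul_le_mul_of_nonneg_left (mul_le_of_le_one_right hk0 hη1) hx0.le
  have b6 : k ≤ K * (e * k) := by
    rw [← mul_assoc]; exact le_mul_of_one_le_left hk0 h6
  have b7 : e * k ≤ K * (e * k) := le_mul_of_one_le_left (mul_nonneg hx0.le hk0) hK
  have b8 : η * η ≤ η := mul_le_of_le_one_right hη.le hη1
  have b9 : 24 * D * K / η * (e * y ^ 2) = 24 * D * K * (e * k) := by rw [hk]; field_simp
  rw [b9]
  have c1 : 2 * (e * y ^ 2) + (2 * |y| + η) * η + 4 * (2 * |y| + η) * |z - q| ≤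
      7 * (K * (e * k)) + η * (4 + 12 * z ^ 2 + 12 * q ^ 2) := by linarith
  have c2 : 7 * (K * (e * k)) + η * (4 + 12 * z ^ 2 + 12 * q ^ 2) ≤
      24 * K * (e * k) + 24 * K * (η * (z ^ 2 + q ^ 2 + 1)) := by
    have : 0 ≤ K * (e * k) := by positivity
    have : η * (z ^ 2 + q ^ 2 + 1) ≤ K * (η * (z ^ 2 + q ^ 2 + 1)) :=
      le_mul_of_one_le_left (by positivity) hK
    have h8 := mul_nonneg hη.le (sq_nonneg z)
    have h9 := mul_nonneg hη.le (sq_nonneg q)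
    linarith
  have c3 := mul_le_mul_of_nonneg_left (c1.trans c2) hD.le
  linarith

namespace WaveSol

variable {g : ℝ → ℝ} {T b₀ E ε : ℝ} (S : WaveSol g T b₀ E ε)

/-- A localized energy identity for the difference of a solution and a static solution. -/
lemma localized_energy_identity (hg : ContDiff ℝ 3 g) (hT : 1 < T) {v p : ℝ → ℝ}
    (hv : ∀ x, HasDerivAt v (p x) x) (hp : ∀ x, HasDerivAt p (g (v x) * deriv g (v x)) x)
    {B : ℝ} (hB : 0 ≤ B) :
    ∫ x in (-B)..B, ((B - x) * (B + x)) ^ 2 *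
        (Real.exp (2 * x) * S.ut (0, x) ^ 2 + (S.ux (0, x) - p x) ^ 2) =
      (∫ x in (-B)..B, ((B - x) * (B + x)) ^ 2 *
        (Real.exp (2 * x) * ((S.u (0, x) - v x) * S.ut (0, x)))) -
      (∫ x in (-B)..B, ((B - x) * (B + x)) ^ 2 *
        (Real.exp (2 * x) * ((S.u (1, x) - v x) * S.ut (1, x)))) +
      ∫ t in (0:ℝ)..1, ∫ x in (-B)..B, (((B - x) * (B + x)) ^ 2 *
        (2 * (Real.exp (2 * x) * S.ut (t, x) ^ 2) + (2 * (1 - t) * S.ut (t, x) -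
          (S.u (t, x) - v x)) * (g (S.u (t, x)) * deriv g (S.u (t, x)) - g (v x) * deriv g (v x))) +
        2 * ((B - x) * (B + x)) * (-(2 * x)) * (2 * (1 - t) * S.ut (t, x) - (S.u (t, x) - v x)) *
          (S.ux (t, x) - p x)) := by
  have hg1 : Continuous (deriv g) := hg.continuous_deriv (by norm_num)
  have hg0 : Continuous g := hg.continuous
  have hvc : Continuous v := continuous_iff_continuousAt.2 fun x => (hv x).continuousAt
  have hpc : Continuous p := continuous_iff_continuousAt.2 fun x => (hp x).continuousAt
  have key := rectangle_divergence (z₀ := 0) (z₁ := 1) (a := -B) (b := B)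
    (F := fun q => ((B - q.2) * (B + q.2)) ^ 2 *
      ((1 - q.1) * (Real.exp (2 * q.2) * S.ut q ^ 2 + (S.ux q - p q.2) ^ 2) -
        Real.exp (2 * q.2) * ((S.u q - v q.2) * S.ut q)))
    (Fz := fun q => ((B - q.2) * (B + q.2)) ^ 2 *
      (-(Real.exp (2 * q.2) * S.ut q ^ 2 + (S.ux q - p q.2) ^ 2) +
        (1 - q.1) * (Real.exp (2 * q.2) * (2 * S.ut q * S.utt q) +
          2 * (S.ux q - p q.2) * S.utx q) -
        Real.exp (2 * q.2) * (S.ut q * S.ut q + (S.u q - v q.2) * S.utt q)))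
    (G := fun q => ((B - q.2) * (B + q.2)) ^ 2 *
      ((S.u q - v q.2 - 2 * (1 - q.1) * S.ut q) * (S.ux q - p q.2)))
    (Gx := fun q => 2 * ((B - q.2) * (B + q.2)) * (-(2 * q.2)) *
      ((S.u q - v q.2 - 2 * (1 - q.1) * S.ut q) * (S.ux q - p q.2)) +
      ((B - q.2) * (B + q.2)) ^ 2 *
      ((S.ux q - p q.2 - 2 * (1 - q.1) * S.utx q) * (S.ux q - p q.2) +
       (S.u q - v q.2 - 2 * (1 - q.1) * S.ut q) *
        (S.uxx q - g (v q.2) * deriv g (v q.2))))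
    (H := fun q => -(((B - q.2) * (B + q.2)) ^ 2 *
        (2 * (Real.exp (2 * q.2) * S.ut q ^ 2) + (2 * (1 - q.1) * S.ut q -
          (S.u q - v q.2)) * (g (S.u q) * deriv g (S.u q) - g (v q.2) * deriv g (v q.2))) +
        2 * ((B - q.2) * (B + q.2)) * (-(2 * q.2)) * (2 * (1 - q.1) * S.ut q - (S.u q - v q.2)) *
          (S.ux q - p q.2)))
    (by fun_prop) (by fun_prop) (by fun_prop) (by fun_prop) zero_le_one (by linarith)
    (fun t ht x _ => by
      have ht' : t ∈ Ioo 0 T := ⟨ht.1, ht.2.trans hT⟩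
      have h1 := S.dt_u ht' x
      have h2 := S.dt_ut ht' x
      have h3 := S.dt_ux ht' x
      refine (((((hasDerivAt_id t).const_sub 1).mul (((h2.pow 2).const_mul (Real.exp (2 * x))).add
        ((h3.sub_const (p x)).pow 2))).sub
        (((h1.sub_const (v x)).mul h2).const_mul (Real.exp (2 * x)))).const_mul
          (((B - x) * (B + x)) ^ 2)).congr_deriv ?_
      simp)
    (fun t ht x _ => by
      have h1 := S.dx_u t x
      have h2 := S.dx_ut t x
      have h3 := S.dx_ux t x
      have hr : HasDerivAt (fun x : ℝ => (B - x) * (B + x)) (-(2 * x)) x := by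
        refine (((hasDerivAt_id x).const_sub B).mul ((hasDerivAt_id x).const_add B)).congr_deriv ?_
        simp; ring
      refine ((hr.pow 2).mul (((h1.sub (hv x)).sub (h2.const_mul (2 * (1 - t)))).mul
        (h3.sub (hp x)))).congr_deriv ?_
      simp)
    (fun t ht x _ => by
      have := S.eqn t ⟨ht.1, ht.2.trans hT.le⟩ x
      linear_combination ((B - x) * (B + x)) ^ 2 *
        (2 * (1 - t) * S.ut (t, x) - (S.u (t, x) - v x)) * this)
  simp only [sub_self, add_neg_cancel, zero_mul, mul_zero, ne_eq, OfNat.ofNat_ne_zero,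
    not_false_eq_true, zero_pow, intervalIntegral.integral_zero, add_zero, sub_zero, one_mul,
    intervalIntegral.integral_neg, zero_sub, mul_neg, mul_sub] at key
  rw [intervalIntegral.integral_sub (Continuous.intervalIntegrable (by fun_prop) _ _)
    (Continuous.intervalIntegrable (by fun_prop) _ _)] at key
  simp only [mul_neg, mul_sub]
  linarith

/-- Uniform closeness to a static solution and small kinetic energy imply closeness of the
derivative in `L²`. -/
lemma integral_sq_ux_sub_le (hg : ContDiff ℝ 3 g) (hT : 1 < T) {v p : ℝ → ℝ}
    (hv : ∀ x, HasDerivAt v (p x) x) (hp : ∀ x, HasDerivAt p (g (v x) * deriv g (v x)) x)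
    {B η : ℝ} (hB : 1 ≤ B) (hBb : B ≤ b₀) (hη : 0 < η) (hη1 : η ≤ 1) (hε : ε ≤ η ^ 2)
    (hδ : ∀ t ∈ Icc (0:ℝ) 1, ∀ x ∈ Icc (-B) B, |S.u (t, x) - v x| ≤ η)
    (hδf : ∀ t ∈ Icc (0:ℝ) 1, ∀ x ∈ Icc (-B) B,
      |g (S.u (t, x)) * deriv g (S.u (t, x)) - g (v x) * deriv g (v x)| ≤ η) :
    ∫ x in (-(B - 1))..(B - 1), (S.ux (0, x) - p x) ^ 2 ≤
      24 * B ^ 4 * Real.exp (2 * B) * (3 * E + 6 * B + 1 + ∫ x in (-B)..B, p x ^ 2) * η := by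
  have hg1 : Continuous (deriv g) := hg.continuous_deriv (by norm_num)
  have hg0 : Continuous g := hg.continuous
  have hvc : Continuous v := continuous_iff_continuousAt.2 fun x => (hv x).continuousAt
  have hpc : Continuous p := continuous_iff_continuousAt.2 fun x => (hp x).continuousAt
  have hBB : -B ≤ B := by linarith
  set M := 24 * B ^ 4 * Real.exp (2 * B) with hM
  set P := ∫ x in (-B)..B, p x ^ 2 with hP
  have hB4 : 0 < B ^ 4 := by positivity
  have hexp1 : 1 ≤ Real.exp (2 * B) := Real.one_le_exp (by linarith)
  have hM0 : 0 ≤ M := by positivity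
  have hρ : ∀ x ∈ Icc (-B) B, 0 ≤ (B - x) * (B + x) ∧ (B - x) * (B + x) ≤ B ^ 2 := by
    intro x hx
    exact ⟨mul_nonneg (by linarith [hx.2]) (by linarith [hx.1]), by nlinarith [sq_nonneg x]⟩
  have hρ2 : ∀ x ∈ Icc (-B) B, ((B - x) * (B + x)) ^ 2 ≤ B ^ 4 := by
    intro x hx
    calc ((B - x) * (B + x)) ^ 2 ≤ (B ^ 2) ^ 2 := pow_le_pow_left₀ (hρ x hx).1 (hρ x hx).2 2
      _ = B ^ 4 := by ring
  have hcomp : ∫ x in (-(B - 1))..(B - 1), (S.ux (0, x) - p x) ^ 2 ≤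
      ∫ x in (-B)..B, ((B - x) * (B + x)) ^ 2 *
        (Real.exp (2 * x) * S.ut (0, x) ^ 2 + (S.ux (0, x) - p x) ^ 2) := by
    calc ∫ x in (-(B - 1))..(B - 1), (S.ux (0, x) - p x) ^ 2
        ≤ ∫ x in (-(B - 1))..(B - 1), ((B - x) * (B + x)) ^ 2 *
          (Real.exp (2 * x) * S.ut (0, x) ^ 2 + (S.ux (0, x) - p x) ^ 2) := by
          refine integral_mono_of_continuous (by fun_prop) (by fun_prop) (by linarith)
            fun x hx => ?_
          have h1 : 1 ≤ (B - x) * (B + x) := by nlinarith [hx.1, hx.2]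
          have h2 : 1 ≤ ((B - x) * (B + x)) ^ 2 := one_le_pow₀ h1
          have h3 : 0 ≤ Real.exp (2 * x) * S.ut (0, x) ^ 2 := by positivity
          nlinarith [sq_nonneg (S.ux (0, x) - p x)]
      _ ≤ _ := by
          refine intervalIntegral.integral_mono_interval (by linarith) (by linarith) (by linarith)
            (Eventually.of_forall fun x => by positivity)
            (Continuous.intervalIntegrable (by fun_prop) _ _)
  refine hcomp.trans ?_
  rw [S.localized_energy_identity hg hT hv hp (by linarith)]
  have hkinE : ∀ t ∈ Icc (0:ℝ) 1, ∫ x in (-B)..B, Real.exp (2 * x) * S.ut (t, x) ^ 2 ≤ E := by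
    intro t ht
    refine (integral_mono_of_continuous (by fun_prop) (h := fun x => Real.exp (2 * x) *
      S.ut (t, x) ^ 2 + S.ux (t, x) ^ 2 + g (S.u (t, x)) ^ 2) (by fun_prop) hBB
      fun x _ => ?_).trans (S.energy t ⟨ht.1, ht.2.trans hT.le⟩ _ _ hBB)
    nlinarith [sq_nonneg (S.ux (t, x)), sq_nonneg (g (S.u (t, x)))]
  have hbd : ∀ t ∈ Icc (0:ℝ) 1, ∀ x ∈ Icc (-B) B, |((B - x) * (B + x)) ^ 2 *
      (Real.exp (2 * x) * ((S.u (t, x) - v x) * S.ut (t, x)))| ≤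
        M * η * (Real.exp (2 * x) * S.ut (t, x) ^ 2) + M * η * 1 := by
    intro t ht x hx
    have h1 := hδ t ht x hx
    have h2 : Real.exp (2 * x) ≤ Real.exp (2 * B) := Real.exp_le_exp.2 (by linarith [hx.2])
    have h3 : |S.ut (t, x)| ≤ S.ut (t, x) ^ 2 + 1 := by
      rw [← sq_abs]; nlinarith [sq_nonneg (|S.ut (t, x)| - 1), abs_nonneg (S.ut (t, x))]
    rw [abs_mul, abs_mul, abs_mul, abs_of_nonneg (sq_nonneg _), abs_of_pos (Real.exp_pos _)]
    calc ((B - x) * (B + x)) ^ 2 * (Real.exp (2 * x) * (|S.u (t, x) - v x| * |S.ut (t, x)|))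
        ≤ B ^ 4 * (Real.exp (2 * x) * (η * (S.ut (t, x) ^ 2 + 1))) := by
          have := hρ2 x hx; gcongr
      _ = B ^ 4 * η * (Real.exp (2 * x) * S.ut (t, x) ^ 2) + B ^ 4 * η * Real.exp (2 * x) := by ring
      _ ≤ M * η * (Real.exp (2 * x) * S.ut (t, x) ^ 2) + M * η * 1 := by
          have k1 : B ^ 4 ≤ M := by rw [hM]; nlinarith
          have k2 : B ^ 4 * Real.exp (2 * x) ≤ M := by rw [hM]; nlinarith
          have k3 : B ^ 4 * η * Real.exp (2 * x) ≤ M * η * 1 := by nlinarith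
          gcongr
  have hbdI : ∀ t ∈ Icc (0:ℝ) 1, |∫ x in (-B)..B, ((B - x) * (B + x)) ^ 2 *
      (Real.exp (2 * x) * ((S.u (t, x) - v x) * S.ut (t, x)))| ≤ M * η * E + M * η * (2 * B) := by
    intro t ht
    refine (intervalIntegral.abs_integral_le_integral_abs hBB).trans ?_
    refine (integral_le_add_of_continuous (by fun_prop)
      (h := fun x => Real.exp (2 * x) * S.ut (t, x) ^ 2) (k := fun _ => 1)
      (by fun_prop) (by fun_prop) (M * η) (M * η) hBB (hbd t ht)).trans ?_
    have := hkinE t ht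
    have e : ∫ _ in (-B)..B, (1:ℝ) = 2 * B := by simp; ring
    rw [e]
    gcongr
  have hin : ∀ t ∈ Icc (0:ℝ) 1, ∫ x in (-B)..B, (((B - x) * (B + x)) ^ 2 *
        (2 * (Real.exp (2 * x) * S.ut (t, x) ^ 2) + (2 * (1 - t) * S.ut (t, x) -
          (S.u (t, x) - v x)) * (g (S.u (t, x)) * deriv g (S.u (t, x)) - g (v x) * deriv g (v x))) +
        2 * ((B - x) * (B + x)) * (-(2 * x)) * (2 * (1 - t) * S.ut (t, x) - (S.u (t, x) - v x)) *
          (S.ux (t, x) - p x)) ≤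
      M / η * (∫ x in (-B)..B, Real.exp (2 * x) * S.ut (t, x) ^ 2) +
        M * η * (E + P + 2 * B) := by
    intro t ht
    refine (integral_le_add_of_continuous (by fun_prop)
      (h := fun x => Real.exp (2 * x) * S.ut (t, x) ^ 2)
      (k := fun x => S.ux (t, x) ^ 2 + p x ^ 2 + 1)
      (by fun_prop) (by fun_prop) (M / η) (M * η) hBB fun x hx => ?_).trans ?_
    · have h1 := hδ t ht x hx
      have h2 := hδf t ht x hx
      obtain ⟨h3, h4⟩ := hρ x hx
      have h5 := hρ2 x hx
      have h6 : 1 ≤ Real.exp (2 * B) * Real.exp (2 * x) := by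
        rw [← Real.exp_add]; exact Real.one_le_exp (by linarith [hx.1])
      have hx0 := Real.exp_pos (2 * x)
      generalize g (S.u (t, x)) * deriv g (S.u (t, x)) - g (v x) * deriv g (v x) = N at h2 ⊢
      generalize S.u (t, x) - v x = w at h1 ⊢
      generalize S.ut (t, x) = y
      generalize S.ux (t, x) = z
      generalize p x = q
      generalize Real.exp (2 * x) = e at h6 hx0 ⊢
      have hr : |2 * ((B - x) * (B + x)) * (-(2 * x))| ≤ 4 * B ^ 4 := by
        have : |x| ≤ B := abs_le.2 hx
        rw [abs_mul, abs_neg, abs_mul, abs_mul 2 x, abs_two, abs_of_nonneg h3]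
        calc 2 * ((B - x) * (B + x)) * (2 * |x|) ≤ 2 * B ^ 2 * (2 * B) := by gcongr
          _ = 4 * B ^ 3 := by ring
          _ ≤ 4 * B ^ 4 := by
            have : B ^ 3 ≤ B ^ 4 := pow_le_pow_right₀ hB (by norm_num)
            linarith
      generalize 2 * ((B - x) * (B + x)) * (-(2 * x)) = r at hr ⊢
      have h7 := sq_nonneg ((B - x) * (B + x))
      generalize ((B - x) * (B + x)) ^ 2 = ρ at h5 h7 ⊢
      exact localized_energy_pointwise hB4 hexp1 hη hη1 ht h1 h2 h5 h7 hr h6 hx0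
    · have e1 : ∫ x in (-B)..B, (S.ux (t, x) ^ 2 + p x ^ 2 + 1) =
          (∫ x in (-B)..B, S.ux (t, x) ^ 2) + P + 2 * B := by
        rw [intervalIntegral.integral_add (Continuous.intervalIntegrable (by fun_prop) _ _)
          (Continuous.intervalIntegrable (by fun_prop) _ _), intervalIntegral.integral_add
          (Continuous.intervalIntegrable (by fun_prop) _ _)
          (Continuous.intervalIntegrable (by fun_prop) _ _)]
        simp; ring
      have := S.integral_ux_sq_le ⟨ht.1, ht.2.trans hT.le⟩ hg0 hBB
      rw [e1]
      gcongr
  have hdouble := integral_le_add_of_continuous (a := 0) (b := 1) (k := fun _ => 1)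
    (continuous_integral_slice (f := fun q => (((B - q.2) * (B + q.2)) ^ 2 *
        (2 * (Real.exp (2 * q.2) * S.ut q ^ 2) + (2 * (1 - q.1) * S.ut q -
          (S.u q - v q.2)) * (g (S.u q) * deriv g (S.u q) - g (v q.2) * deriv g (v q.2))) +
        2 * ((B - q.2) * (B + q.2)) * (-(2 * q.2)) * (2 * (1 - q.1) * S.ut q - (S.u q - v q.2)) *
          (S.ux q - p q.2))) (by fun_prop) (-B) B)
    (continuous_integral_slice (f := fun q => Real.exp (2 * q.2) * S.ut q ^ 2) (by fun_prop) (-B) B)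
    (by fun_prop) (M / η) (M * η * (E + P + 2 * B)) zero_le_one
    (fun t ht => by simpa using hin t ht)
  have hkin := S.kin 1 one_pos hT.le (-B) B hBB hBb
  have hk2 : M / η * (∫ t in (0:ℝ)..1, ∫ x in (-B)..B, Real.exp (2 * x) * S.ut (t, x) ^ 2) ≤
      M * η := by
    calc _ ≤ M / η * η ^ 2 := by gcongr; linarith
      _ = M * η := by field_simp
  have h0 := abs_le.1 (hbdI 0 (by simp))
  have h1 := abs_le.1 (hbdI 1 (by simp))
  simp only [intervalIntegral.integral_const, sub_zero, smul_eq_mul, mul_one] at hdouble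
  linarith

end WaveSol

/-- A static solution in the logarithmic variable, together with its derivative, with energy
bounded by `B`. -/
structure IsProfile (g v p : ℝ → ℝ) (B : ℝ) : Prop where
  hv : ∀ x, HasDerivAt v (p x) x
  hp : ∀ x, HasDerivAt p (g (v x) * deriv g (v x)) x
  energy : ∀ a b, a ≤ b → ∫ x in a..b, (p x ^ 2 + g (v x) ^ 2) ≤ B

lemma IsProfile.continuous {g v p : ℝ → ℝ} {B : ℝ} (h : IsProfile g v p B) : Continuous v :=
  continuous_iff_continuousAt.2 fun x => (h.hv x).continuousAt

lemma IsProfile.continuous_deriv {g v p : ℝ → ℝ} {B : ℝ} (h : IsProfile g v p B) : Continuous p :=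
  continuous_iff_continuousAt.2 fun x => (h.hp x).continuousAt

lemma exists_abs_comp_sub_le {f v : ℝ → ℝ} (hf : Continuous f) (hv : Continuous v) (A : ℝ) {η : ℝ}
    (hη : 0 < η) :
    ∃ δ > 0, ∀ x ∈ Icc (-A) A, ∀ y, |y - v x| ≤ δ → |f y - f (v x)| ≤ η := by
  have hc : IsCompact (v '' Icc (-A) A) := isCompact_Icc.image hv
  have := hc.uniformContinuousAt_of_continuousAt f (fun a _ => hf.continuousAt)
    (Metric.dist_mem_uniformity hη)
  obtain ⟨δ, hδ, h⟩ := Metric.mem_uniformity_dist.1 this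
  refine ⟨δ / 2, by positivity, fun x hx y hy => ?_⟩
  have h1 : dist (v x) y < δ := by rw [dist_comm, Real.dist_eq]; linarith
  have h2 := h h1 (mem_image_of_mem v hx)
  rw [mem_ofPred_eq, dist_comm, Real.dist_eq] at h2
  exact h2.le

namespace WaveSol

variable {g : ℝ → ℝ} {E : ℝ} {l : Filter ℕ} {T b ε : ℕ → ℝ}
  {S : ∀ n, WaveSol g (T n) (b n) E (ε n)} {v : ℝ → ℝ}

lemma E_nonneg (hg : Continuous g) {T b₀ ε : ℝ} (S : WaveSol g T b₀ E ε) : 0 ≤ E :=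
  le_trans (integral_nonneg_of_continuous le_rfl fun _ _ => sq_nonneg _)
    (S.integral_ux_sq_le (t := 0) ⟨le_rfl, S.T_pos.le⟩ hg (le_refl (0:ℝ)))

lemma eventually_time_osc_le (hg : Continuous g) (hT : Tendsto T l atTop) (hb : Tendsto b l atTop)
    (hε : Tendsto ε l (𝓝 0)) (A : ℝ) {η : ℝ} (hη : 0 < η) :
    ∀ᶠ n in l, ∀ t ∈ Icc (0:ℝ) 1, ∀ x ∈ Icc (-A) A,
      |(S n).u (t, x) - (S n).u (0, x)| ≤ η := by
  have hE := E_nonneg hg (S 0)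
  obtain ⟨h, hh, hh2⟩ : ∃ h > 0, 6 * E * h ≤ η ^ 2 / 2 := by
    refine ⟨η ^ 2 / (12 * (E + 1)), by positivity, ?_⟩
    rw [mul_div_assoc', div_le_div_iff₀ (by positivity) (by positivity)]
    nlinarith [sq_nonneg η]
  have hlim : Tendsto (fun n => 3 * Real.exp (2 * A) / h * |ε n|) l (𝓝 0) := by
    simpa using hε.abs.const_mul (3 * Real.exp (2 * A) / h)
  filter_upwards [hT.eventually_ge_atTop 1, hb.eventually_ge_atTop (A + h),
    hlim.eventually_le_const (by positivity : (0:ℝ) < η ^ 2 / 2)] with n h1 h2 h3 t ht x hx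
  have h4 := (S n).sq_time_osc_le (x := x) hg ht.1 ht.2 one_pos h1 hh (by linarith [hx.2])
  have h5 : 3 * (1:ℝ) ^ 2 * Real.exp (-(2 * x)) * ε n / h ≤ 3 * Real.exp (2 * A) / h * |ε n| := by
    calc _ ≤ 3 * (1:ℝ) ^ 2 * Real.exp (-(2 * x)) * |ε n| / h := by gcongr; exact le_abs_self _
      _ ≤ 3 * (1:ℝ) ^ 2 * Real.exp (2 * A) * |ε n| / h := by gcongr; linarith [hx.1]
      _ = _ := by ring
  exact abs_le_of_sq_le_sq (by linarith) hη.le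

variable [NeBot l]

lemma sq_limit_sub_le (hg : Continuous g)
    (hv : ∀ x, Tendsto (fun n => (S n).u (0, x)) l (𝓝 (v x))) (x y : ℝ) :
    (v y - v x) ^ 2 ≤ E * |y - x| := by
  refine le_of_tendsto (((hv y).sub (hv x)).pow 2) (Eventually.of_forall fun n => ?_)
  rcases le_total x y with h | h
  · rw [abs_of_nonneg (by linarith)]
    exact (S n).sq_sub_le ⟨le_rfl, (S n).T_pos.le⟩ hg h
  · rw [abs_of_nonpos (by linarith), neg_sub]
    have := (S n).sq_sub_le (t := 0) ⟨le_rfl, (S n).T_pos.le⟩ hg h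
    nlinarith

lemma continuous_limit (hg : Continuous g)
    (hv : ∀ x, Tendsto (fun n => (S n).u (0, x)) l (𝓝 (v x))) : Continuous v := by
  have hE := E_nonneg hg (S 0)
  rw [Metric.continuous_iff]
  intro x η hη
  refine ⟨η ^ 2 / (2 * (E + 1)), by positivity, fun y hy => ?_⟩
  rw [Real.dist_eq] at hy ⊢
  have h1 := sq_limit_sub_le hg hv x y
  have h2 : E * |y - x| ≤ (E + 1) * (η ^ 2 / (2 * (E + 1))) := by gcongr; linarith
  have h3 : (E + 1) * (η ^ 2 / (2 * (E + 1))) = η ^ 2 / 2 := by field_simp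
  exact abs_lt_of_sq_lt_sq (by nlinarith) hη.le

lemma eventually_abs_sub_limit_le (hg : Continuous g) (hT : Tendsto T l atTop)
    (hb : Tendsto b l atTop) (hε : Tendsto ε l (𝓝 0))
    (hv : ∀ x, Tendsto (fun n => (S n).u (0, x)) l (𝓝 (v x))) (A : ℝ) {η : ℝ} (hη : 0 < η) :
    ∀ᶠ n in l, ∀ t ∈ Icc (0:ℝ) 1, ∀ x ∈ Icc (-A) A, |(S n).u (t, x) - v x| ≤ η := by
  have hE := E_nonneg hg (S 0)
  have h0 : ∀ᶠ n in l, ∀ x ∈ Icc (-A) A, |(S n).u (0, x) - v x| ≤ 3 * (η / 4) := by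
    refine isCompact_Icc.induction_on (p := fun s => ∀ᶠ n in l, ∀ x ∈ s,
      |(S n).u (0, x) - v x| ≤ 3 * (η / 4)) (by simp)
      (fun s t hst ht => ht.mono fun n h x hx => h x (hst hx))
      (fun s t hs ht => (hs.and ht).mono fun n h x hx => hx.elim (h.1 x) (h.2 x)) fun x₀ _ => ?_
    set r := (η / 4) ^ 2 / (E + 1) with hr
    have hr0 : 0 < r := by positivity
    have hEr : E * r ≤ (η / 4) ^ 2 := by
      rw [hr, mul_div_assoc', div_le_iff₀ (by positivity)]
      nlinarith [sq_nonneg (η / 4)]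
    refine ⟨Metric.closedBall x₀ r, mem_nhdsWithin_of_mem_nhds (Metric.closedBall_mem_nhds _ hr0),
      ?_⟩
    have hclose : ∀ᶠ n in l, |(S n).u (0, x₀) - v x₀| ≤ η / 4 := by
      have : Tendsto (fun n => |(S n).u (0, x₀) - v x₀|) l (𝓝 0) := by
        simpa using ((hv x₀).sub_const (v x₀)).abs
      exact this.eventually_le_const (by positivity)
    filter_upwards [hclose] with n hn x hx
    rw [Metric.mem_closedBall, Real.dist_eq] at hx
    have h1 : |v x - v x₀| ≤ η / 4 := by
      refine abs_le_of_sq_le_sq ((sq_limit_sub_le hg hv x₀ x).trans ?_) (by positivity)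
      exact (mul_le_mul_of_nonneg_left hx hE).trans hEr
    have h2 : |(S n).u (0, x) - (S n).u (0, x₀)| ≤ η / 4 := by
      refine abs_le_of_sq_le_sq (le_trans ?_ ((mul_le_mul_of_nonneg_left hx hE).trans hEr))
        (by positivity)
      rcases le_total x₀ x with h | h
      · rw [abs_of_nonneg (by linarith)]
        exact (S n).sq_sub_le ⟨le_rfl, (S n).T_pos.le⟩ hg h
      · rw [abs_of_nonpos (by linarith), neg_sub]
        have := (S n).sq_sub_le (t := 0) ⟨le_rfl, (S n).T_pos.le⟩ hg h
        nlinarith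
    rw [abs_le] at *
    constructor <;> linarith
  filter_upwards [h0, eventually_time_osc_le (S := S) hg hT hb hε A
    (by positivity : 0 < η / 4)] with n h1 h2 t ht x hx
  have h3 := abs_le.1 (h1 x hx)
  have h4 := abs_le.1 (h2 t ht x hx)
  rw [abs_le]
  constructor <;> linarith

lemma eventually_abs_comp_sub_limit_le (hg : Continuous g) (hT : Tendsto T l atTop)
    (hb : Tendsto b l atTop) (hε : Tendsto ε l (𝓝 0))
    (hv : ∀ x, Tendsto (fun n => (S n).u (0, x)) l (𝓝 (v x))) {f : ℝ → ℝ} (hf : Continuous f)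
    (A : ℝ) {η : ℝ} (hη : 0 < η) :
    ∀ᶠ n in l, ∀ t ∈ Icc (0:ℝ) 1, ∀ x ∈ Icc (-A) A, |f ((S n).u (t, x)) - f (v x)| ≤ η := by
  obtain ⟨δ, hδ, h⟩ := exists_abs_comp_sub_le hf (continuous_limit hg hv) A hη
  filter_upwards [eventually_abs_sub_limit_le hg hT hb hε hv A hδ] with n hn t ht x hx
  exact h x hx _ (hn t ht x hx)

lemma limit_eq_taylor (hg : ContDiff ℝ 3 g) (hT : Tendsto T l atTop)
    (hb : Tendsto b l atTop) (hε : Tendsto ε l (𝓝 0))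
    (hv : ∀ x, Tendsto (fun n => (S n).u (0, x)) l (𝓝 (v x))) :
    ∃ c, ∀ x, v x = v 0 + x * c + ∫ s in (0:ℝ)..x, (x - s) * (g (v s) * deriv g (v s)) := by
  have hg1 : Continuous (deriv g) := hg.continuous_deriv (by norm_num)
  have hg0 : Continuous g := hg.continuous
  set h : ℝ → ℝ := fun x => v x - v 0 - ∫ s in (0:ℝ)..x, (x - s) * (g (v s) * deriv g (v s)) with hh
  refine ⟨h 1, fun x => ?_⟩
  suffices hx : h x = x * h 1 by rw [← hx, hh]; ring
  set A := |x| + 1 with hA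
  have hA1 : 1 ≤ A := by have := abs_nonneg x; linarith
  have hxA : x ∈ Icc (-A) A := abs_le.1 (by linarith)
  set K := 2 + A * (A * (Real.exp (2 * A) * 60 + 1)) with hK
  have hK0 : 0 < K := by positivity
  have hall : ∀ δ > 0, |h x - x * h 1| ≤ (1 + A) * K * δ := by
    intro δ hδ
    obtain ⟨n, h1, h2, h3⟩ := ((hT.eventually_gt_atTop 1).and
      ((eventually_abs_sub_limit_le hg0 hT hb hε hv A hδ).and
      (eventually_abs_comp_sub_limit_le hg0 hT hb hε hv (f := fun y => g y * deriv g y)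
        (by fun_prop) A hδ))).exists
    obtain ⟨c, hc⟩ := (S n).exists_abs_sub_taylor_le hg h1 (continuous_limit hg0 hv)
      (by linarith) h2 h3
    have e : ∀ y, v y - v 0 - y * c - ∫ s in (0:ℝ)..y, (y - s) * (g (v s) * deriv g (v s)) =
      h y - y * c := fun y => by rw [hh]; ring
    simp only [e] at hc
    have k1 := hc x hxA
    have k2 := hc 1 ⟨by linarith, hA1⟩
    rw [one_mul] at k2
    have k3 : |x * (h 1 - c)| ≤ A * (K * δ) := by
      rw [abs_mul]; exact mul_le_mul (by linarith) k2 (abs_nonneg _) (by linarith)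
    have k4 : h x - x * h 1 = (h x - x * c) - x * (h 1 - c) := by ring
    rw [k4]
    refine (abs_sub _ _).trans ?_
    linarith
  have hz : |h x - x * h 1| ≤ 0 := by
    refine le_of_forall_pos_le_add fun η hη => ?_
    have := hall (η / ((1 + A) * K)) (by positivity)
    rwa [mul_div_cancel₀ _ (by positivity), ← zero_add η] at this
  linarith [abs_nonpos_iff.1 hz]

/-- Rescaled limits of wave maps with vanishing kinetic energy are static, and the convergence is
strong at the initial time. -/
theorem exists_profile (hg : ContDiff ℝ 3 g) (hT : Tendsto T l atTop)
    (hb : Tendsto b l atTop) (hε : Tendsto ε l (𝓝 0))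
    (hv : ∀ x, Tendsto (fun n => (S n).u (0, x)) l (𝓝 (v x))) :
    ∃ p, IsProfile g v p (2 * E + 1) ∧ ∀ A, ∀ η > 0, ∀ᶠ n in l,
      (∀ x ∈ Icc (-A) A, |(S n).u (0, x) - v x| ≤ η) ∧
      ∫ x in (-A)..A, ((S n).ux (0, x) - p x) ^ 2 ≤ η := by
  have hg1 : Continuous (deriv g) := hg.continuous_deriv (by norm_num)
  have hg0 : Continuous g := hg.continuous
  have hE := E_nonneg hg0 (S 0)
  have hvc := continuous_limit hg0 hv
  obtain ⟨c, hc⟩ := limit_eq_taylor hg hT hb hε hv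
  set p : ℝ → ℝ := fun x => c + ∫ s in (0:ℝ)..x, g (v s) * deriv g (v s) with hpdef
  have hF : Continuous fun s => g (v s) * deriv g (v s) := by fun_prop
  have hF2 : Continuous fun s => s * (g (v s) * deriv g (v s)) := by fun_prop
  have hp : ∀ x, HasDerivAt p (g (v x) * deriv g (v x)) x := fun x =>
    (hF.integral_hasStrictDerivAt 0 x).hasDerivAt.const_add c
  have hvp : ∀ x, HasDerivAt v (p x) x := by
    intro x
    have e : ∀ y, v y = v 0 + y * c + (y * (∫ s in (0:ℝ)..y, g (v s) * deriv g (v s)) -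
        ∫ s in (0:ℝ)..y, s * (g (v s) * deriv g (v s))) := by
      intro y
      rw [← intervalIntegral.integral_const_mul, ← intervalIntegral.integral_sub
        (Continuous.intervalIntegrable (by fun_prop) _ _)
        (Continuous.intervalIntegrable (by fun_prop) _ _)]
      rw [hc y]
      congr 2
      funext s
      ring
    refine HasDerivAt.congr_of_eventuallyEq ?_ (Eventually.of_forall e)
    refine ((((hasDerivAt_id x).mul_const c).const_add (v 0)).add (((hasDerivAt_id x).mul
      (hF.integral_hasStrictDerivAt 0 x).hasDerivAt).sub
      (hF2.integral_hasStrictDerivAt 0 x).hasDerivAt)).congr_deriv ?_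
    simp [hpdef]
  have hpc : Continuous p := continuous_iff_continuousAt.2 fun x => (hp x).continuousAt
  have hstrong : ∀ A, ∀ η > 0, ∀ᶠ n in l, ∫ x in (-A)..A, ((S n).ux (0, x) - p x) ^ 2 ≤ η := by
    intro A η hη
    set B := |A| + 1 with hB
    have hB1 : 1 ≤ B := by have := abs_nonneg A; linarith
    have hP : 0 ≤ ∫ x in (-B)..B, p x ^ 2 :=
      integral_nonneg_of_continuous (by linarith) fun _ _ => sq_nonneg _
    set K := 24 * B ^ 4 * Real.exp (2 * B) * (3 * E + 6 * B + 1 + ∫ x in (-B)..B, p x ^ 2) with hK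
    have hK0 : 0 < K := by positivity
    set η' := min 1 (η / K) with hη'
    have h0 : 0 < η' := by positivity
    filter_upwards [hT.eventually_gt_atTop 1, hb.eventually_ge_atTop B,
      hε.eventually_le_const (by positivity : 0 < η' ^ 2),
      eventually_abs_sub_limit_le hg0 hT hb hε hv B h0,
      eventually_abs_comp_sub_limit_le hg0 hT hb hε hv (f := fun y => g y * deriv g y)
        (by fun_prop) B h0] with n h1 h2 h3 h4 h5
    have h6 := (S n).integral_sq_ux_sub_le hg h1 hvp hp hB1 h2 h0 (min_le_left _ _) h3 h4 h5
    have h7 : K * η' ≤ η := by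
      calc K * η' ≤ K * (η / K) := by gcongr; exact min_le_right _ _
        _ = η := by field_simp
    have hBA : B - 1 = |A| := by rw [hB]; ring
    rw [hBA] at h6
    rcases le_total 0 A with hA | hA
    · rw [abs_of_nonneg hA] at h6
      exact h6.trans h7
    · refine le_trans ?_ hη.le
      rw [intervalIntegral.integral_symm]
      have : 0 ≤ ∫ x in A..(-A), ((S n).ux (0, x) - p x) ^ 2 :=
        integral_nonneg_of_continuous (by linarith) fun _ _ => sq_nonneg _
      linarith
  refine ⟨p, ⟨hvp, hp, fun a d had => ?_⟩, fun A η hη => ?_⟩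
  · set A := max |a| |d| + 1 with hA
    have hA1 : 1 ≤ A := by have := (abs_nonneg a).trans (le_max_left |a| |d|); linarith
    have ha : -A ≤ a := by linarith [neg_abs_le a, le_max_left |a| |d|]
    have hd : d ≤ A := by linarith [le_abs_self d, le_max_right |a| |d|]
    obtain ⟨n, h1, h2⟩ := ((hstrong A (1 / 4) (by norm_num)).and
      (eventually_abs_comp_sub_limit_le hg0 hT hb hε hv hg0 A
        (η := 1 / (4 * A)) (by positivity))).exists
    refine (intervalIntegral.integral_mono_interval ha had hd
      (Eventually.of_forall fun x => by positivity)
      (Continuous.intervalIntegrable (by fun_prop) _ _)).trans ?_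
    have hen := (S n).energy 0 ⟨le_rfl, (S n).T_pos.le⟩ (-A) A (by linarith)
    have hle := integral_le_add_of_continuous (a := -A) (b := A)
      (f := fun x => p x ^ 2 + g (v x) ^ 2 - 2 * (1 / (4 * A)) ^ 2)
      (h := fun x => Real.exp (2 * x) * (S n).ut (0, x) ^ 2 + (S n).ux (0, x) ^ 2 +
        g ((S n).u (0, x)) ^ 2) (k := fun x => ((S n).ux (0, x) - p x) ^ 2)
      (by fun_prop) (by fun_prop) (by fun_prop) 2 2 (by linarith) (fun x hx => by
        have h3 := h2 0 (by simp) x hx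
        have h4 : (g ((S n).u (0, x)) - g (v x)) ^ 2 ≤ (1 / (4 * A)) ^ 2 := by
          rw [← sq_abs]; exact pow_le_pow_left₀ (abs_nonneg _) h3 2
        have h5 : 0 ≤ Real.exp (2 * x) * (S n).ut (0, x) ^ 2 := by positivity
        nlinarith [sq_nonneg (2 * (S n).ux (0, x) - p x), sq_nonneg (2 * g ((S n).u (0, x)) - g (v x))])
    rw [intervalIntegral.integral_sub (Continuous.intervalIntegrable (by fun_prop) _ _)
      (Continuous.intervalIntegrable (by fun_prop) _ _), intervalIntegral.integral_const,
      smul_eq_mul] at hle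
    have e1 : (A - -A) * (2 * (1 / (4 * A)) ^ 2) = 1 / (4 * A) := by field_simp; norm_num
    have e2 : 1 / (4 * A) ≤ 1 / 4 := by
      rw [div_le_div_iff₀ (by positivity) (by norm_num)]; linarith
    rw [e1] at hle
    linarith
  · filter_upwards [hstrong A η hη, eventually_abs_sub_limit_le hg0 hT hb hε hv A hη] with n h1 h2
    exact ⟨fun x hx => h2 0 (by simp) x hx, h1⟩

end WaveSol

lemma abs_sub_le_of_hasDerivAt {F F' : ℝ → ℝ} (hF : ∀ y, HasDerivAt F (F' y) y) {a x K : ℝ}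
    (hK : ∀ y ∈ uIcc a x, |F' y| ≤ K) : |F x - F a| ≤ K * |x - a| := by
  simpa using (convex_uIcc a x).norm_image_sub_le_of_norm_hasDerivWithin_le (C := K)
    (fun y _ => (hF y).hasDerivWithinAt) (fun y hy => by simpa using hK y hy)
    left_mem_uIcc right_mem_uIcc

lemma abs_sub_left_le_of_mem_uIcc {a x y : ℝ} (hy : y ∈ uIcc a x) : |y - a| ≤ |x - a| :=
  abs_sub_left_of_mem_uIcc hy

/-- The Taylor bounds of `g` at its zeros are locally uniform. -/
lemma exists_quadBound {g : ℝ → ℝ} (hg : ContDiff ℝ 3 g) (hA3 : A3 g) (M : ℝ) :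
    ∃ C, 1 ≤ C ∧ ∀ ℓ, |ℓ| ≤ M → g ℓ = 0 → QuadBound g ℓ C := by
  have hg1 : ContDiff ℝ 2 (deriv g) := ContDiff.deriv' (n := 2) (hg.of_le (by norm_num))
  have hf : ContDiff ℝ 2 (fun x => g x * deriv g x) := (hg.of_le (by norm_num)).mul hg1
  have hf1 : ContDiff ℝ 1 (deriv fun x => g x * deriv g x) := ContDiff.deriv' (n := 1) (hf.of_le (by norm_num))
  have hf2 : Continuous (deriv (deriv fun x => g x * deriv g x)) :=
    hf1.continuous_deriv le_rfl
  obtain ⟨C, hC⟩ := (isCompact_Icc (a := -(M + 1)) (b := M + 1)).exists_bound_of_continuousOn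
    hf2.continuousOn
  refine ⟨2 * max C 1, by linarith [le_max_right C 1], fun ℓ hℓ hgℓ x hx => ?_⟩
  set D := max C 1
  have hD : ∀ y ∈ uIcc ℓ x, |deriv (deriv fun x => g x * deriv g x) y| ≤ D := by
    intro y hy
    refine le_trans (hC y ?_) (le_max_left _ _)
    have h1 := abs_le.1 ((abs_sub_left_le_of_mem_uIcc hy).trans hx)
    have h2 := abs_le.1 hℓ
    exact ⟨by linarith, by linarith⟩
  have hdg : ∀ y, HasDerivAt g (deriv g y) y := fun y =>
    (hg.differentiable (by norm_num) y).hasDerivAt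
  have hdf : ∀ y, HasDerivAt (fun x => g x * deriv g x) (deriv (fun x => g x * deriv g x) y) y :=
    fun y => (hf.differentiable (by norm_num) y).hasDerivAt
  have hddf : ∀ y, HasDerivAt (deriv fun x => g x * deriv g x)
      (deriv (deriv fun x => g x * deriv g x) y) y :=
    fun y => (hf1.differentiable (by norm_num) y).hasDerivAt
  have hfℓ : deriv (fun x => g x * deriv g x) ℓ = 1 := by
    have h1 : HasDerivAt (fun x => g x * deriv g x) _ ℓ :=
      (hdg ℓ).mul (hg1.differentiable (by norm_num) ℓ).hasDerivAt
    rw [h1.deriv, hgℓ]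
    rcases hA3 ℓ hgℓ with h | h <;> rw [h] <;> norm_num
  have hsub : ∀ y ∈ uIcc ℓ x, uIcc ℓ y ⊆ uIcc ℓ x := fun y hy =>
    uIcc_subset_uIcc left_mem_uIcc hy
  have s1 : ∀ y ∈ uIcc ℓ x, |deriv (fun x => g x * deriv g x) y - 1| ≤ D * |y - ℓ| := by
    intro y hy
    have := abs_sub_le_of_hasDerivAt hddf (a := ℓ) (x := y) fun z hz => hD z (hsub y hy hz)
    rwa [hfℓ] at this
  have s2 : ∀ y ∈ uIcc ℓ x, |g y * deriv g y - (y - ℓ)| ≤ D * |y - ℓ| ^ 2 := by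
    intro y hy
    have := abs_sub_le_of_hasDerivAt (F := fun y => g y * deriv g y - (y - ℓ))
      (fun z => (hdf z).sub ((hasDerivAt_id z).sub_const ℓ)) (a := ℓ) (x := y)
      (K := D * |y - ℓ|) fun z hz => (s1 z (hsub y hy hz)).trans (by
        have := abs_sub_left_le_of_mem_uIcc hz
        gcongr)
    simp only [hgℓ, zero_mul, sub_self, sub_zero] at this
    rwa [mul_assoc, ← sq] at this
  have s3 : |g x ^ 2 - (x - ℓ) ^ 2| ≤ 2 * D * |x - ℓ| ^ 3 := by
    have := abs_sub_le_of_hasDerivAt (F := fun y => g y ^ 2 - (y - ℓ) ^ 2)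
      (F' := fun y => 2 * (g y * deriv g y - (y - ℓ)))
      (fun z => (((hdg z).pow 2).sub (((hasDerivAt_id z).sub_const ℓ).pow 2)).congr_deriv
        (by simp; ring)) (a := ℓ) (x := x)
      (K := 2 * (D * |x - ℓ| ^ 2)) fun z hz => by
        rw [abs_mul, abs_two]
        have h1 := s2 z hz
        have h2 := abs_sub_left_le_of_mem_uIcc hz
        have h3 : D * |z - ℓ| ^ 2 ≤ D * |x - ℓ| ^ 2 := by gcongr
        linarith
    simp only [hgℓ, sub_self, ne_eq, OfNat.ofNat_ne_zero, not_false_eq_true, zero_pow,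
      sub_zero] at this
    linarith
  refine ⟨(s2 x right_mem_uIcc).trans ?_, s3⟩
  rw [sq_abs]
  have : 0 ≤ D := le_trans zero_le_one (le_max_right C 1)
  nlinarith [sq_nonneg (x - ℓ), mul_nonneg this (sq_nonneg (x - ℓ))]

namespace QuadBound

variable {g : ℝ → ℝ} {ℓ C δ : ℝ}

lemma sq_le (h : QuadBound g ℓ C) (hδ1 : δ ≤ 1) (hCδ : C * δ ≤ 1 / 8) (hC : 0 ≤ C) {x : ℝ}
    (hx : |x - ℓ| ≤ δ) : 3 / 4 * (x - ℓ) ^ 2 ≤ g x ^ 2 := by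
  have h1 := (abs_le.1 (h x (hx.trans hδ1)).2).1
  have h2 : C * |x - ℓ| ^ 3 ≤ 1 / 8 * (x - ℓ) ^ 2 := by
    rw [← sq_abs (x - ℓ)]
    have : C * |x - ℓ| ≤ 1 / 8 := (mul_le_mul_of_nonneg_left hx hC).trans hCδ
    nlinarith [sq_nonneg |x - ℓ|, mul_le_mul_of_nonneg_right this (sq_nonneg |x - ℓ|)]
  nlinarith [sq_nonneg (x - ℓ)]

lemma mul_nonneg (h : QuadBound g ℓ C) (hδ1 : δ ≤ 1) (hCδ : C * δ ≤ 1 / 8) (hC : 0 ≤ C) {x : ℝ}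
    (hx : |x - ℓ| ≤ δ) : 0 ≤ (x - ℓ) * (g x * deriv g x) := by
  have h1 := (h x (hx.trans hδ1)).1
  have h3 : |(x - ℓ) * (g x * deriv g x - (x - ℓ))| ≤ 1 / 8 * (x - ℓ) ^ 2 := by
    have : C * |x - ℓ| ≤ 1 / 8 := (mul_le_mul_of_nonneg_left hx hC).trans hCδ
    rw [abs_mul]
    calc |x - ℓ| * |g x * deriv g x - (x - ℓ)| ≤ |x - ℓ| * (C * (x - ℓ) ^ 2) := by gcongr
      _ = C * |x - ℓ| * (x - ℓ) ^ 2 := by ring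
      _ ≤ 1 / 8 * (x - ℓ) ^ 2 := by gcongr
  have h4 := (abs_le.1 h3).1
  nlinarith [sq_nonneg (x - ℓ)]

lemma eq_of_zero (h : QuadBound g ℓ C) (hδ1 : δ ≤ 1) (hCδ : C * δ ≤ 1 / 8) (hC : 0 ≤ C) {x : ℝ}
    (hx : |x - ℓ| ≤ δ) (hgx : g x = 0) : x = ℓ := by
  have h1 := h.sq_le hδ1 hCδ hC hx
  rw [hgx] at h1
  have : (x - ℓ) ^ 2 = 0 := le_antisymm (by linarith) (sq_nonneg _)
  linarith [pow_eq_zero_iff (two_ne_zero) |>.1 this]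

end QuadBound

section Gfun

variable {g : ℝ → ℝ}

lemma hasDerivAt_Gfun (hg : Continuous g) (x : ℝ) : HasDerivAt (Gfun g) |g x| x :=
  ((continuous_abs.comp hg).integral_hasStrictDerivAt 0 x).hasDerivAt

lemma continuous_Gfun (hg : Continuous g) : Continuous (Gfun g) :=
  continuous_iff_continuousAt.2 fun x => (hasDerivAt_Gfun hg x).continuousAt

lemma strictMono_Gfun (hg : Continuous g) (hA2 : A2 g) : StrictMono (Gfun g) := by
  intro a b hab
  have hi : ∀ c d, IntervalIntegrable (fun y => |g y|) volume c d := fun c d =>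
    (continuous_abs.comp hg).intervalIntegrable _ _
  have h1 : Gfun g b - Gfun g a = ∫ y in a..b, |g y| :=
    intervalIntegral.integral_interval_sub_left (hi _ _) (hi _ _)
  rw [← sub_pos, h1]
  refine intervalIntegral.integral_pos hab (continuous_abs.comp hg).continuousOn
    (fun _ _ => abs_nonneg _) ?_
  by_contra! hcon
  have hz : ∀ c ∈ Icc a b, g c = 0 := fun c hc => abs_nonpos_iff.1 (hcon c hc)
  obtain ⟨ε, hε, h⟩ := hA2 a (hz a ⟨le_rfl, hab.le⟩)
  have hm : a + min (ε / 2) (b - a) ∈ Icc a b := by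
    constructor
    · have : 0 < min (ε / 2) (b - a) := lt_min (by positivity) (by linarith)
      linarith
    · linarith [min_le_right (ε / 2) (b - a)]
  have h3 : 0 < min (ε / 2) (b - a) := lt_min (by positivity) (by linarith)
  have := h _ (hz _ hm) (by
    rw [add_sub_cancel_left, abs_of_pos h3]; linarith [min_le_left (ε / 2) (b - a)])
  linarith

lemma surjective_Gfun (hg : Continuous g) (hA1 : A1 g) : Function.Surjective (Gfun g) :=
  (continuous_Gfun hg).surjective hA1.1 hA1.2

lemma exists_abs_le_of_abs_Gfun_le (hA1 : A1 g) (K : ℝ) : ∃ M, ∀ y, |Gfun g y| ≤ K → |y| ≤ M := by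
  obtain ⟨a, ha⟩ := eventually_atTop.1 (hA1.1.eventually_gt_atTop K)
  obtain ⟨b, hb⟩ := eventually_atBot.1 (hA1.2.eventually_lt_atBot (-K))
  refine ⟨max a (-b), fun y hy => ?_⟩
  have h1 : y ≤ a := by
    by_contra! h
    linarith [ha y h.le, (abs_le.1 hy).2]
  have h2 : b ≤ y := by
    by_contra! h
    linarith [hb y h.le, (abs_le.1 hy).1]
  rw [abs_le]
  exact ⟨by linarith [le_max_right a (-b)], h1.trans (le_max_left _ _)⟩

lemma abs_Gfun_sub_le (hg : Continuous g) {U U' : ℝ → ℝ} (hU : ∀ x, HasDerivAt U (U' x) x)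
    (hU' : Continuous U') {a b : ℝ} (hab : a ≤ b) :
    |Gfun g (U b) - Gfun g (U a)| ≤ ∫ x in a..b, (U' x ^ 2 + g (U x) ^ 2) := by
  have hUc : Continuous U := continuous_iff_continuousAt.2 fun x => (hU x).continuousAt
  have h1 : ∫ x in a..b, |g (U x)| * U' x = Gfun g (U b) - Gfun g (U a) :=
    intervalIntegral.integral_eq_sub_of_hasDerivAt
      (fun x _ => (hasDerivAt_Gfun hg (U x)).comp x (hU x))
      (Continuous.intervalIntegrable (by fun_prop) _ _)
  rw [← h1]
  refine (intervalIntegral.abs_integral_le_integral_abs hab).trans ?_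
  refine integral_mono_of_continuous (by fun_prop) (by fun_prop) hab fun x _ => ?_
  rw [abs_mul, abs_abs, ← sq_abs (U' x), ← sq_abs (g (U x))]
  nlinarith [sq_nonneg (|U' x| - |g (U x)|), sq_nonneg (|U' x| + |g (U x)|)]

end Gfun

/-- The tail energy of a function of finite energy is small. -/
lemma exists_forall_integral_le {e : ℝ → ℝ} (he : Continuous e) (h0 : ∀ x, 0 ≤ e x) {B : ℝ}
    (hB : ∀ a b, a ≤ b → ∫ x in a..b, e x ≤ B) {η : ℝ} (hη : 0 < η) :
    ∃ A, ∀ a b, A ≤ a → a ≤ b → ∫ x in a..b, e x ≤ η := by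
  have hi : ∀ c d, IntervalIntegrable e volume c d := fun c d => he.intervalIntegrable _ _
  have hmono : Monotone fun x => ∫ s in (0:ℝ)..x, e s := by
    intro a b hab
    have : (∫ s in (0:ℝ)..b, e s) - ∫ s in (0:ℝ)..a, e s = ∫ x in a..b, e x :=
      intervalIntegral.integral_interval_sub_left (hi _ _) (hi _ _)
    have h1 : 0 ≤ ∫ x in a..b, e x := integral_nonneg_of_continuous hab fun x _ => h0 x
    simp only
    linarith
  have hbdd : BddAbove (range fun x => ∫ s in (0:ℝ)..x, e s) := by
    refine ⟨B, ?_⟩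
    rintro _ ⟨x, rfl⟩
    refine (hmono (le_max_right 0 x)).trans (hB _ _ (le_max_left 0 x))
  have hlim := tendsto_atTop_ciSup hmono hbdd
  obtain ⟨A, hA⟩ := eventually_atTop.1 (hlim.eventually (lt_mem_nhds (sub_lt_self _ hη)))
  refine ⟨A, fun a b ha hab => ?_⟩
  have h1 := hA a ha
  have h2 := le_ciSup hbdd b
  have h3 : (∫ s in (0:ℝ)..b, e s) - ∫ s in (0:ℝ)..a, e s = ∫ x in a..b, e x :=
      intervalIntegral.integral_interval_sub_left (hi _ _) (hi _ _)
  linarith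

lemma exists_tendsto_of_energy_le {g : ℝ → ℝ} (hg : Continuous g) (hA1 : A1 g) (hA2 : A2 g)
    {U U' : ℝ → ℝ} (hU : ∀ x, HasDerivAt U (U' x) x) (hU' : Continuous U') {B : ℝ}
    (hB : ∀ a b, a ≤ b → ∫ x in a..b, (U' x ^ 2 + g (U x) ^ 2) ≤ B) :
    ∃ ℓ, g ℓ = 0 ∧ Tendsto U atTop (𝓝 ℓ) := by
  have hUc : Continuous U := continuous_iff_continuousAt.2 fun x => (hU x).continuousAt
  have htail := @exists_forall_integral_le (fun x => U' x ^ 2 + g (U x) ^ 2) (by fun_prop)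
    (fun x => by positivity) B hB
  have hcau : CauchySeq fun x => Gfun g (U x) := by
    rw [Metric.cauchySeq_iff']
    intro η hη
    obtain ⟨A, hA⟩ := htail (half_pos hη)
    refine ⟨A, fun x hx => ?_⟩
    rw [Real.dist_eq]
    linarith [abs_Gfun_sub_le hg hU hU' hx, hA A x le_rfl hx]
  obtain ⟨L, hL⟩ := cauchySeq_tendsto_of_complete hcau
  set Φ := ((strictMono_Gfun hg hA2).orderIsoOfSurjective _ (surjective_Gfun hg hA1)).toHomeomorph
    with hΦ
  have hlim : Tendsto U atTop (𝓝 (Φ.symm L)) := by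
    have := (Φ.symm.continuous.tendsto L).comp hL
    refine this.congr fun x => ?_
    exact Φ.symm_apply_apply (U x)
  refine ⟨_, ?_, hlim⟩
  by_contra hne
  have hc : 0 < g (Φ.symm L) ^ 2 := by positivity
  have hglim : Tendsto (fun x => g (U x) ^ 2) atTop (𝓝 (g (Φ.symm L) ^ 2)) :=
    ((hg.tendsto _).comp hlim).pow 2
  obtain ⟨A, hA⟩ := eventually_atTop.1 (hglim.eventually (lt_mem_nhds (half_lt_self hc)))
  set c := g (Φ.symm L) ^ 2 / 2
  have hc' : 0 < c := half_pos hc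
  have hB0 : 0 ≤ B := (integral_nonneg_of_continuous le_rfl fun x _ => by positivity).trans
    (hB 0 0 le_rfl)
  have h1 : ∫ _ in A..(A + (B + 1) / c), c ≤ ∫ x in A..(A + (B + 1) / c),
      (U' x ^ 2 + g (U x) ^ 2) := by
    refine integral_mono_of_continuous (by fun_prop) (by fun_prop)
      (le_add_of_nonneg_right (by positivity)) fun x hx => ?_
    have := hA x hx.1
    nlinarith [sq_nonneg (U' x)]
  have h2 := hB A (A + (B + 1) / c) (le_add_of_nonneg_right (by positivity))
  rw [intervalIntegral.integral_const, add_sub_cancel_left, smul_eq_mul,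
    div_mul_cancel₀ _ hc'.ne'] at h1
  linarith

namespace IsProfile

variable {g v p : ℝ → ℝ} {B : ℝ}

lemma reflect (h : IsProfile g v p B) : IsProfile g (fun x => v (-x)) (fun x => -p (-x)) B where
  hv x := by
    have := (h.hv (-x)).comp x (hasDerivAt_neg x)
    exact this.congr_deriv (by ring)
  hp x := by
    have := ((h.hp (-x)).comp x (hasDerivAt_neg x)).neg
    exact this.congr_deriv (by ring)
  energy a b hab := by
    have := intervalIntegral.integral_comp_neg (fun x => p x ^ 2 + g (v x) ^ 2) (a := a) (b := b)
    simp only [neg_sq]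
    rw [this]
    exact h.energy _ _ (by linarith)

lemma exists_tendsto_atTop (h : IsProfile g v p B) (hg : Continuous g) (hA1 : A1 g) (hA2 : A2 g) :
    ∃ ℓ, g ℓ = 0 ∧ Tendsto v atTop (𝓝 ℓ) :=
  exists_tendsto_of_energy_le hg hA1 hA2 h.hv h.continuous_deriv h.energy

lemma exists_tendsto_atBot (h : IsProfile g v p B) (hg : Continuous g) (hA1 : A1 g) (hA2 : A2 g) :
    ∃ ℓ, g ℓ = 0 ∧ Tendsto v atBot (𝓝 ℓ) := by
  obtain ⟨ℓ, h1, h2⟩ := h.reflect.exists_tendsto_atTop hg hA1 hA2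
  refine ⟨ℓ, h1, ?_⟩
  exact (h2.comp tendsto_neg_atBot_atTop).congr fun x => by simp

/-- Smallness of the tails of a profile in the energy space. -/
lemma exists_tail_le (h : IsProfile g v p B) (hg : Continuous g) {ℓ C : ℝ} (hC : QuadBound g ℓ C)
    (hC1 : 1 ≤ C) (hlim : Tendsto v atTop (𝓝 ℓ)) {η : ℝ} (hη : 0 < η) :
    ∃ A, ∀ a b, A ≤ a → a ≤ b → ∫ x in a..b, (p x ^ 2 + (v x - ℓ) ^ 2) ≤ η := by
  have hvc := h.continuous
  have hpc := h.continuous_deriv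
  obtain ⟨A, hA⟩ := exists_forall_integral_le (e := fun x => p x ^ 2 + g (v x) ^ 2) (by fun_prop)
    (fun x => by positivity) h.energy (half_pos hη)
  have hlim' : Tendsto (fun x => |v x - ℓ|) atTop (𝓝 0) := by
    simpa using (hlim.sub_const ℓ).abs
  obtain ⟨A', hA'⟩ := eventually_atTop.1 (hlim'.eventually_le_const
    (by positivity : 0 < 1 / (8 * C)))
  refine ⟨max A A', fun a b ha hab => ?_⟩
  have h1 := hA a b ((le_max_left _ _).trans ha) hab
  have h2 := integral_le_add_of_continuous (a := a) (b := b)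
    (f := fun x => p x ^ 2 + (v x - ℓ) ^ 2) (h := fun x => p x ^ 2 + g (v x) ^ 2) (k := fun _ => 0)
    (by fun_prop) (by fun_prop) (by fun_prop) 2 0 hab fun x hx => by
      have := hC.sq_le (δ := 1 / (8 * C)) (by rw [div_le_one (by positivity)]; linarith)
        (by apply le_of_eq; field_simp) (by linarith)
        (hA' x (((le_max_right _ _).trans ha).trans hx.1))
      nlinarith [sq_nonneg (p x), sq_nonneg (g (v x))]
  linarith

/-- A profile staying close to a zero of `g` is constant. -/
lemma eq_const (h : IsProfile g v p B) (hg : Continuous g) (hA1 : A1 g) (hA2 : A2 g) {ℓ C δ : ℝ}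
    (hC : QuadBound g ℓ C) (hC1 : 0 ≤ C) (hδ1 : δ ≤ 1) (hCδ : C * δ ≤ 1 / 8)
    (hδ : ∀ x, |v x - ℓ| ≤ δ) (x : ℝ) : v x = ℓ := by
  have key : ∀ ℓ', g ℓ' = 0 → ∀ l : Filter ℝ, l.NeBot → Tendsto v l (𝓝 ℓ') → ℓ' = ℓ := by
    intro ℓ' h0 l _ hl
    refine hC.eq_of_zero hδ1 hCδ hC1 ?_ h0
    exact le_of_tendsto (hl.sub_const ℓ).abs (Eventually.of_forall hδ)
  obtain ⟨ℓ₁, h1, h1'⟩ := h.exists_tendsto_atTop hg hA1 hA2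
  obtain ⟨ℓ₂, h2, h2'⟩ := h.exists_tendsto_atBot hg hA1 hA2
  rw [key ℓ₁ h1 _ inferInstance h1'] at h1'
  rw [key ℓ₂ h2 _ inferInstance h2'] at h2'
  have hd1 : ∀ y, HasDerivAt (fun y => (v y - ℓ) ^ 2) (2 * (v y - ℓ) * p y) y := fun y =>
    (((h.hv y).sub_const ℓ).pow 2).congr_deriv (by simp)
  have hd1' : deriv (fun y => (v y - ℓ) ^ 2) = fun y => 2 * (v y - ℓ) * p y :=
    funext fun y => (hd1 y).deriv
  have hd2 : ∀ y, HasDerivAt (fun y => 2 * (v y - ℓ) * p y)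
      (2 * p y * p y + 2 * (v y - ℓ) * (g (v y) * deriv g (v y))) y := fun y =>
    ((((h.hv y).sub_const ℓ).const_mul 2).mul (h.hp y)).congr_deriv (by simp)
  have hconv : ConvexOn ℝ univ fun y => (v y - ℓ) ^ 2 := by
    refine convexOn_univ_of_deriv2_nonneg (fun y => (hd1 y).differentiableAt) ?_ fun y => ?_
    · rw [hd1']; exact fun y => (hd2 y).differentiableAt
    · simp only [Function.iterate_succ, Function.iterate_zero, Function.comp, id]
      rw [hd1', (hd2 y).deriv]
      nlinarith [mul_self_nonneg (p y), hC.mul_nonneg hδ1 hCδ hC1 (hδ y)]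
  have hs1 : Tendsto (fun y => (v y - ℓ) ^ 2) atTop (𝓝 0) := by
    simpa using (h1'.sub_const ℓ).pow 2
  have hs2 : Tendsto (fun y => (v y - ℓ) ^ 2) atBot (𝓝 0) := by
    simpa using (h2'.sub_const ℓ).pow 2
  have hz : (v x - ℓ) ^ 2 ≤ 0 := by
    refine le_of_forall_pos_le_add fun η hη => ?_
    obtain ⟨b, hb, hxb⟩ := ((hs1.eventually_le_const hη).and (eventually_ge_atTop x)).exists
    obtain ⟨a, ha, hxa⟩ := ((hs2.eventually_le_const hη).and (eventually_le_atBot x)).exists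
    have := hconv.le_max_of_mem_Icc (mem_univ a) (mem_univ b) ⟨hxa, hxb⟩
    rw [zero_add]
    exact this.trans (max_le ha hb)
  linarith [pow_eq_zero_iff (two_ne_zero) |>.1 (le_antisymm hz (sq_nonneg (v x - ℓ)))]

end IsProfile

/-- The energy norm of `f` on `[a, b]` in logarithmic coordinates, `f'` being the derivative
of `f`. -/
noncomputable def logEnergy (f f' : ℝ → ℝ) (a b : ℝ) : ℝ := ∫ x in a..b, (f' x ^ 2 + f x ^ 2)

section logEnergy

variable {f f' h h' : ℝ → ℝ} {a b c : ℝ}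

lemma logEnergy_nonneg (hab : a ≤ b) : 0 ≤ logEnergy f f' a b :=
  integral_nonneg_of_continuous hab fun x _ => by positivity

lemma logEnergy_add_adjacent (hf : Continuous f) (hf' : Continuous f') :
    logEnergy f f' a b + logEnergy f f' b c = logEnergy f f' a c :=
  intervalIntegral.integral_add_adjacent_intervals
    (Continuous.intervalIntegrable (by fun_prop) _ _)
    (Continuous.intervalIntegrable (by fun_prop) _ _)

lemma logEnergy_mono (hf : Continuous f) (hf' : Continuous f') {a' b' : ℝ} (ha : a' ≤ a)
    (hb : b ≤ b') : logEnergy f f' a b ≤ logEnergy f f' a' b' := by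
  have h1 := logEnergy_add_adjacent (a := a') (b := a) (c := b') hf hf'
  have h2 := logEnergy_add_adjacent (a := a) (b := b) (c := b') hf hf'
  linarith [logEnergy_nonneg (f := f) (f' := f') ha, logEnergy_nonneg (f := f) (f' := f') hb]

lemma logEnergy_sub_le (hf : Continuous f) (hf' : Continuous f') (hh : Continuous h)
    (hh' : Continuous h') (hab : a ≤ b) :
    logEnergy (fun x => f x - h x) (fun x => f' x - h' x) a b ≤
      2 * logEnergy f f' a b + 2 * logEnergy h h' a b := by
  refine integral_le_add_of_continuous (by fun_prop) (by fun_prop) (by fun_prop) 2 2 hab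
    fun x _ => ?_
  linarith [sq_nonneg (f x + h x), sq_nonneg (f' x + h' x)]

lemma logEnergy_add_le (hf : Continuous f) (hf' : Continuous f') (hh : Continuous h)
    (hh' : Continuous h') (hab : a ≤ b) :
    logEnergy (fun x => f x + h x) (fun x => f' x + h' x) a b ≤
      2 * logEnergy f f' a b + 2 * logEnergy h h' a b := by
  refine integral_le_add_of_continuous (by fun_prop) (by fun_prop) (by fun_prop) 2 2 hab
    fun x _ => ?_
  linarith [sq_nonneg (f x - h x), sq_nonneg (f' x - h' x)]

lemma logEnergy_comp_sub (y : ℝ) :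
    logEnergy (fun x => f (x - y)) (fun x => f' (x - y)) a b =
      logEnergy f f' (a - y) (b - y) :=
  intervalIntegral.integral_comp_sub_right (fun x => f' x ^ 2 + f x ^ 2) y

lemma logEnergy_reflect :
    logEnergy (fun x => f (-x)) (fun x => -f' (-x)) a b = logEnergy f f' (-b) (-a) := by
  simp only [logEnergy, neg_sq]
  exact intervalIntegral.integral_comp_neg (fun x => f' x ^ 2 + f x ^ 2)

end logEnergy

/-- Diagonal extraction along a filter on `ℕ`. -/
lemma exists_tendsto_atTop_eventually {l : Filter ℕ} (hl : l ≤ atTop) {P : ℕ → ℕ → Prop}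
    (h : ∀ k, ∀ᶠ n in l, P k n) :
    ∃ K : ℕ → ℕ, Tendsto K l atTop ∧ ∀ᶠ n in l, P (K n) n := by
  classical
  refine ⟨fun n => Nat.findGreatest (fun k => ∀ j ≤ k, P j n) n, ?_, ?_⟩
  · rw [tendsto_atTop]
    intro k
    have h1 : ∀ᶠ n in l, ∀ j ∈ Finset.range (k + 1), P j n :=
      (Finset.eventually_all _).2 fun j _ => h j
    filter_upwards [h1, hl (eventually_ge_atTop k)] with n hn hk
    exact Nat.le_findGreatest hk fun j hj => hn j (Finset.mem_range.2 (by omega))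
  · filter_upwards [h 0] with n hn
    have := Nat.findGreatest_spec (P := fun k => ∀ j ≤ k, P j n) (Nat.zero_le n)
      (fun j hj => by rwa [Nat.le_zero.1 hj])
    exact this _ le_rfl

/-- The last point before `b` where a continuous function takes the value `δ`. -/
lemma exists_last_eq {f : ℝ → ℝ} (hf : Continuous f) {b δ : ℝ} (hb : f b < δ)
    (h : ∃ x ≤ b, δ ≤ f x) : ∃ x < b, f x = δ ∧ ∀ y ∈ Icc x b, f y ≤ δ := by
  obtain ⟨x₀, hx₀, hδ⟩ := h
  have hK : IsCompact (Icc x₀ b ∩ {x | δ ≤ f x}) :=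
    isCompact_Icc.inter_right (isClosed_le continuous_const hf)
  obtain ⟨x, ⟨hx, hxδ⟩, hmax⟩ := hK.exists_isGreatest ⟨x₀, ⟨le_rfl, hx₀⟩, hδ⟩
  have hxδ' : δ ≤ f x := hxδ
  have hlt : x < b := lt_of_le_of_ne hx.2 fun h => by rw [h] at hxδ'; linarith
  have heq : f x = δ := by
    obtain ⟨y, hy, hfy⟩ := intermediate_value_Icc' hx.2 hf.continuousOn ⟨hb.le, hxδ'⟩
    have := hmax ⟨⟨hx.1.trans hy.1, hy.2⟩, hfy.ge⟩
    rwa [le_antisymm this hy.1] at hfy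
  refine ⟨x, hlt, heq, fun y hy => ?_⟩
  by_contra! hlt'
  have := hmax ⟨⟨hx.1.trans hy.1, hy.2⟩, hlt'.le⟩
  rw [le_antisymm this hy.1, heq] at hlt'
  exact lt_irrefl _ hlt'

/-- A transition of amplitude `δ` close to a zero of `g` costs a fixed amount of energy. -/
lemma energy_gap {g U U' : ℝ → ℝ} (hg : Continuous g) (hU : ∀ x, HasDerivAt U (U' x) x)
    (hU' : Continuous U') {ℓ C δ a b : ℝ} (hC : QuadBound g ℓ C) (hC0 : 0 ≤ C) (hδ1 : δ ≤ 1)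
    (hCδ : C * δ ≤ 1 / 8) (hab : a ≤ b) (ha : |U a - ℓ| = δ) (hb : |U b - ℓ| ≤ δ / 2)
    (h : ∀ x ∈ Icc a b, |U x - ℓ| ≤ δ) :
    δ ^ 2 / 2 ≤ ∫ x in a..b, (U' x ^ 2 + g (U x) ^ 2) := by
  have hUc : Continuous U := continuous_iff_continuousAt.2 fun x => (hU x).continuousAt
  have hd : ∀ x ∈ uIcc a b, HasDerivAt (fun y => (U y - ℓ) ^ 2) (2 * (U x - ℓ) * U' x) x :=
    fun x _ => (((hU x).sub_const ℓ).pow 2).congr_deriv (by simp)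
  have h1 := intervalIntegral.integral_eq_sub_of_hasDerivAt hd
    (Continuous.intervalIntegrable (by fun_prop) _ _)
  have h2 := integral_le_add_of_continuous (a := a) (b := b)
    (f := fun x => -(2 * (U x - ℓ) * U' x)) (h := fun x => U' x ^ 2 + g (U x) ^ 2)
    (k := fun _ => 0) (by fun_prop) (by fun_prop) (by fun_prop) (4 / 3) 0 hab fun x hx => by
      have := hC.sq_le hδ1 hCδ hC0 (h x hx)
      nlinarith [sq_nonneg (U' x), sq_nonneg ((U x - ℓ) + U' x)]
  rw [intervalIntegral.integral_neg, h1] at h2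
  have h3 : (U a - ℓ) ^ 2 = δ ^ 2 := by rw [← ha, sq_abs]
  have h4 : (U b - ℓ) ^ 2 ≤ (δ / 2) ^ 2 := by
    rw [← sq_abs (U b - ℓ)]; exact pow_le_pow_left₀ (abs_nonneg _) hb 2
  nlinarith [sq_nonneg δ]

/-- A sequence of maps in logarithmic coordinates for which profiles can be extracted at scales
tending to `0`, and which has no energy in necks. -/
structure BubblingSeq (g : ℝ → ℝ) (E M : ℝ) (l : Filter ℕ) (U U' : ℕ → ℝ → ℝ) : Prop where
  hU : ∀ n x, HasDerivAt (U n) (U' n x) x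
  hU' : ∀ n, Continuous (U' n)
  bdd : ∀ n x, |U n x| ≤ M
  energy : ∀ n a b, a ≤ b → ∫ x in a..b, (U' n x ^ 2 + g (U n x) ^ 2) ≤ E
  profile : ∀ y : ℕ → ℝ, Tendsto y l atBot → ∃ v p B, IsProfile g v p B ∧
    ∀ A, ∀ η > 0, ∀ᶠ n in l, (∀ x ∈ Icc (-A) A, |U n (y n + x) - v x| ≤ η) ∧
      ∫ x in (-A)..A, (U' n (y n + x) - p x) ^ 2 ≤ η
  neck : ∃ c, ∀ ℓ, g ℓ = 0 → |ℓ| ≤ M → ∀ η > 0, ∃ s > 0, ∀ᶠ n in l, ∀ a b, a ≤ b → b ≤ c →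
    (∀ x ∈ Icc (a - 3) (b + 3), |U n x - ℓ| ≤ s) →
    ∫ x in a..b, (U' n x ^ 2 + (U n x - ℓ) ^ 2) ≤ η

/-- A concentrating profile, in logarithmic coordinates. -/
structure Bubble (g : ℝ → ℝ) where
  x : ℕ → ℝ
  v : ℝ → ℝ
  p : ℝ → ℝ
  B : ℝ
  l0 : ℝ
  l1 : ℝ
  prof : IsProfile g v p B
  zero0 : g l0 = 0
  zero1 : g l1 = 0
  lim0 : Tendsto v atBot (𝓝 l0)
  lim1 : Tendsto v atTop (𝓝 l1)

/-- A chain of matching profiles at well separated scales. -/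
def BubbleChain {g : ℝ → ℝ} (l : Filter ℕ) : (ℕ → ℝ) → ℝ → List (Bubble g) → Prop
  | _, _, [] => True
  | b, ℓ, β :: L => Tendsto (fun n => b n - β.x n) l atTop ∧ β.l1 = ℓ ∧ BubbleChain l β.x β.l0 L

/-- The sum of the profiles of a chain. -/
noncomputable def bubbleSum {g : ℝ → ℝ} (L : List (Bubble g)) (n : ℕ) (x : ℝ) : ℝ :=
  (L.map fun β => β.v (x - β.x n) - β.l1).sum

/-- The derivative of the sum of the profiles of a chain. -/
noncomputable def bubbleSum' {g : ℝ → ℝ} (L : List (Bubble g)) (n : ℕ) (x : ℝ) : ℝ :=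
  (L.map fun β => β.p (x - β.x n)).sum

section Bubble

variable {g : ℝ → ℝ}

lemma bubbleSum_cons (β : Bubble g) (L : List (Bubble g)) (n : ℕ) (x : ℝ) :
    bubbleSum (β :: L) n x = β.v (x - β.x n) - β.l1 + bubbleSum L n x := by
  simp [bubbleSum]

lemma bubbleSum'_cons (β : Bubble g) (L : List (Bubble g)) (n : ℕ) (x : ℝ) :
    bubbleSum' (β :: L) n x = β.p (x - β.x n) + bubbleSum' L n x := by
  simp [bubbleSum']

lemma hasDerivAt_bubbleSum (L : List (Bubble g)) (n : ℕ) (x : ℝ) :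
    HasDerivAt (bubbleSum L n) (bubbleSum' L n x) x := by
  induction L with
  | nil => exact hasDerivAt_const x (0 : ℝ)
  | cons β L ih =>
    rw [bubbleSum'_cons]
    refine HasDerivAt.congr_of_eventuallyEq ?_ (Eventually.of_forall (bubbleSum_cons β L n))
    refine HasDerivAt.add (HasDerivAt.sub_const _ ?_) ih
    exact ((β.prof.hv (x - β.x n)).comp x ((hasDerivAt_id x).sub_const _)).congr_deriv (by simp)

lemma continuous_bubbleSum (L : List (Bubble g)) (n : ℕ) : Continuous (bubbleSum L n) :=
  continuous_iff_continuousAt.2 fun x => (hasDerivAt_bubbleSum L n x).continuousAt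

lemma continuous_bubbleSum' (L : List (Bubble g)) (n : ℕ) : Continuous (bubbleSum' L n) := by
  induction L with
  | nil => exact continuous_const (y := (0 : ℝ))
  | cons β L ih =>
    have := β.prof.continuous_deriv
    rw [funext (bubbleSum'_cons β L n)]
    fun_prop

lemma BubbleChain.mono {l : Filter ℕ} {b b' : ℕ → ℝ} {ℓ : ℝ} {L : List (Bubble g)}
    (h : BubbleChain l b ℓ L) (hb : ∀ᶠ n in l, b n ≤ b' n) : BubbleChain l b' ℓ L := by
  cases L with
  | nil => trivial
  | cons β L =>
    refine ⟨tendsto_atTop_mono' l ?_ h.1, h.2⟩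
    filter_upwards [hb] with n hn
    linarith

lemma BubbleChain.of_le {l l' : Filter ℕ} (hl : l' ≤ l) {b : ℕ → ℝ} {ℓ : ℝ}
    {L : List (Bubble g)} (h : BubbleChain l b ℓ L) : BubbleChain l' b ℓ L := by
  induction L generalizing b ℓ with
  | nil => trivial
  | cons β L ih => exact ⟨h.1.mono_left hl, h.2.1, ih h.2.2⟩

/-- A chain along some filter is a chain along a coarser, countably generated one. -/
lemma BubbleChain.exists_isCountablyGenerated {l : Filter ℕ} {b : ℕ → ℝ} {ℓ : ℝ}
    {L : List (Bubble g)} (h : BubbleChain l b ℓ L) :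
    ∃ l' : Filter ℕ, l ≤ l' ∧ l'.IsCountablyGenerated ∧ BubbleChain l' b ℓ L := by
  induction L generalizing b ℓ with
  | nil => exact ⟨⊤, le_top, inferInstance, trivial⟩
  | cons β L ih =>
    obtain ⟨l', h1, h2, h3⟩ := ih h.2.2
    refine ⟨l' ⊓ comap (fun n => b n - β.x n) atTop, le_inf h1 h.1.le_comap, inferInstance, ?_⟩
    exact ⟨tendsto_comap.mono_left inf_le_right, h.2.1, h3.of_le inf_le_left⟩

lemma BubbleChain.tendsto_sub {l : Filter ℕ} {b : ℕ → ℝ} {ℓ : ℝ} {L : List (Bubble g)}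
    (h : BubbleChain l b ℓ L) (j : ℕ) (hj : j + 1 < L.length) :
    Tendsto (fun n => L[j].x n - L[j + 1].x n) l atTop ∧ L[j + 1].l1 = L[j].l0 := by
  induction L generalizing b ℓ j with
  | nil => simp at hj
  | cons β L ih =>
    cases j with
    | zero =>
      cases L with
      | nil => simp at hj
      | cons β' L => exact ⟨h.2.2.1, h.2.2.2.1⟩
    | succ j => exact ih h.2.2 j (by simpa using hj)

end Bubble

namespace BubblingSeq

variable {g : ℝ → ℝ} {E M C δ ℓ : ℝ} {𝒰 : Ultrafilter ℕ} {U U' : ℕ → ℝ → ℝ} {b : ℕ → ℝ}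

lemma continuous (hS : BubblingSeq g E M 𝒰 U U') (n : ℕ) : Continuous (U n) :=
  continuous_iff_continuousAt.2 fun x => (hS.hU n x).continuousAt

/-- A sequence of points to the left of which the maps stay close to `ℓ` takes values
tending to `ℓ`. -/
lemma eventually_abs_sub_le (hS : BubblingSeq g E M 𝒰 U U') (hg : Continuous g) (hA1 : A1 g)
    (hA2 : A2 g) (hC : QuadBound g ℓ C) (hC0 : 0 ≤ C) (hδ : 0 < δ) (hδ1 : δ ≤ 1)
    (hCδ : C * δ ≤ 1 / 8) (hb : Tendsto b 𝒰 atBot)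
    (hconv : ∀ A, ∀ η > 0, ∀ᶠ n in (𝒰 : Filter ℕ), ∀ x ∈ Icc (-A) A, |U n (b n + x) - ℓ| ≤ η)
    {y : ℕ → ℝ} (hyb : ∀ᶠ n in (𝒰 : Filter ℕ), y n ≤ b n)
    (hy : ∀ A, ∀ᶠ n in (𝒰 : Filter ℕ), ∀ x ∈ Icc (y n - A) (b n), |U n x - ℓ| ≤ δ)
    {s : ℝ} (hs : 0 < s) : ∀ᶠ n in (𝒰 : Filter ℕ), |U n (y n) - ℓ| ≤ s := by
  obtain ⟨v, p, B, hv, hlim⟩ := hS.profile y (tendsto_atBot_mono' _ hyb hb)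
  have hvδ : ∀ x, |v x - ℓ| ≤ δ := by
    intro x
    refine le_of_forall_pos_le_add fun η hη => ?_
    obtain ⟨n, h1, h2, h3, h4⟩ := ((hlim |x| η hη).and
      ((hconv |x| δ hδ).and ((hy |x|).and hyb))).exists
    have h5 := h1.1 x ⟨neg_abs_le x, le_abs_self x⟩
    have h6 : |U n (y n + x) - ℓ| ≤ δ := by
      rcases le_total (y n + x) (b n) with h | h
      · exact h3 _ ⟨by linarith [neg_abs_le x], h⟩
      · have := h2 (y n + x - b n) ⟨by linarith [abs_nonneg x], by linarith [le_abs_self x]⟩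
        rwa [add_sub_cancel] at this
    rw [abs_sub_comm] at h5
    have := abs_sub_le (v x) (U n (y n + x)) ℓ
    linarith
  have hv0 := hv.eq_const hg hA1 hA2 hC hC0 hδ1 hCδ hvδ 0
  filter_upwards [hlim 0 s hs] with n hn
  simpa [hv0] using hn.1 0 (by simp)

lemma exists_logEnergy_le_of_near (hS : BubblingSeq g E M 𝒰 U U') (hℓ : g ℓ = 0) (hℓM : |ℓ| ≤ M)
    (hb : Tendsto b 𝒰 atBot)
    (hconv : ∀ A, ∀ η > 0, ∀ᶠ n in (𝒰 : Filter ℕ), ∀ x ∈ Icc (-A) A, |U n (b n + x) - ℓ| ≤ η)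
    {η : ℝ} (hη : 0 < η) :
    ∃ s > 0, ∀ᶠ n in (𝒰 : Filter ℕ), ∀ a ≤ b n, (∀ x ∈ Icc (a - 3) (b n), |U n x - ℓ| ≤ s) →
      logEnergy (fun x => U n x - ℓ) (U' n) a (b n) ≤ η := by
  obtain ⟨c, hc⟩ := hS.neck
  obtain ⟨s, hs, h⟩ := hc ℓ hℓ hℓM η hη
  refine ⟨s, hs, ?_⟩
  filter_upwards [h, hconv 3 s hs, hb.eventually (eventually_le_atBot c)] with n h1 h2 h3 a ha h4
  refine h1 a (b n) ha h3 fun x hx => ?_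
  rcases le_total x (b n) with h | h
  · exact h4 x ⟨hx.1, h⟩
  · have := h2 (x - b n) ⟨by linarith, by linarith [hx.2]⟩
    rwa [add_sub_cancel] at this

/-- Absence of energy when the maps stay close to `ℓ`. -/
lemma eventually_logEnergy_le (hS : BubblingSeq g E M 𝒰 U U') (hg : Continuous g) (hA1 : A1 g)
    (hA2 : A2 g) (hC : QuadBound g ℓ C) (hC0 : 0 ≤ C) (hδ : 0 < δ) (hδ1 : δ ≤ 1)
    (hCδ : C * δ ≤ 1 / 8) (hℓ : g ℓ = 0) (hℓM : |ℓ| ≤ M) (hb : Tendsto b 𝒰 atBot)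
    (hconv : ∀ A, ∀ η > 0, ∀ᶠ n in (𝒰 : Filter ℕ), ∀ x ∈ Icc (-A) A, |U n (b n + x) - ℓ| ≤ η)
    (hnear : ∀ᶠ n in (𝒰 : Filter ℕ), ∀ x ≤ b n, |U n x - ℓ| ≤ δ) {η : ℝ} (hη : 0 < η) :
    ∀ᶠ n in (𝒰 : Filter ℕ), ∀ a ≤ b n, logEnergy (fun x => U n x - ℓ) (U' n) a (b n) ≤ η := by
  obtain ⟨s, hs, h⟩ := hS.exists_logEnergy_le_of_near hℓ hℓM hb hconv hη
  suffices hsup : ∀ᶠ n in (𝒰 : Filter ℕ), ∀ x ≤ b n, |U n x - ℓ| ≤ s by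
    filter_upwards [h, hsup] with n h1 h2 a ha
    exact h1 a ha fun x hx => h2 x hx.2
  by_contra hnot
  rw [← Ultrafilter.eventually_not] at hnot
  push Not at hnot
  obtain ⟨y, hy⟩ := hnot.choice
  have h1 := hS.eventually_abs_sub_le hg hA1 hA2 hC hC0 hδ hδ1 hCδ hb hconv
    (hy.mono fun n hn => hn.1) (fun A => hnear.mono fun n hn x hx => hn x hx.2) hs
  obtain ⟨n, h2, h3⟩ := (h1.and hy).exists
  exact absurd h3.2 (not_lt.2 h2)

/-- Absence of energy in the neck between two scales. -/
lemma exists_logEnergy_neck_le (hS : BubblingSeq g E M 𝒰 U U') (h𝒰 : (𝒰 : Filter ℕ) ≤ atTop)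
    (hg : Continuous g) (hA1 : A1 g)
    (hA2 : A2 g) (hC : QuadBound g ℓ C) (hC0 : 0 ≤ C) (hδ : 0 < δ) (hδ1 : δ ≤ 1)
    (hCδ : C * δ ≤ 1 / 8) (hℓ : g ℓ = 0) (hℓM : |ℓ| ≤ M) (hb : Tendsto b 𝒰 atBot)
    (hconv : ∀ A, ∀ η > 0, ∀ᶠ n in (𝒰 : Filter ℕ), ∀ x ∈ Icc (-A) A, |U n (b n + x) - ℓ| ≤ η)
    {x : ℕ → ℝ} (hnear : ∀ᶠ n in (𝒰 : Filter ℕ), ∀ y ∈ Icc (x n) (b n), |U n y - ℓ| ≤ δ)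
    {η : ℝ} (hη : 0 < η) :
    ∃ A, ∀ᶠ n in (𝒰 : Filter ℕ), ∀ a, x n + A ≤ a → a ≤ b n →
      logEnergy (fun x => U n x - ℓ) (U' n) a (b n) ≤ η := by
  obtain ⟨s, hs, h⟩ := hS.exists_logEnergy_le_of_near hℓ hℓM hb hconv hη
  suffices hsup : ∃ k : ℕ, ∀ᶠ n in (𝒰 : Filter ℕ), ∀ y, x n + k ≤ y → y ≤ b n →
      |U n y - ℓ| ≤ s by
    obtain ⟨k, hk⟩ := hsup
    refine ⟨k + 3, ?_⟩
    filter_upwards [h, hk] with n h1 h2 a ha hab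
    exact h1 a hab fun y hy => h2 y (by linarith [hy.1]) hy.2
  by_contra! hnot
  obtain ⟨K, hK, hKP⟩ := exists_tendsto_atTop_eventually h𝒰 hnot
  obtain ⟨y, hy⟩ := hKP.choice
  have hK' : Tendsto (fun n => (K n : ℝ)) 𝒰 atTop := tendsto_natCast_atTop_atTop.comp hK
  have h1 := hS.eventually_abs_sub_le hg hA1 hA2 hC hC0 hδ hδ1 hCδ hb hconv
    (hy.mono fun n hn => hn.2.1) (fun A => by
      filter_upwards [hy, hnear, hK'.eventually (eventually_ge_atTop A)] with n h1 h2 h3 z hz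
      exact h2 z ⟨by linarith [hz.1, h1.1], hz.2⟩) hs
  obtain ⟨n, h2, h3⟩ := (h1.and hy).exists
  exact absurd h3.2.2 (not_lt.2 h2)

end BubblingSeq

lemma Bubble.exists_forall_logEnergy_atTop_le {g : ℝ → ℝ} (β : Bubble g) (hg : Continuous g)
    {C : ℝ} (hC : QuadBound g β.l1 C) (hC1 : 1 ≤ C) {η : ℝ} (hη : 0 < η) :
    ∃ A, ∀ a b, A ≤ a → a ≤ b → logEnergy (fun x => β.v x - β.l1) β.p a b ≤ η :=
  β.prof.exists_tail_le hg hC hC1 β.lim1 hη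

lemma Bubble.exists_forall_logEnergy_atBot_le {g : ℝ → ℝ} (β : Bubble g) (hg : Continuous g)
    {C : ℝ} (hC : QuadBound g β.l0 C) (hC1 : 1 ≤ C) {η : ℝ} (hη : 0 < η) :
    ∃ A, ∀ a b, b ≤ -A → a ≤ b → logEnergy (fun x => β.v x - β.l0) β.p a b ≤ η := by
  obtain ⟨A, hA⟩ := β.prof.reflect.exists_tail_le hg hC hC1
    (β.lim0.comp tendsto_neg_atTop_atBot) hη
  refine ⟨A, fun a b hb hab => ?_⟩
  have h1 := hA (-b) (-a) (by linarith) (by linarith)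
  have h2 := logEnergy_reflect (f := fun x => β.v x - β.l0) (f' := β.p) (a := -b) (b := -a)
  rw [neg_neg, neg_neg] at h2
  rw [← h2]
  exact h1

namespace BubblingSeq

variable {g : ℝ → ℝ} {E M C δ ℓ : ℝ} {𝒰 : Ultrafilter ℕ} {U U' : ℕ → ℝ → ℝ} {b : ℕ → ℝ}

/-- Extraction of the outermost profile. -/
lemma exists_bubble (hS : BubblingSeq g E M 𝒰 U U') (hg : Continuous g) (hA1 : A1 g)
    (hA2 : A2 g) (hC : QuadBound g ℓ C) (hC0 : 0 ≤ C) (hδ : 0 < δ) (hδ1 : δ ≤ 1)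
    (hCδ : C * δ ≤ 1 / 8) (hb : Tendsto b 𝒰 atBot)
    (hconv : ∀ A, ∀ η > 0, ∀ᶠ n in (𝒰 : Filter ℕ), ∀ x ∈ Icc (-A) A, |U n (b n + x) - ℓ| ≤ η)
    (hfar : ∀ᶠ n in (𝒰 : Filter ℕ), ∃ x ≤ b n, δ < |U n x - ℓ|) :
    ∃ β : Bubble g, β.l1 = ℓ ∧ |β.l0| ≤ M ∧ Tendsto (fun n => b n - β.x n) 𝒰 atTop ∧
      (∀ᶠ n in (𝒰 : Filter ℕ), |U n (β.x n) - ℓ| = δ ∧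
        ∀ y ∈ Icc (β.x n) (b n), |U n y - ℓ| ≤ δ) ∧
      ∀ A, ∀ η > 0, ∀ᶠ n in (𝒰 : Filter ℕ), (∀ x ∈ Icc (-A) A, |U n (β.x n + x) - β.v x| ≤ η) ∧
        ∫ x in (-A)..A, (U' n (β.x n + x) - β.p x) ^ 2 ≤ η := by
  have hlast : ∀ᶠ n in (𝒰 : Filter ℕ), ∃ x, x < b n ∧ |U n x - ℓ| = δ ∧
      ∀ y ∈ Icc x (b n), |U n y - ℓ| ≤ δ := by
    filter_upwards [hfar, hconv 0 (δ / 2) (by positivity)] with n h1 h2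
    have h3 := h2 0 (by simp)
    rw [add_zero] at h3
    have := hS.continuous n
    obtain ⟨x, hx, hx'⟩ := exists_last_eq (f := fun x => |U n x - ℓ|) (δ := δ) (b := b n)
      (by fun_prop) (by linarith) (by
        obtain ⟨x, h4, h5⟩ := h1
        exact ⟨x, h4, h5.le⟩)
    exact ⟨x, hx, hx'⟩
  obtain ⟨x, hx⟩ := hlast.choice
  have hsep : Tendsto (fun n => b n - x n) 𝒰 atTop := by
    rw [tendsto_atTop]
    intro A
    filter_upwards [hx, hconv A (δ / 2) (by positivity)] with n h1 h2
    by_contra! hlt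
    have h3 := h2 (x n - b n) ⟨by linarith, by linarith [h1.1]⟩
    rw [add_sub_cancel] at h3
    linarith [h1.2.1]
  obtain ⟨v, p, B, hv, hlim⟩ := hS.profile x
    (tendsto_atBot_mono' _ (hx.mono fun n hn => hn.1.le) hb)
  obtain ⟨l1, h10, h11⟩ := hv.exists_tendsto_atTop hg hA1 hA2
  obtain ⟨l0, h00, h01⟩ := hv.exists_tendsto_atBot hg hA1 hA2
  have hvM : ∀ y, |v y| ≤ M := by
    intro y
    refine le_of_forall_pos_le_add fun η hη => ?_
    obtain ⟨n, hn⟩ := (hlim |y| η hη).exists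
    have h1 := hn.1 y ⟨neg_abs_le y, le_abs_self y⟩
    have h2 := abs_sub_abs_le_abs_sub (v y) (U n (x n + y))
    rw [abs_sub_comm] at h1
    linarith [hS.bdd n (x n + y)]
  have hvδ : ∀ y, 0 ≤ y → |v y - ℓ| ≤ δ := by
    intro y hy
    refine le_of_forall_pos_le_add fun η hη => ?_
    obtain ⟨n, h1, h2, h3⟩ := ((hlim y η hη).and
      (hx.and (hsep.eventually (eventually_ge_atTop y)))).exists
    have h4 := h1.1 y ⟨by linarith, le_rfl⟩
    have h5 := h2.2.2 (x n + y) ⟨by linarith, by linarith⟩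
    rw [abs_sub_comm] at h4
    linarith [abs_sub_le (v y) (U n (x n + y)) ℓ]
  have hl1 : l1 = ℓ := by
    refine hC.eq_of_zero hδ1 hCδ hC0 ?_ h10
    exact le_of_tendsto (h11.sub_const ℓ).abs ((eventually_ge_atTop 0).mono hvδ)
  refine ⟨⟨x, v, p, B, l0, l1, hv, h00, h10, h01, h11⟩, hl1, ?_, hsep, ?_, hlim⟩
  · exact le_of_tendsto h01.abs (Eventually.of_forall hvM)
  · exact hx.mono fun n hn => hn.2

/-- A cut between the outermost profile and the remaining ones. -/
lemma exists_cut (hS : BubblingSeq g E M 𝒰 U U') (h𝒰 : (𝒰 : Filter ℕ) ≤ atTop) (β : Bubble g)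
    (hlim : ∀ A, ∀ η > 0, ∀ᶠ n in (𝒰 : Filter ℕ),
      (∀ x ∈ Icc (-A) A, |U n (β.x n + x) - β.v x| ≤ η) ∧
        ∫ x in (-A)..A, (U' n (β.x n + x) - β.p x) ^ 2 ≤ η) :
    ∃ K : ℕ → ℝ, Tendsto K 𝒰 atTop ∧
      (∀ η > 0, ∀ᶠ n in (𝒰 : Filter ℕ), logEnergy (fun x => U n (β.x n + x) - β.v x)
        (fun x => U' n (β.x n + x) - β.p x) (-K n) (K n) ≤ η) ∧
      ∀ A, ∀ η > 0, ∀ᶠ n in (𝒰 : Filter ℕ), ∀ x ∈ Icc (-A) A,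
        |U n (β.x n - K n + x) - β.l0| ≤ η := by
  have hvc := β.prof.continuous
  have hpc := β.prof.continuous_deriv
  have hP : ∀ k : ℕ, ∀ᶠ n in (𝒰 : Filter ℕ),
      (∀ x ∈ Icc (-(2 * k : ℝ)) (2 * k), |U n (β.x n + x) - β.v x| ≤ 1 / (k + 1)) ∧
      logEnergy (fun x => U n (β.x n + x) - β.v x)
        (fun x => U' n (β.x n + x) - β.p x) (-k) k ≤ 1 / (k + 1) := by
    intro k
    have hk : (0 : ℝ) < k + 1 := by positivity
    have hη0 : (0 : ℝ) < 1 / (4 * (k + 1) ^ 2) := by positivity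
    filter_upwards [hlim (2 * k) (1 / (k + 1)) (by positivity),
      hlim k (1 / (4 * (k + 1) ^ 2)) hη0] with n h1 h2
    refine ⟨h1.1, ?_⟩
    have hUc := hS.continuous n
    have hUc' := hS.hU' n
    have h3 := integral_le_add_of_continuous (a := -(k : ℝ)) (b := k)
      (f := fun x => (U' n (β.x n + x) - β.p x) ^ 2 + (U n (β.x n + x) - β.v x) ^ 2)
      (h := fun x => (U' n (β.x n + x) - β.p x) ^ 2) (k := fun _ => 1)
      (by fun_prop) (by fun_prop) (by fun_prop) 1 (1 / (4 * (k + 1) ^ 2)) (by linarith)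
      fun x hx => by
        have h4 := h2.1 x hx
        have h5 : (U n (β.x n + x) - β.v x) ^ 2 ≤ (1 / (4 * (k + 1) ^ 2)) ^ 2 := by
          rw [← sq_abs (_ - _)]
          exact pow_le_pow_left₀ (abs_nonneg _) h4 2
        have h6 : (1 / (4 * ((k : ℝ) + 1) ^ 2)) ^ 2 ≤ 1 / (4 * (k + 1) ^ 2) := by
          have : 1 / (4 * ((k : ℝ) + 1) ^ 2) ≤ 1 := by
            rw [div_le_one (by positivity)]; nlinarith [(Nat.cast_nonneg k : (0 : ℝ) ≤ k)]
          nlinarith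
        linarith
    rw [intervalIntegral.integral_const, smul_eq_mul] at h3
    have h7 : 1 / (4 * ((k : ℝ) + 1) ^ 2) * (1 + (k + k)) ≤ 1 / (k + 1) := by
      rw [div_mul_eq_mul_div, div_le_div_iff₀ (by positivity) hk]
      nlinarith [(Nat.cast_nonneg k : (0 : ℝ) ≤ k)]
    unfold logEnergy
    linarith [h2.2]
  obtain ⟨K, hK, hKP⟩ := exists_tendsto_atTop_eventually h𝒰 hP
  have hK' : Tendsto (fun n => (K n : ℝ)) 𝒰 atTop := tendsto_natCast_atTop_atTop.comp hK
  have hinv : Tendsto (fun n => 1 / ((K n : ℝ) + 1)) 𝒰 (𝓝 0) :=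
    tendsto_one_div_add_atTop_nhds_zero_nat.comp hK
  refine ⟨fun n => K n, hK', fun η hη => ?_, fun A η hη => ?_⟩
  · filter_upwards [hKP, hinv.eventually_le_const hη] with n h1 h2
    exact h1.2.trans h2
  · have hl0 : Tendsto (fun x => |β.v x - β.l0|) atBot (𝓝 0) := by
      simpa using (β.lim0.sub_const β.l0).abs
    obtain ⟨a, ha⟩ := eventually_atBot.1 (hl0.eventually_le_const (half_pos hη))
    filter_upwards [hKP, hinv.eventually_le_const (half_pos hη),
      hK'.eventually (eventually_ge_atTop (A - a)), hK'.eventually (eventually_ge_atTop A)]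
      with n h1 h2 h3 h4 x hx
    have h5 := h1.1 (x - K n) ⟨by linarith [hx.1], by
      linarith [hx.2, (Nat.cast_nonneg (K n) : (0 : ℝ) ≤ K n)]⟩
    have h6 := ha (x - K n) (by linarith [hx.2])
    rw [show β.x n - K n + x = β.x n + (x - K n) by ring]
    linarith [abs_sub_le (U n (β.x n + (x - K n))) (β.v (x - K n)) β.l0]

end BubblingSeq

namespace BubblingSeq

variable {g : ℝ → ℝ} {E M C δ ℓ : ℝ} {𝒰 : Ultrafilter ℕ} {U U' : ℕ → ℝ → ℝ} {b : ℕ → ℝ}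

/-- The profiles of a chain have small energy beyond the outermost scale. -/
lemma logEnergy_bubbleSum_cons_le (hg : Continuous g) {l : Filter ℕ} (β : Bubble g)
    (L : List (Bubble g)) (hC1 : 1 ≤ C) (hQ1 : QuadBound g β.l1 C)
    (hsep : Tendsto (fun n => b n - β.x n) l atTop) {K : ℕ → ℝ} (hK : Tendsto K l atTop)
    (htail : ∀ η > 0, ∀ᶠ n in l, ∀ c, β.x n - K n ≤ c →
      logEnergy (bubbleSum L n) (bubbleSum' L n) (β.x n - K n) c ≤ η)
    {η : ℝ} (hη : 0 < η) :
    ∀ᶠ n in l, ∀ c, b n ≤ c →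
      logEnergy (bubbleSum (β :: L) n) (bubbleSum' (β :: L) n) (b n) c ≤ η := by
  obtain ⟨A, hA⟩ := β.exists_forall_logEnergy_atTop_le hg hQ1 hC1 (by positivity : 0 < η / 4)
  have hvc := β.prof.continuous
  have hpc := β.prof.continuous_deriv
  filter_upwards [htail (η / 4) (by positivity), hsep.eventually (eventually_ge_atTop A),
    hsep.eventually (eventually_ge_atTop 0), hK.eventually (eventually_ge_atTop 0)]
    with n h1 h2 h3 h4 c hc
  have hc1 := continuous_bubbleSum L n
  have hc2 := continuous_bubbleSum' L n
  rw [funext (bubbleSum_cons β L n), funext (bubbleSum'_cons β L n)]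
  refine (logEnergy_add_le (by fun_prop) (by fun_prop) hc1 hc2 hc).trans ?_
  have h5 := logEnergy_comp_sub (f := fun x => β.v x - β.l1) (f' := β.p) (a := b n) (b := c)
    (β.x n)
  have h6 := hA (b n - β.x n) (c - β.x n) h2 (by linarith)
  have h7 := logEnergy_mono hc1 hc2 (by linarith : β.x n - K n ≤ b n) (le_refl c)
  have h8 := h1 c (by linarith)
  linarith

/-- Adding the outermost profile to the decomposition on the inner region. -/
lemma logEnergy_sub_bubbleSum_cons_le (hS : BubblingSeq g E M 𝒰 U U') (hg : Continuous g)
    (β : Bubble g) (L : List (Bubble g)) (hC1 : 1 ≤ C) (hQ0 : QuadBound g β.l0 C)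
    (hQ1 : QuadBound g β.l1 C) (hβ : β.l1 = ℓ)
    (hsep : Tendsto (fun n => b n - β.x n) 𝒰 atTop)
    (hneck : ∀ η > 0, ∃ A, ∀ᶠ n in (𝒰 : Filter ℕ), ∀ a, β.x n + A ≤ a → a ≤ b n →
      logEnergy (fun x => U n x - ℓ) (U' n) a (b n) ≤ η)
    {K : ℕ → ℝ} (hK : Tendsto K 𝒰 atTop)
    (hin : ∀ η > 0, ∀ᶠ n in (𝒰 : Filter ℕ), logEnergy (fun x => U n (β.x n + x) - β.v x)
        (fun x => U' n (β.x n + x) - β.p x) (-K n) (K n) ≤ η)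
    (hold : ∀ η > 0, ∀ᶠ n in (𝒰 : Filter ℕ), ∀ a ≤ β.x n - K n,
      logEnergy (fun x => U n x - β.l0 - bubbleSum L n x) (fun x => U' n x - bubbleSum' L n x)
        a (β.x n - K n) ≤ η)
    (htail : ∀ η > 0, ∀ᶠ n in (𝒰 : Filter ℕ), ∀ c, β.x n - K n ≤ c →
      logEnergy (bubbleSum L n) (bubbleSum' L n) (β.x n - K n) c ≤ η)
    {η : ℝ} (hη : 0 < η) :
    ∀ᶠ n in (𝒰 : Filter ℕ), ∀ a ≤ b n,
      logEnergy (fun x => U n x - ℓ - bubbleSum (β :: L) n x)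
        (fun x => U' n x - bubbleSum' (β :: L) n x) a (b n) ≤ η := by
  have hη' : 0 < η / 24 := by positivity
  obtain ⟨A₁, hA₁⟩ := β.exists_forall_logEnergy_atTop_le hg hQ1 hC1 hη'
  obtain ⟨A₀, hA₀⟩ := β.exists_forall_logEnergy_atBot_le hg hQ0 hC1 hη'
  obtain ⟨A₂, hA₂⟩ := hneck (η / 24) hη'
  set A := max A₁ (max A₂ 0) with hA
  have hA1 : A₁ ≤ A := le_max_left _ _
  have hA2 : A₂ ≤ A := (le_max_left _ _).trans (le_max_right _ _)
  have hA0 : 0 ≤ A := (le_max_right _ _).trans (le_max_right _ _)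
  have hvc := β.prof.continuous
  have hpc := β.prof.continuous_deriv
  filter_upwards [hA₂, hin _ hη', hold _ hη', htail _ hη', hsep.eventually (eventually_ge_atTop A),
    hK.eventually (eventually_ge_atTop A), hK.eventually (eventually_ge_atTop A₀)]
    with n h1 h2 h3 h4 h5 h6 h7 a hab
  have hUc := hS.continuous n
  have hUc' := hS.hU' n
  have hc1 := continuous_bubbleSum L n
  have hc2 := continuous_bubbleSum' L n
  have hc3 := continuous_bubbleSum (β :: L) n
  have hc4 := continuous_bubbleSum' (β :: L) n
  set x := β.x n
  have hac : min a (x - K n) ≤ x - K n := min_le_right _ _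
  refine (logEnergy_mono (by fun_prop) (by fun_prop) (min_le_left a (x - K n)) le_rfl).trans ?_
  generalize min a (x - K n) = a' at hac
  rw [← logEnergy_add_adjacent (b := x - K n) (by fun_prop) (by fun_prop),
    ← logEnergy_add_adjacent (a := x - K n) (b := x + A) (by fun_prop) (by fun_prop)]
  have hinner : logEnergy (fun y => U n y - ℓ - bubbleSum (β :: L) n y)
      (fun y => U' n y - bubbleSum' (β :: L) n y) a' (x - K n) ≤
      2 * (η / 24) + 2 * (η / 24) := by
    have e1 : (fun y => U n y - ℓ - bubbleSum (β :: L) n y) =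
        fun y => (U n y - β.l0 - bubbleSum L n y) - (β.v (y - x) - β.l0) := by
      funext y; rw [bubbleSum_cons, hβ]; ring
    have e2 : (fun y => U' n y - bubbleSum' (β :: L) n y) =
        fun y => (U' n y - bubbleSum' L n y) - β.p (y - x) := by
      funext y; rw [bubbleSum'_cons]; ring
    rw [e1, e2]
    refine (logEnergy_sub_le (by fun_prop) (by fun_prop) (by fun_prop) (by fun_prop) hac).trans ?_
    rw [logEnergy_comp_sub (f := fun y => β.v y - β.l0) (f' := β.p)]
    linarith [h3 a' hac, hA₀ (a' - x) (x - K n - x) (by linarith) (by linarith)]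
  have hmid : logEnergy (fun y => U n y - ℓ - bubbleSum (β :: L) n y)
      (fun y => U' n y - bubbleSum' (β :: L) n y) (x - K n) (x + A) ≤
      2 * (η / 24) + 2 * (η / 24) := by
    have e1 : (fun y => U n y - ℓ - bubbleSum (β :: L) n y) =
        fun y => (U n (x + (y - x)) - β.v (y - x)) - bubbleSum L n y := by
      funext y; rw [bubbleSum_cons, hβ, add_sub_cancel]; ring
    have e2 : (fun y => U' n y - bubbleSum' (β :: L) n y) =
        fun y => (U' n (x + (y - x)) - β.p (y - x)) - bubbleSum' L n y := by
      funext y; rw [bubbleSum'_cons, add_sub_cancel]; ring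
    rw [e1, e2]
    refine (logEnergy_sub_le (by fun_prop) (by fun_prop) (by fun_prop) (by fun_prop)
      (by linarith)).trans ?_
    rw [logEnergy_comp_sub (f := fun y => U n (x + y) - β.v y)
      (f' := fun y => U' n (x + y) - β.p y)]
    have h8 : logEnergy (fun y => U n (x + y) - β.v y) (fun y => U' n (x + y) - β.p y)
        (x - K n - x) (x + A - x) ≤ _ := logEnergy_mono (by fun_prop) (by fun_prop)
          (by linarith : -K n ≤ x - K n - x) (by linarith : x + A - x ≤ K n)
    linarith [h4 (x + A) (by linarith)]
  have houter : logEnergy (fun y => U n y - ℓ - bubbleSum (β :: L) n y)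
      (fun y => U' n y - bubbleSum' (β :: L) n y) (x + A) (b n) ≤
      2 * (η / 24) + 2 * (2 * (η / 24) + 2 * (η / 24)) := by
    have e1 : (fun y => U n y - ℓ - bubbleSum (β :: L) n y) =
        fun y => (U n y - ℓ) - ((β.v (y - x) - β.l1) + bubbleSum L n y) := by
      funext y; rw [bubbleSum_cons]
    have e2 : (fun y => U' n y - bubbleSum' (β :: L) n y) =
        fun y => U' n y - (β.p (y - x) + bubbleSum' L n y) := by
      funext y; rw [bubbleSum'_cons]
    rw [e1, e2]
    have hle : x + A ≤ b n := by linarith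
    refine (logEnergy_sub_le (by fun_prop) (by fun_prop) (by fun_prop) (by fun_prop) hle).trans ?_
    have h8 := logEnergy_add_le (f := fun y => β.v (y - x) - β.l1) (f' := fun y => β.p (y - x))
      (by fun_prop) (by fun_prop) hc1 hc2 hle
    rw [logEnergy_comp_sub (f := fun y => β.v y - β.l1) (f' := β.p)] at h8
    have h9 := logEnergy_mono hc1 hc2 (by linarith : x - K n ≤ x + A) (le_refl (b n))
    linarith [h1 (x + A) (by linarith) hle, h4 (b n) (by linarith),
      hA₁ (x + A - x) (b n - x) (by linarith) (by linarith)]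
  linarith

/-- Bubble tree decomposition below a scale at which the maps are close to a zero of `g`. -/
theorem exists_bubbleChain (hS : BubblingSeq g E M 𝒰 U U') (h𝒰 : (𝒰 : Filter ℕ) ≤ atTop)
    (hg : Continuous g) (hA1 : A1 g) (hA2 : A2 g) (hC1 : 1 ≤ C) (hδ : 0 < δ) (hδ1 : δ ≤ 1)
    (hCδ : C * δ ≤ 1 / 8) (hQ : ∀ ℓ, |ℓ| ≤ M → g ℓ = 0 → QuadBound g ℓ C) (k : ℕ) :
    ∀ (b : ℕ → ℝ) (ℓ : ℝ), Tendsto b 𝒰 atBot → g ℓ = 0 → |ℓ| ≤ M →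
    (∀ A, ∀ η > 0, ∀ᶠ n in (𝒰 : Filter ℕ), ∀ x ∈ Icc (-A) A, |U n (b n + x) - ℓ| ≤ η) →
    (∀ᶠ n in (𝒰 : Filter ℕ), ∀ a ≤ b n,
      ∫ x in a..(b n), (U' n x ^ 2 + g (U n x) ^ 2) ≤ k * (δ ^ 2 / 2)) →
    ∃ L : List (Bubble g), BubbleChain 𝒰 b ℓ L ∧
      (∀ η > 0, ∀ᶠ n in (𝒰 : Filter ℕ), ∀ a ≤ b n,
        logEnergy (fun x => U n x - ℓ - bubbleSum L n x) (fun x => U' n x - bubbleSum' L n x)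
          a (b n) ≤ η) ∧
      ∀ η > 0, ∀ᶠ n in (𝒰 : Filter ℕ), ∀ c, b n ≤ c →
        logEnergy (bubbleSum L n) (bubbleSum' L n) (b n) c ≤ η := by
  have hC0 : 0 ≤ C := by linarith
  induction k with
  | zero =>
    intro b ℓ hb hℓ hℓM hconv hen
    refine ⟨[], trivial, fun η hη => ?_, fun η hη => ?_⟩
    · have hnear : ∀ᶠ n in (𝒰 : Filter ℕ), ∀ x ≤ b n, |U n x - ℓ| ≤ δ := by
        by_contra hnot
        rw [← Ultrafilter.eventually_not] at hnot
        push Not at hnot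
        obtain ⟨β, -, -, hsep, hδβ, -⟩ := hS.exists_bubble hg hA1 hA2 (hQ ℓ hℓM hℓ) hC0 hδ hδ1 hCδ
          hb hconv hnot
        obtain ⟨n, h1, h2, h3, h4⟩ := (hδβ.and (hen.and ((hconv 0 (δ / 2) (by positivity)).and
          (hsep.eventually (eventually_ge_atTop 0))))).exists
        have h5 := energy_gap hg (hS.hU n) (hS.hU' n) (hQ ℓ hℓM hℓ) hC0 hδ1 hCδ
          (by linarith : β.x n ≤ b n) h1.1 (by simpa using h3 0 (by simp)) h1.2
        have h6 := h2 (β.x n) (by linarith)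
        have : 0 < δ ^ 2 := by positivity
        simp only [Nat.cast_zero, zero_mul] at h6
        linarith
      have := hS.eventually_logEnergy_le hg hA1 hA2 (hQ ℓ hℓM hℓ) hC0 hδ hδ1 hCδ hℓ hℓM hb hconv
        hnear hη
      simpa [bubbleSum, bubbleSum'] using this
    · exact Eventually.of_forall fun n c _ => by simpa [bubbleSum, bubbleSum', logEnergy] using hη.le
  | succ k ih =>
    intro b ℓ hb hℓ hℓM hconv hen
    by_cases hnear : ∀ᶠ n in (𝒰 : Filter ℕ), ∀ x ≤ b n, |U n x - ℓ| ≤ δ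
    · refine ⟨[], trivial, fun η hη => ?_, fun η hη => ?_⟩
      · have := hS.eventually_logEnergy_le hg hA1 hA2 (hQ ℓ hℓM hℓ) hC0 hδ hδ1 hCδ hℓ hℓM hb hconv
          hnear hη
        simpa [bubbleSum, bubbleSum'] using this
      · exact Eventually.of_forall fun n c _ => by
          simpa [bubbleSum, bubbleSum', logEnergy] using hη.le
    rw [← Ultrafilter.eventually_not] at hnear
    push Not at hnear
    obtain ⟨β, hβ1, hβM, hsep, hδβ, hlim⟩ := hS.exists_bubble hg hA1 hA2 (hQ ℓ hℓM hℓ) hC0 hδ hδ1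
      hCδ hb hconv hnear
    obtain ⟨K, hK, hin, hconv'⟩ := hS.exists_cut h𝒰 β hlim
    have hxb : ∀ᶠ n in (𝒰 : Filter ℕ), β.x n - K n ≤ b n := by
      filter_upwards [hsep.eventually (eventually_ge_atTop 0),
        hK.eventually (eventually_ge_atTop 0)] with n h1 h2
      linarith
    obtain ⟨L, hL, hL1, hL2⟩ := ih (fun n => β.x n - K n) β.l0 (tendsto_atBot_mono' _ hxb hb)
      β.zero0 hβM hconv' (by
        filter_upwards [hδβ, hen, hconv 0 (δ / 2) (by positivity),
          hsep.eventually (eventually_ge_atTop 0), hK.eventually (eventually_ge_atTop 0)]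
          with n h1 h2 h3 h4 h5 a ha
        have hgap := energy_gap hg (hS.hU n) (hS.hU' n) (hQ ℓ hℓM hℓ) hC0 hδ1 hCδ
          (by linarith : β.x n ≤ b n) h1.1 (by simpa using h3 0 (by simp)) h1.2
        have h6 := h2 a (by linarith)
        have hUc := hS.continuous n
        have hUc' := hS.hU' n
        have hi : ∀ c d, IntervalIntegrable (fun x => U' n x ^ 2 + g (U n x) ^ 2) volume c d :=
          fun c d => Continuous.intervalIntegrable (by fun_prop) _ _
        have h7 := intervalIntegral.integral_add_adjacent_intervals (hi a (β.x n - K n))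
          (hi (β.x n - K n) (β.x n))
        have h8 := intervalIntegral.integral_add_adjacent_intervals (hi a (β.x n))
          (hi (β.x n) (b n))
        have h9 : 0 ≤ ∫ x in (β.x n - K n)..(β.x n), (U' n x ^ 2 + g (U n x) ^ 2) :=
          integral_nonneg_of_continuous (by linarith) fun x _ => by positivity
        push_cast at h6
        linarith)
    have hQ1 : QuadBound g β.l1 C := hβ1 ▸ hQ ℓ hℓM hℓ
    refine ⟨β :: L, ⟨hsep, hβ1, hL.mono ?_⟩, fun η hη => ?_, fun η hη => ?_⟩
    · filter_upwards [hK.eventually (eventually_ge_atTop 0)] with n hn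
      linarith
    · exact hS.logEnergy_sub_bubbleSum_cons_le hg β L hC1 (hQ _ hβM β.zero0) hQ1 hβ1 hsep
        (fun η hη => hS.exists_logEnergy_neck_le h𝒰 hg hA1 hA2 (hQ ℓ hℓM hℓ) hC0 hδ hδ1 hCδ hℓ hℓM
          hb hconv (hδβ.mono fun n hn => hn.2) hη) hK hin hL1 hL2 hη
    · exact logEnergy_bubbleSum_cons_le hg β L hC1 hQ1 hsep hK hL2 hη

/-- Bubble tree decomposition up to a fixed scale, the energy being concentrated at the
origin. -/
theorem exists_bubbleChain_of_concentration (hS : BubblingSeq g E M 𝒰 U U')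
    (h𝒰 : (𝒰 : Filter ℕ) ≤ atTop) (hg : Continuous g) (hA1 : A1 g) (hA2 : A2 g) (hC1 : 1 ≤ C)
    (hQ : ∀ ℓ, |ℓ| ≤ M → g ℓ = 0 → QuadBound g ℓ C) (hℓ : g ℓ = 0) (hℓM : |ℓ| ≤ M) (x₀ : ℝ)
    (hval : Tendsto (fun n => U n x₀) 𝒰 (𝓝 ℓ))
    (hsmall : ∀ A, 0 ≤ A → ∀ η > 0, ∀ᶠ n in (𝒰 : Filter ℕ),
      ∫ x in (x₀ - A)..x₀, (U' n x ^ 2 + g (U n x) ^ 2) ≤ η) :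
    ∃ L : List (Bubble g), BubbleChain 𝒰 (fun _ => x₀) ℓ L ∧
      ∀ η > 0, ∀ᶠ n in (𝒰 : Filter ℕ), ∀ a ≤ x₀,
        logEnergy (fun x => U n x - ℓ - bubbleSum L n x) (fun x => U' n x - bubbleSum' L n x)
          a x₀ ≤ η := by
  have hsup : ∀ A, 0 ≤ A → ∀ η > 0, ∀ᶠ n in (𝒰 : Filter ℕ),
      ∀ x ∈ Icc (x₀ - A) x₀, |U n x - ℓ| ≤ η := by
    intro A hA η hη
    have hval' : Tendsto (fun n => |U n x₀ - ℓ|) 𝒰 (𝓝 0) := by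
      simpa using (hval.sub_const ℓ).abs
    filter_upwards [hsmall A hA ((η / 2) ^ 2 / (A + 1)) (by positivity),
      hval'.eventually_le_const (half_pos hη)] with n h1 h2 x hx
    have hUc := hS.continuous n
    have hUc' := hS.hU' n
    have h3 := sq_integral_le_of_continuous (hS.hU' n) hx.2
    rw [intervalIntegral.integral_eq_sub_of_hasDerivAt (fun y _ => hS.hU n y)
      ((hS.hU' n).intervalIntegrable _ _)] at h3
    have h4 : ∫ y in x..x₀, U' n y ^ 2 ≤ ∫ y in x..x₀, (U' n y ^ 2 + g (U n y) ^ 2) :=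
      integral_mono_of_continuous (by fun_prop) (by fun_prop) hx.2 fun y _ =>
        le_add_of_nonneg_right (sq_nonneg _)
    have hi : ∀ c d, IntervalIntegrable (fun x => U' n x ^ 2 + g (U n x) ^ 2) volume c d :=
      fun c d => Continuous.intervalIntegrable (by fun_prop) _ _
    have h5 := intervalIntegral.integral_add_adjacent_intervals (hi (x₀ - A) x) (hi x x₀)
    have h6 : 0 ≤ ∫ y in (x₀ - A)..x, (U' n y ^ 2 + g (U n y) ^ 2) :=
      integral_nonneg_of_continuous hx.1 fun x _ => by positivity
    have h0 : 0 ≤ ∫ y in x..x₀, U' n y ^ 2 :=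
      integral_nonneg_of_continuous hx.2 fun x _ => by positivity
    have h7 : (x₀ - x) * ∫ y in x..x₀, U' n y ^ 2 ≤ (A + 1) * ((η / 2) ^ 2 / (A + 1)) :=
      mul_le_mul (by linarith [hx.1]) (by linarith) h0 (by linarith)
    rw [mul_div_cancel₀ _ (by positivity)] at h7
    have h8 : |U n x₀ - U n x| ≤ η / 2 := abs_le_of_sq_le_sq (by linarith) (by positivity)
    rw [abs_sub_comm] at h8
    linarith [abs_sub_le (U n x) (U n x₀) ℓ]
  have hC0 : 0 < C := by linarith
  set δ := 1 / (8 * C) with hδ'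
  have hδ : 0 < δ := by positivity
  have hδ1 : δ ≤ 1 := by rw [hδ', div_le_one (by positivity)]; linarith
  have hCδ : C * δ ≤ 1 / 8 := by apply le_of_eq; rw [hδ']; field_simp
  have hP : ∀ k : ℕ, ∀ᶠ n in (𝒰 : Filter ℕ),
      (∀ x ∈ Icc (x₀ - 2 * k) x₀, |U n x - ℓ| ≤ 1 / (k + 1)) ∧
      logEnergy (fun x => U n x - ℓ) (U' n) (x₀ - k) x₀ ≤ 1 / (k + 1) := by
    intro k
    filter_upwards [hsup (2 * k) (by positivity) (1 / (k + 1)) (by positivity),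
      hsup k (by positivity) δ hδ, hsmall k (by positivity) (1 / (2 * (k + 1))) (by positivity)]
      with n h1 h2 h3
    refine ⟨h1, ?_⟩
    have hUc := hS.continuous n
    have hUc' := hS.hU' n
    have h4 := integral_le_add_of_continuous (a := x₀ - k) (b := x₀)
      (f := fun x => U' n x ^ 2 + (U n x - ℓ) ^ 2) (h := fun x => U' n x ^ 2 + g (U n x) ^ 2)
      (k := fun _ => 0) (by fun_prop) (by fun_prop) (by fun_prop) 2 0
      (by linarith [(Nat.cast_nonneg k : (0 : ℝ) ≤ k)]) fun x hx => by
        have := (hQ ℓ hℓM hℓ).sq_le hδ1 hCδ hC0.le (h2 x hx)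
        nlinarith [sq_nonneg (U' n x), sq_nonneg (g (U n x))]
    have h5 : 2 * (1 / (2 * ((k : ℝ) + 1))) = 1 / (k + 1) := by field_simp
    unfold logEnergy
    linarith
  obtain ⟨K, hK, hKP⟩ := exists_tendsto_atTop_eventually h𝒰 hP
  have hK' : Tendsto (fun n => (K n : ℝ)) 𝒰 atTop := tendsto_natCast_atTop_atTop.comp hK
  have hinv : Tendsto (fun n => 1 / ((K n : ℝ) + 1)) 𝒰 (𝓝 0) :=
    tendsto_one_div_add_atTop_nhds_zero_nat.comp hK
  obtain ⟨k, hk⟩ := exists_nat_ge (E / (δ ^ 2 / 2))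
  rw [div_le_iff₀ (by positivity)] at hk
  obtain ⟨L, hL, hL1, hL2⟩ := hS.exists_bubbleChain h𝒰 hg hA1 hA2 hC1 hδ hδ1 hCδ hQ k
    (fun n => x₀ - K n) ℓ
    (tendsto_atBot_add_const_left _ x₀ (tendsto_neg_atTop_atBot.comp hK')) hℓ hℓM (by
      intro A η hη
      filter_upwards [hKP, hinv.eventually_le_const hη, hK'.eventually (eventually_ge_atTop A)]
        with n h1 h2 h3 x hx
      exact (h1.1 _ ⟨by linarith [hx.1], by linarith [hx.2]⟩).trans h2)
    (Eventually.of_forall fun n a ha => (hS.energy n a _ ha).trans hk)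
  refine ⟨L, hL.mono (Eventually.of_forall fun n => by simp), fun η hη => ?_⟩
  have hη' : 0 < η / 5 := by positivity
  filter_upwards [hL1 _ hη', hL2 _ hη', hKP, hinv.eventually_le_const hη'] with n h1 h2 h3 h4 a ha
  have hUc := hS.continuous n
  have hUc' := hS.hU' n
  have hc1 := continuous_bubbleSum L n
  have hc2 := continuous_bubbleSum' L n
  have hk0 : (0 : ℝ) ≤ K n := Nat.cast_nonneg _
  refine (logEnergy_mono (by fun_prop) (by fun_prop) (min_le_left a (x₀ - K n)) le_rfl).trans ?_
  rw [← logEnergy_add_adjacent (b := x₀ - K n) (by fun_prop) (by fun_prop)]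
  have h5 := logEnergy_sub_le (a := x₀ - K n) (b := x₀) (f := fun x => U n x - ℓ) (f' := U' n)
    (h := bubbleSum L n) (h' := bubbleSum' L n)
    (by fun_prop) (by fun_prop) hc1 hc2 (by linarith)
  linarith [h1 _ (min_le_right a (x₀ - K n)), h2 x₀ (by linarith), h3.2]

end BubblingSeq

/-- Maps of uniformly bounded energy which are bounded at one point are uniformly bounded. -/
lemma exists_uniform_bound {g : ℝ → ℝ} (hg : Continuous g) (hA1 : A1 g) {U U' : ℕ → ℝ → ℝ}
    (hU : ∀ n x, HasDerivAt (U n) (U' n x) x) (hU' : ∀ n, Continuous (U' n)) {E m x₀ : ℝ}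
    (hE : ∀ n a b, a ≤ b → ∫ x in a..b, (U' n x ^ 2 + g (U n x) ^ 2) ≤ E)
    (hm : ∀ n, |U n x₀| ≤ m) : ∃ M, ∀ n x, |U n x| ≤ M := by
  obtain ⟨K, hK⟩ := (isCompact_Icc (a := -m) (b := m)).exists_bound_of_continuousOn
    (continuous_Gfun hg).continuousOn
  obtain ⟨M, hM⟩ := exists_abs_le_of_abs_Gfun_le hA1 (K + E)
  refine ⟨M, fun n x => hM _ ?_⟩
  have h1 : |Gfun g (U n x₀)| ≤ K := hK _ (abs_le.1 (hm n))
  have h2 : |Gfun g (U n x) - Gfun g (U n x₀)| ≤ E := by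
    rcases le_total x₀ x with h | h
    · exact (abs_Gfun_sub_le hg (hU n) (hU' n) h).trans (hE n _ _ h)
    · rw [abs_sub_comm]
      exact (abs_Gfun_sub_le hg (hU n) (hU' n) h).trans (hE n _ _ h)
  linarith [abs_sub_abs_le_abs_sub (Gfun g (U n x)) (Gfun g (U n x₀))]

namespace WaveSol

variable {g : ℝ → ℝ} {T b₀ E ε : ℝ}

lemma continuous_u_zero (S : WaveSol g T b₀ E ε) : Continuous fun x => S.u (0, x) :=
  S.cu.comp (by fun_prop)

lemma continuous_ux_zero (S : WaveSol g T b₀ E ε) : Continuous fun x => S.ux (0, x) :=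
  S.cux.comp (by fun_prop)

lemma integral_energy_zero_le (S : WaveSol g T b₀ E ε) (hg : Continuous g) {a b : ℝ} (hab : a ≤ b) :
    ∫ x in a..b, (S.ux (0, x) ^ 2 + g (S.u (0, x)) ^ 2) ≤ E := by
  have h1 := S.continuous_u_zero
  have h2 := S.continuous_ux_zero
  have h3 : Continuous fun x => S.ut (0, x) := S.cut.comp (by fun_prop)
  refine le_trans (integral_mono_of_continuous (by fun_prop) (by fun_prop) hab fun x _ => ?_)
    (S.energy 0 ⟨le_rfl, S.T_pos.le⟩ a b hab)
  have : 0 ≤ Real.exp (2 * x) * S.ut (0, x) ^ 2 := by positivity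
  linarith

/-- Smallness of the bound for the energy of a neck. -/
lemma exists_neck_parameter {C η : ℝ} (hC : 1 ≤ C) (hE : 0 ≤ E) (hη : 0 < η) :
    ∃ θ, 0 < θ ∧ θ ≤ 1 ∧ C * θ ≤ 1 / 4 ∧ ∀ e, 0 ≤ e → e ≤ θ ^ 2 →
      1300 * ((527 * e + 100 * θ ^ 2) + C * θ * (E + 7 * (527 * e + 100 * θ ^ 2))) ≤ η := by
  set D := 1300 * (627 + C * (E + 7 * 627)) with hD
  have hC0 : 0 < C := by linarith
  have hDpos : 0 < D := by positivity
  refine ⟨min (1 / (4 * C)) (η / D), by positivity, ?_, ?_, ?_⟩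
  · refine (min_le_left _ _).trans ?_
    rw [div_le_one (by positivity)]; linarith
  · refine (mul_le_mul_of_nonneg_left (min_le_left _ _) hC0.le).trans (le_of_eq ?_)
    field_simp
  · intro e he heθ
    have hθ0 : 0 ≤ min (1 / (4 * C)) (η / D) := by positivity
    have hθ1 : min (1 / (4 * C)) (η / D) ≤ 1 := by
      refine (min_le_left _ _).trans ?_
      rw [div_le_one (by positivity)]; linarith
    have hθη : D * min (1 / (4 * C)) (η / D) ≤ η := by
      refine (mul_le_mul_of_nonneg_left (min_le_right _ _) hDpos.le).trans (le_of_eq ?_)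
      field_simp
    generalize min (1 / (4 * C)) (η / D) = θ at *
    have h1 : θ ^ 2 ≤ θ := by nlinarith
    have h2 : 527 * e + 100 * θ ^ 2 ≤ 627 * θ := by linarith
    have h3 : C * θ * (E + 7 * (527 * e + 100 * θ ^ 2)) ≤ C * θ * (E + 7 * 627) :=
      mul_le_mul_of_nonneg_left (by linarith) (by positivity)
    refine le_trans ?_ hθη
    rw [hD]
    linarith

theorem bubblingSeq {𝒰 : Ultrafilter ℕ} {M C : ℝ} {ε : ℕ → ℝ} (S : ∀ n, WaveSol g T b₀ E (ε n))
    (hg : ContDiff ℝ 3 g) (hε0 : ∀ n, 0 < ε n) (hε : Tendsto ε 𝒰 (𝓝 0))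
    (hM : ∀ n x, |(S n).u (0, x)| ≤ M) (hC1 : 1 ≤ C)
    (hQ : ∀ ℓ, |ℓ| ≤ M → g ℓ = 0 → QuadBound g ℓ C) :
    BubblingSeq g E M 𝒰 (fun n x => (S n).u (0, x)) (fun n x => (S n).ux (0, x)) where
  hU n x := (S n).dx_u 0 x
  hU' n := (S n).continuous_ux_zero
  bdd := hM
  energy n a b hab := (S n).integral_energy_zero_le hg.continuous hab
  profile y hy := by
    have hex : ∀ x, ∃ z, Tendsto (fun n => (S n).u (0, x + y n)) 𝒰 (𝓝 z) := by
      intro x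
      obtain ⟨z, -, hz⟩ := (isCompact_Icc (a := -M) (b := M)).ultrafilter_le_nhds
        (𝒰.map fun n => (S n).u (0, x + y n)) (by
          rw [Ultrafilter.coe_map, le_principal_iff]
          exact (Eventually.of_forall fun n => abs_le.1 (hM n _) :
            ∀ᶠ n in (𝒰 : Filter ℕ), (S n).u (0, x + y n) ∈ Icc (-M) M))
      exact ⟨z, hz⟩
    choose v hv using hex
    have hT : Tendsto (fun n => T * Real.exp (-y n)) 𝒰 atTop :=
      (Real.tendsto_exp_atTop.comp (tendsto_neg_atBot_atTop.comp hy)).const_mul_atTop (S 0).T_pos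
    have hb : Tendsto (fun n => b₀ - y n) 𝒰 atTop :=
      tendsto_atTop_add_const_left _ b₀ (tendsto_neg_atBot_atTop.comp hy)
    obtain ⟨p, hp, hlim⟩ := WaveSol.exists_profile (S := fun n => (S n).shift (y n)) (v := v)
      hg hT hb hε (fun x => by simpa [WaveSol.shift] using hv x)
    refine ⟨v, p, _, hp, fun A η hη => ?_⟩
    filter_upwards [hlim A η hη] with n hn
    simpa [WaveSol.shift, add_comm] using hn
  neck := by
    refine ⟨min (Real.log T - 3) (b₀ - 4), fun ℓ hℓ hℓM η hη => ?_⟩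
    have hE : 0 ≤ E := WaveSol.E_nonneg hg.continuous (S 0)
    obtain ⟨θ, hθ, hθ1, hCθ, hbound⟩ := exists_neck_parameter hC1 hE hη
    refine ⟨θ / 2, by positivity, ?_⟩
    have hsq : Tendsto (fun n => (3 + 6 * E) * √(ε n)) 𝒰 (𝓝 0) := by
      simpa using (hε.sqrt).const_mul (3 + 6 * E)
    filter_upwards [hsq.eventually_le_const (by positivity : 0 < (θ / 2) ^ 2),
      hε.eventually_le_const (by positivity : 0 < θ ^ 2), hε.eventually_le_const one_pos]
      with n h1 h2 h3 a b hab hb hx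
    have hb1 := hb.trans (min_le_left _ _)
    have hb2 := hb.trans (min_le_right _ _)
    refine ((S n).integral_neck_le hg (hε0 n) h3 (by positivity : 0 ≤ θ / 2) h1 (hQ ℓ hℓM hℓ)
      (by linarith) (by linarith : θ / 2 + θ / 2 ≤ θ) (by linarith) hθ1 hCθ hab ?_ (by linarith)
      hx).trans (hbound _ (hε0 n).le h2)
    rw [← Real.le_log_iff_exp_le (S 0).T_pos]
    linarith

end WaveSol

lemma lintegral_image_exp {s : Set ℝ} (hs : MeasurableSet s) (φ : ℝ → ℝ) :
    ∫⁻ r in Real.exp '' s, ENNReal.ofReal (φ r) =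
      ∫⁻ x in s, ENNReal.ofReal (Real.exp x * φ (Real.exp x)) := by
  rw [lintegral_image_eq_lintegral_abs_deriv_mul hs
    (fun x _ => (Real.hasDerivAt_exp x).hasDerivWithinAt) Real.exp_injective.injOn]
  refine lintegral_congr fun x => ?_
  rw [abs_of_pos (Real.exp_pos x), ENNReal.ofReal_mul (Real.exp_pos x).le]

lemma ofReal_intervalIntegral {f : ℝ → ℝ} (hf : Continuous f) (h0 : ∀ x, 0 ≤ f x) {a b : ℝ}
    (hab : a ≤ b) :
    ENNReal.ofReal (∫ x in a..b, f x) = ∫⁻ x in Ioo a b, ENNReal.ofReal (f x) := by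
  rw [intervalIntegral.integral_of_le hab, ofReal_integral_eq_lintegral_ofReal
    ((hf.intervalIntegrable a b).1) (Eventually.of_forall h0),
    Measure.restrict_congr_set Ioo_ae_eq_Ioc]

lemma ofReal_intervalIntegral_eq_lintegral_image {f φ : ℝ → ℝ} (hf : Continuous f)
    (h0 : ∀ x, 0 ≤ f x) (hφ : ∀ x, f x = Real.exp x * φ (Real.exp x)) {a b : ℝ} (hab : a ≤ b) :
    ENNReal.ofReal (∫ x in a..b, f x) = ∫⁻ r in Real.exp '' Ioo a b, ENNReal.ofReal (φ r) := by
  rw [lintegral_image_exp measurableSet_Ioo, ofReal_intervalIntegral hf h0 hab]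
  simp only [hφ]

lemma lintegral_le_of_intervalIntegral_le {f : ℝ → ℝ} (hf : Continuous f) (h0 : ∀ x, 0 ≤ f x)
    {B : ℝ} (hB : ∀ a b, a ≤ b → ∫ x in a..b, f x ≤ B) :
    ∫⁻ x, ENNReal.ofReal (f x) ≤ ENNReal.ofReal B := by
  have hcov : AECover (volume : Measure ℝ) atTop fun n : ℕ => Ioo (-(n : ℝ)) n :=
    aecover_Ioo (tendsto_neg_atTop_atBot.comp tendsto_natCast_atTop_atTop)
      tendsto_natCast_atTop_atTop
  refine le_of_tendsto (hcov.lintegral_tendsto_of_countably_generated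
    (f := fun x => ENNReal.ofReal (f x)) (by fun_prop)) (Eventually.of_forall fun n => ?_)
  have hn : (0 : ℝ) ≤ n := Nat.cast_nonneg n
  rw [← ofReal_intervalIntegral hf h0 (by linarith)]
  exact ENNReal.ofReal_le_ofReal (hB _ _ (by linarith))

lemma setLIntegral_Iic_le_of_intervalIntegral_le {f : ℝ → ℝ} (hf : Continuous f)
    (h0 : ∀ x, 0 ≤ f x) {B c : ℝ} (hB : ∀ a ≤ c, ∫ x in a..c, f x ≤ B) :
    ∫⁻ x in Iic c, ENNReal.ofReal (f x) ≤ ENNReal.ofReal B := by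
  have hcov : AECover (volume.restrict (Iic c)) atTop fun n : ℕ => Ioi (-(n : ℝ)) :=
    (aecover_Ioi (tendsto_neg_atTop_atBot.comp tendsto_natCast_atTop_atTop)).mono
      Measure.restrict_le_self
  refine le_of_tendsto (hcov.lintegral_tendsto_of_countably_generated
    (f := fun x => ENNReal.ofReal (f x)) (by fun_prop)) ?_
  filter_upwards [tendsto_natCast_atTop_atTop.eventually (eventually_ge_atTop (-c))] with n hn
  rw [Measure.restrict_restrict measurableSet_Ioi, Ioi_inter_Iic,
    ← Measure.restrict_congr_set Ioo_ae_eq_Ioc, ← ofReal_intervalIntegral hf h0 (by linarith)]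
  exact ENNReal.ofReal_le_ofReal (hB _ (by linarith))

lemma image_exp_univ : Real.exp '' univ = Ioi 0 := by rw [image_univ, Real.range_exp]

lemma image_exp_Iic_log {R : ℝ} (hR : 0 < R) : Real.exp '' Iic (Real.log R) = Ioc 0 R := by
  ext r
  constructor
  · rintro ⟨x, hx, rfl⟩
    exact ⟨Real.exp_pos x, (Real.le_log_iff_exp_le hR).1 hx⟩
  · rintro ⟨h0, hr⟩
    exact ⟨Real.log r, Real.log_le_log h0 hr, Real.exp_log h0⟩

lemma image_exp_Ioo_subset {R a b : ℝ} (hR : 0 < R) (hb : b ≤ Real.log R) :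
    Real.exp '' Ioo a b ⊆ Ioo (Real.exp a) R := by
  rintro _ ⟨x, hx, rfl⟩
  exact ⟨Real.exp_lt_exp.2 hx.1, (Real.lt_log_iff_exp_lt hR).1 (hx.2.trans_le hb)⟩

lemma hasDerivAt_comp_log {F : ℝ → ℝ} {F' r : ℝ} (hr : 0 < r)
    (hF : HasDerivAt F F' (Real.log r)) :
    HasDerivAt (fun ρ => F (Real.log ρ)) (F' / r) r :=
  (hF.comp r (Real.hasDerivAt_log hr.ne')).congr_deriv (by rw [div_eq_mul_inv])

namespace IsProfile

variable {g v p : ℝ → ℝ} {B : ℝ}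

lemma contDiff_two (h : IsProfile g v p B) (hg : ContDiff ℝ 3 g) : ContDiff ℝ 2 v := by
  have hg1 : Continuous (deriv g) := hg.continuous_deriv (by norm_num)
  have hg0 : Continuous g := hg.continuous
  have hv := h.continuous
  have hdv : deriv v = p := funext fun x => (h.hv x).deriv
  have hdp : deriv p = fun x => g (v x) * deriv g (v x) := funext fun x => (h.hp x).deriv
  rw [show (2 : WithTop ℕ∞) = 1 + 1 by norm_num, contDiff_succ_iff_deriv]
  refine ⟨fun x => (h.hv x).differentiableAt, by simp, ?_⟩
  rw [hdv, contDiff_one_iff_deriv, hdp]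
  exact ⟨fun x => (h.hp x).differentiableAt, by fun_prop⟩

end IsProfile

/-- The harmonic map associated with a profile in logarithmic coordinates. -/
noncomputable def Bubble.harmonicMap {g : ℝ → ℝ} (hg : ContDiff ℝ 3 g) (β : Bubble g) :
    HarmonicMap g where
  Q r := β.v (Real.log r)
  Q0 := β.l0
  Qinf := β.l1
  smooth := (β.prof.contDiff_two hg).comp_contDiffOn
    (Real.contDiffOn_log.mono fun r hr => (mem_Ioi.1 hr).ne')
  eqn r hr := by
    have hr0 : (0 : ℝ) < r := hr
    have hd : deriv (fun r => β.v (Real.log r)) =ᶠ[𝓝 r] fun r => β.p (Real.log r) / r := by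
      filter_upwards [lt_mem_nhds hr0] with ρ hρ
      exact (hasDerivAt_comp_log hρ (β.prof.hv _)).deriv
    have hd2 : HasDerivAt (fun ρ => β.p (Real.log ρ) / ρ) _ r :=
      (hasDerivAt_comp_log hr0 (β.prof.hp _)).div (hasDerivAt_id r) hr0.ne'
    rw [hd.deriv_eq, hd.self_of_nhds, hd2.deriv]
    dsimp only
    field_simp
    ring
  finiteEnergy := by
    have hvc := β.prof.continuous
    have hpc := β.prof.continuous_deriv
    have hg0 := hg.continuous
    have h1 := lintegral_le_of_intervalIntegral_le (f := fun x => β.p x ^ 2 + g (β.v x) ^ 2)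
      (by fun_prop) (fun x => by positivity) β.prof.energy
    refine lt_of_le_of_lt (le_trans (le_of_eq ?_) h1) ENNReal.ofReal_lt_top
    rw [energyOn, ← image_exp_univ, lintegral_image_exp MeasurableSet.univ, Measure.restrict_univ]
    refine lintegral_congr fun x => ?_
    rw [(hasDerivAt_comp_log (Real.exp_pos x) (β.prof.hv _)).deriv, Real.log_exp]
    congr 1
    have := (Real.exp_pos x).ne'
    field_simp
    ring
  lim_zero := β.lim0.comp Real.tendsto_log_nhdsGT_zero
  lim_infty := β.lim1.comp Real.tendsto_log_atTop
  zero_mem := β.zero0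
  infty_mem := β.zero1

lemma ContDiffOn.hasFDerivAt_partials {F : ℝ × ℝ → ℝ} {s : Set (ℝ × ℝ)} {n : WithTop ℕ∞}
    (hF : ContDiffOn ℝ n F s) (hs : IsOpen s) (hn : n ≠ 0) {p : ℝ × ℝ} (hp : p ∈ s) :
    HasFDerivAt F (fderiv ℝ F p (1, 0) • ContinuousLinearMap.fst ℝ ℝ ℝ +
      fderiv ℝ F p (0, 1) • ContinuousLinearMap.snd ℝ ℝ ℝ) p := by
  have h := ((hF.contDiffAt (hs.mem_nhds hp)).differentiableAt hn).hasFDerivAt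
  refine h.congr_fderiv ?_
  ext <;> simp

lemma ContDiffOn.fderiv_apply_of_isOpen {F : ℝ × ℝ → ℝ} {s : Set (ℝ × ℝ)} {m n : WithTop ℕ∞}
    (hF : ContDiffOn ℝ n F s) (hs : IsOpen s) (hmn : m + 1 ≤ n) (v : ℝ × ℝ) :
    ContDiffOn ℝ m (fun p => fderiv ℝ F p v) s :=
  (hF.fderiv_of_isOpen hs hmn).clm_apply contDiffOn_const

lemma ContDiffOn.fderiv_fderiv_symm {F : ℝ × ℝ → ℝ} {s : Set (ℝ × ℝ)}
    (hF : ContDiffOn ℝ 2 F s) (hs : IsOpen s) {p : ℝ × ℝ} (hp : p ∈ s) (v w : ℝ × ℝ) :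
    fderiv ℝ (fun q => fderiv ℝ F q v) p w = fderiv ℝ (fun q => fderiv ℝ F q w) p v := by
  have hA := hF.contDiffAt (hs.mem_nhds hp)
  have hd : DifferentiableAt ℝ (fderiv ℝ F) p :=
    (hA.fderiv_right (m := 1) (by norm_num)).differentiableAt (by norm_num)
  have hsymm : IsSymmSndFDerivAt ℝ F p := hA.isSymmSndFDerivAt (by simp)
  rw [fderiv_clm_apply hd (differentiableAt_const v), fderiv_clm_apply hd (differentiableAt_const w)]
  simpa using hsymm w v

/-- Projection of a time onto `[0, 1/2]`. -/
noncomputable def clampTime (t : ℝ) : ℝ := max 0 (min t (1 / 2))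

@[fun_prop]
lemma continuous_clampTime : Continuous clampTime := by
  unfold clampTime
  fun_prop

lemma clampTime_mem (t : ℝ) : clampTime t ∈ Icc (0 : ℝ) (1 / 2) :=
  ⟨le_max_left _ _, max_le (by norm_num) (min_le_right _ _)⟩

lemma clampTime_of_mem {t : ℝ} (ht : t ∈ Icc (0 : ℝ) (1 / 2)) : clampTime t = t := by
  rw [clampTime, min_eq_left ht.2, max_eq_right ht.1]

lemma HasFDerivAt.comp_clampTime_exp {F : ℝ × ℝ → ℝ} {α β t x : ℝ}
    (hF : HasFDerivAt F (α • ContinuousLinearMap.fst ℝ ℝ ℝ + β • ContinuousLinearMap.snd ℝ ℝ ℝ)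
      (clampTime t, Real.exp x)) (ht : t ∈ Ioo (0 : ℝ) (1 / 2)) :
    HasFDerivAt (fun p : ℝ × ℝ => F (clampTime p.1, Real.exp p.2))
      (α • ContinuousLinearMap.fst ℝ ℝ ℝ +
        (Real.exp x * β) • ContinuousLinearMap.snd ℝ ℝ ℝ) (t, x) := by
  have hc : HasDerivAt clampTime 1 t := by
    refine (hasDerivAt_id t).congr_of_eventuallyEq ?_
    filter_upwards [Ioo_mem_nhds ht.1 ht.2] with s hs
    exact clampTime_of_mem (Ioo_subset_Icc_self hs)
  have h1 : HasFDerivAt (fun p : ℝ × ℝ => clampTime p.1)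
      ((1 : ℝ) • ContinuousLinearMap.fst ℝ ℝ ℝ) (t, x) :=
    HasDerivAt.comp_hasFDerivAt (h₂ := clampTime) (f := Prod.fst) (t, x) hc hasFDerivAt_fst
  have h2 : HasFDerivAt (fun p : ℝ × ℝ => Real.exp p.2)
      (Real.exp x • ContinuousLinearMap.snd ℝ ℝ ℝ) (t, x) :=
    HasDerivAt.comp_hasFDerivAt (h₂ := Real.exp) (f := Prod.snd) (t, x) (Real.hasDerivAt_exp x)
      hasFDerivAt_snd
  refine (HasFDerivAt.comp (t, x) (g := F) hF (h1.prodMk h2)).congr_fderiv ?_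
  ext <;> simp [mul_comm]

lemma HasFDerivAt.exp_mul_snd {F : ℝ × ℝ → ℝ} {α β t x : ℝ}
    (hF : HasFDerivAt F (α • ContinuousLinearMap.fst ℝ ℝ ℝ + β • ContinuousLinearMap.snd ℝ ℝ ℝ)
      (t, x)) :
    HasFDerivAt (fun p : ℝ × ℝ => Real.exp p.2 * F p)
      ((Real.exp x * α) • ContinuousLinearMap.fst ℝ ℝ ℝ +
        (Real.exp x * F (t, x) + Real.exp x * β) • ContinuousLinearMap.snd ℝ ℝ ℝ) (t, x) := by
  have h2 : HasFDerivAt (fun p : ℝ × ℝ => Real.exp p.2)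
      (Real.exp x • ContinuousLinearMap.snd ℝ ℝ ℝ) (t, x) :=
    HasDerivAt.comp_hasFDerivAt (h₂ := Real.exp) (f := Prod.snd) (t, x) (Real.hasDerivAt_exp x)
      hasFDerivAt_snd
  refine (h2.mul hF).congr_fderiv ?_
  ext <;> simp
  ring

lemma HasFDerivAt.hasDerivAt_comp_exp {F : ℝ × ℝ → ℝ} {α β s x : ℝ}
    (hF : HasFDerivAt F (α • ContinuousLinearMap.fst ℝ ℝ ℝ + β • ContinuousLinearMap.snd ℝ ℝ ℝ)
      (s, Real.exp x)) :
    HasDerivAt (fun y => F (s, Real.exp y)) (Real.exp x * β) x :=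
  (HasFDerivAt.hasDerivAt_comp_pair (c := fun _ => s) (d := Real.exp) hF (hasDerivAt_const x s)
    (Real.hasDerivAt_exp x)).congr_deriv (by ring)

lemma intervalIntegral_le_mul_of_average_le {h : ℝ → ℝ} {H : ℝ → ℝ≥0∞} (hh : Continuous h)
    (h0 : ∀ t, 0 ≤ h t) {μ ε : ℝ} (hμ : 0 < μ) (hε : 0 ≤ ε)
    (hle : ∀ t ∈ Ioo 0 μ, ENNReal.ofReal (h t) ≤ H t)
    (hH : ENNReal.ofReal (1 / μ) * ∫⁻ t in Icc (-μ) μ, H t ≤ ENNReal.ofReal ε) :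
    ∫ t in (0:ℝ)..μ, h t ≤ μ * ε := by
  have h1 : ENNReal.ofReal (∫ t in (0:ℝ)..μ, h t) ≤ ∫⁻ t in Icc (-μ) μ, H t := by
    rw [ofReal_intervalIntegral hh h0 hμ.le]
    refine (setLIntegral_mono' measurableSet_Ioo hle).trans (lintegral_mono_set fun t ht => ?_)
    exact ⟨by linarith [ht.1], ht.2.le⟩
  have h2 : ENNReal.ofReal (1 / μ * ∫ t in (0:ℝ)..μ, h t) ≤ ENNReal.ofReal ε := by
    rw [ENNReal.ofReal_mul (by positivity)]
    exact (mul_le_mul_right h1 _).trans hH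
  rw [ENNReal.ofReal_le_ofReal_iff hε, one_div, inv_mul_le_iff₀ hμ] at h2
  exact h2

lemma HasFDerivAt.hasDerivAt_left {F : ℝ × ℝ → ℝ} {α β t r : ℝ}
    (hF : HasFDerivAt F (α • ContinuousLinearMap.fst ℝ ℝ ℝ + β • ContinuousLinearMap.snd ℝ ℝ ℝ)
      (t, r)) : HasDerivAt (fun s => F (s, r)) α t :=
  (HasFDerivAt.hasDerivAt_comp_pair (c := fun s => s) (d := fun _ => r) hF (hasDerivAt_id t)
    (hasDerivAt_const t r)).congr_deriv (by ring)

lemma HasFDerivAt.hasDerivAt_right {F : ℝ × ℝ → ℝ} {α β t r : ℝ}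
    (hF : HasFDerivAt F (α • ContinuousLinearMap.fst ℝ ℝ ℝ + β • ContinuousLinearMap.snd ℝ ℝ ℝ)
      (t, r)) : HasDerivAt (fun ρ => F (t, ρ)) β r :=
  (HasFDerivAt.hasDerivAt_comp_pair (c := fun _ => t) (d := fun ρ => ρ) hF (hasDerivAt_const r t)
    (hasDerivAt_id r)).congr_deriv (by ring)

/-- The partial derivatives of a wave map, as functions on space-time, together with the equation
they satisfy. -/
lemma IsWaveMapOn.exists_partials {g : ℝ → ℝ} {ψ : ℝ → ℝ → ℝ}
    (h : IsWaveMapOn g ψ (Icc (-1) 1)) :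
    ∃ ψt ψr ψtt ψtr ψrr : ℝ × ℝ → ℝ,
      (ContinuousOn (fun p : ℝ × ℝ => ψ p.1 p.2) (Ioo (-1) 1 ×ˢ Ioi 0) ∧
        ContinuousOn ψt (Ioo (-1) 1 ×ˢ Ioi 0) ∧ ContinuousOn ψr (Ioo (-1) 1 ×ˢ Ioi 0) ∧
        ContinuousOn ψtt (Ioo (-1) 1 ×ˢ Ioi 0) ∧ ContinuousOn ψtr (Ioo (-1) 1 ×ˢ Ioi 0) ∧
        ContinuousOn ψrr (Ioo (-1) 1 ×ˢ Ioi 0)) ∧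
      ∀ p ∈ Ioo (-1 : ℝ) 1 ×ˢ Ioi (0 : ℝ),
        HasFDerivAt (fun p : ℝ × ℝ => ψ p.1 p.2) (ψt p • ContinuousLinearMap.fst ℝ ℝ ℝ +
          ψr p • ContinuousLinearMap.snd ℝ ℝ ℝ) p ∧
        HasFDerivAt ψt (ψtt p • ContinuousLinearMap.fst ℝ ℝ ℝ +
          ψtr p • ContinuousLinearMap.snd ℝ ℝ ℝ) p ∧
        HasFDerivAt ψr (ψtr p • ContinuousLinearMap.fst ℝ ℝ ℝ +
          ψrr p • ContinuousLinearMap.snd ℝ ℝ ℝ) p ∧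
        pdt ψ p.1 p.2 = ψt p ∧ pdr ψ p.1 p.2 = ψr p ∧
        ψtt p - ψrr p - ψr p / p.2 + g (ψ p.1 p.2) * deriv g (ψ p.1 p.2) / p.2 ^ 2 = 0 := by
  obtain ⟨hC, heq⟩ := h
  set s : Set (ℝ × ℝ) := Ioo (-1) 1 ×ˢ Ioi 0 with hs_def
  have hs : IsOpen s := isOpen_Ioo.prod isOpen_Ioi
  have hF : ContDiffOn ℝ 2 (fun p : ℝ × ℝ => ψ p.1 p.2) s :=
    hC.mono (prod_mono Ioo_subset_Icc_self subset_rfl)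
  set F : ℝ × ℝ → ℝ := fun p => ψ p.1 p.2 with hF_def
  have ht : ContDiffOn ℝ 1 (fun p => fderiv ℝ F p (1, 0)) s :=
    hF.fderiv_apply_of_isOpen hs (by norm_num) _
  have hr : ContDiffOn ℝ 1 (fun p => fderiv ℝ F p (0, 1)) s :=
    hF.fderiv_apply_of_isOpen hs (by norm_num) _
  set ψt : ℝ × ℝ → ℝ := fun p => fderiv ℝ F p (1, 0) with hψt
  set ψr : ℝ × ℝ → ℝ := fun p => fderiv ℝ F p (0, 1) with hψr
  have dF : ∀ p ∈ s, HasFDerivAt F (ψt p • ContinuousLinearMap.fst ℝ ℝ ℝ +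
      ψr p • ContinuousLinearMap.snd ℝ ℝ ℝ) p := fun p hp =>
    hF.hasFDerivAt_partials hs (by norm_num) hp
  have dt : ∀ p ∈ s, pdt ψ p.1 p.2 = ψt p := fun p hp =>
    (HasFDerivAt.hasDerivAt_left (t := p.1) (r := p.2) (dF p hp)).deriv
  have dr : ∀ p ∈ s, pdr ψ p.1 p.2 = ψr p := fun p hp =>
    (HasFDerivAt.hasDerivAt_right (t := p.1) (r := p.2) (dF p hp)).deriv
  refine ⟨ψt, ψr, fun p => fderiv ℝ ψt p (1, 0), fun p => fderiv ℝ ψt p (0, 1),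
    fun p => fderiv ℝ ψr p (0, 1), ⟨hF.continuousOn, ht.continuousOn, hr.continuousOn,
      (ht.fderiv_apply_of_isOpen (m := 0) hs (by norm_num) _).continuousOn,
      (ht.fderiv_apply_of_isOpen (m := 0) hs (by norm_num) _).continuousOn,
      (hr.fderiv_apply_of_isOpen (m := 0) hs (by norm_num) _).continuousOn⟩, fun p hp => ?_⟩
  have dtt := ht.hasFDerivAt_partials hs (by norm_num) hp
  have drr := hr.hasFDerivAt_partials hs (by norm_num) hp
  have hsymm : fderiv ℝ ψr p (1, 0) = fderiv ℝ ψt p (0, 1) :=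
    hF.fderiv_fderiv_symm hs hp (0, 1) (1, 0)
  have e1 : pdtt ψ p.1 p.2 = fderiv ℝ ψt p (1, 0) := by
    refine (HasDerivAt.congr_of_eventuallyEq
      (HasFDerivAt.hasDerivAt_left (t := p.1) (r := p.2) dtt) ?_).deriv
    filter_upwards [isOpen_Ioo.mem_nhds hp.1] with τ hτ
    exact dt (τ, p.2) ⟨hτ, hp.2⟩
  have e2 : pdrr ψ p.1 p.2 = fderiv ℝ ψr p (0, 1) := by
    refine (HasDerivAt.congr_of_eventuallyEq
      (HasFDerivAt.hasDerivAt_right (t := p.1) (r := p.2) drr) ?_).deriv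
    filter_upwards [isOpen_Ioi.mem_nhds hp.2] with ρ hρ
    exact dr (p.1, ρ) ⟨hp.1, hρ⟩
  rw [hsymm] at drr
  refine ⟨dF p hp, dtt, drr, dt p hp, dr p hp, ?_⟩
  dsimp only
  rw [← e1, ← e2, ← dr p hp]
  exact heq p.1 (Ioo_subset_Icc_self hp.1) p.2 hp.2

/-- A wave map, written in logarithmic coordinates. -/
lemma IsWaveMapOn.exists_waveSol {g : ℝ → ℝ} (hg : Continuous g) {ψ : ℝ → ℝ → ℝ} {R E ε : ℝ}
    (hR : 0 < R) (hE : 0 ≤ E) (hε : 0 ≤ ε) (h : IsWaveMapOn g ψ (Icc (-1) 1))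
    (hen : ∀ t ∈ Icc (-1:ℝ) 1, energyOn g (ψ t) (pdt ψ t) (Ioi 0) ≤ ENNReal.ofReal E)
    (hkin : ∀ μ ∈ Ioc (0:ℝ) 1, ENNReal.ofReal (1/μ) *
      ∫⁻ t in Icc (-μ) μ, ∫⁻ r in Ioo 0 R, ENNReal.ofReal ((pdt ψ t r)^2 * r) ≤
        ENNReal.ofReal ε) :
    ∃ S : WaveSol g (1 / 2) (Real.log R) E ε, (∀ x, S.u (0, x) = ψ 0 (Real.exp x)) ∧
      (∀ x, S.ut (0, x) = pdt ψ 0 (Real.exp x)) ∧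
      ∀ x, S.ux (0, x) = Real.exp x * pdr ψ 0 (Real.exp x) := by
  obtain ⟨ψt, ψr, ψtt, ψtr, ψrr, ⟨c0, ct, cr, ctt, ctr, crr⟩, hp⟩ := h.exists_partials
  have hmem : ∀ p : ℝ × ℝ, (clampTime p.1, Real.exp p.2) ∈ Ioo (-1 : ℝ) 1 ×ˢ Ioi (0 : ℝ) :=
    fun p => ⟨⟨by linarith [(clampTime_mem p.1).1], by linarith [(clampTime_mem p.1).2]⟩,
      Real.exp_pos _⟩
  have hΦ : Continuous fun p : ℝ × ℝ => (clampTime p.1, Real.exp p.2) := by fun_prop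
  have c0' : Continuous fun p : ℝ × ℝ => ψ (clampTime p.1) (Real.exp p.2) :=
    c0.comp_continuous hΦ hmem
  have ct' : Continuous fun p : ℝ × ℝ => ψt (clampTime p.1, Real.exp p.2) :=
    ct.comp_continuous hΦ hmem
  have cr' : Continuous fun p : ℝ × ℝ => ψr (clampTime p.1, Real.exp p.2) :=
    cr.comp_continuous hΦ hmem
  have ctt' : Continuous fun p : ℝ × ℝ => ψtt (clampTime p.1, Real.exp p.2) :=
    ctt.comp_continuous hΦ hmem
  have ctr' : Continuous fun p : ℝ × ℝ => ψtr (clampTime p.1, Real.exp p.2) :=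
    ctr.comp_continuous hΦ hmem
  have crr' : Continuous fun p : ℝ × ℝ => ψrr (clampTime p.1, Real.exp p.2) :=
    crr.comp_continuous hΦ hmem
  have cexp : Continuous fun p : ℝ × ℝ => Real.exp p.2 := by fun_prop
  have cexp2 : Continuous fun p : ℝ × ℝ => Real.exp (2 * p.2) := by fun_prop
  have cslice : ∀ t : ℝ, Continuous fun x : ℝ => (t, x) := fun t => by fun_prop
  refine ⟨{
    u := fun p => ψ (clampTime p.1) (Real.exp p.2)
    ut := fun p => ψt (clampTime p.1, Real.exp p.2)
    ux := fun p => Real.exp p.2 * ψr (clampTime p.1, Real.exp p.2)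
    utt := fun p => ψtt (clampTime p.1, Real.exp p.2)
    utx := fun p => Real.exp p.2 * ψtr (clampTime p.1, Real.exp p.2)
    uxx := fun p => Real.exp p.2 * ψr (clampTime p.1, Real.exp p.2) +
      Real.exp p.2 * (Real.exp p.2 * ψrr (clampTime p.1, Real.exp p.2))
    T_pos := by norm_num
    cu := c0'
    cut := ct'
    cux := cexp.mul cr'
    cutt := ctt'
    cutx := cexp.mul ctr'
    cuxx := (cexp.mul cr').add (cexp.mul (cexp.mul crr'))
    grad_u := fun t ht x => (hp _ (hmem (t, x))).1.comp_clampTime_exp ht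
    grad_ut := fun t ht x => (hp _ (hmem (t, x))).2.1.comp_clampTime_exp ht
    grad_ux := fun t ht x => ((hp _ (hmem (t, x))).2.2.1.comp_clampTime_exp ht).exp_mul_snd
    dx_u := fun t x => (hp _ (hmem (t, x))).1.hasDerivAt_comp_exp
    dx_ut := fun t x => (hp _ (hmem (t, x))).2.1.hasDerivAt_comp_exp
    dx_ux := fun t x => (Real.hasDerivAt_exp x).mul
      (hp _ (hmem (t, x))).2.2.1.hasDerivAt_comp_exp
    eqn := ?_
    energy := ?_
    kin := ?_ }, fun x => ?_, fun x => ?_, fun x => ?_⟩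
  · intro t _ x
    have h1 := (hp _ (hmem (t, x))).2.2.2.2.2
    have hx := (Real.exp_pos x).ne'
    simp only at h1 ⊢
    rw [two_mul, Real.exp_add]
    field_simp at h1
    linarith
  · intro t ht a b hab
    have hcont : Continuous fun x => Real.exp (2 * x) * ψt (clampTime t, Real.exp x) ^ 2 +
        (Real.exp x * ψr (clampTime t, Real.exp x)) ^ 2 +
        g (ψ (clampTime t) (Real.exp x)) ^ 2 :=
      (((cexp2.mul (ct'.pow 2)).add ((cexp.mul cr').pow 2)).add ((hg.comp c0').pow 2)).comp
        (cslice t)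
    rw [← ENNReal.ofReal_le_ofReal_iff hE, ofReal_intervalIntegral_eq_lintegral_image
      (φ := fun r => ((pdt ψ t r)^2 + (deriv (ψ t) r)^2 + (g (ψ t r))^2 / r^2) * r)
      hcont (fun x => by positivity) (fun x => ?_) hab]
    · refine le_trans (lintegral_mono_set ?_) (hen t ⟨by linarith [ht.1], by linarith [ht.2]⟩)
      rintro _ ⟨x, -, rfl⟩
      exact Real.exp_pos x
    · have h1 := (hp _ (hmem (t, x))).2.2.2.1
      have h2 := (hp _ (hmem (t, x))).2.2.2.2.1
      simp only [clampTime_of_mem ht] at h1 h2 ⊢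
      rw [pdr] at h2
      rw [h1, h2, two_mul, Real.exp_add]
      have hx := (Real.exp_pos x).ne'
      field_simp
  · intro μ hμ hμT a b hab hb
    refine intervalIntegral_le_mul_of_average_le
      (H := fun t => ∫⁻ r in Ioo 0 R, ENNReal.ofReal ((pdt ψ t r)^2 * r)) ?_ (fun t => ?_) hμ hε
      (fun t ht => ?_) (hkin μ ⟨hμ, by linarith⟩)
    · exact continuous_integral_slice (f := fun p : ℝ × ℝ => Real.exp (2 * p.2) *
        ψt (clampTime p.1, Real.exp p.2) ^ 2) (cexp2.mul (ct'.pow 2)) a b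
    · exact intervalIntegral.integral_nonneg hab fun x _ => by positivity
    · have htT : t ∈ Icc (0 : ℝ) (1 / 2) := ⟨ht.1.le, ht.2.le.trans hμT⟩
      have hcont : Continuous fun x => Real.exp (2 * x) * ψt (clampTime t, Real.exp x) ^ 2 :=
        (cexp2.mul (ct'.pow 2)).comp (cslice t)
      rw [ofReal_intervalIntegral_eq_lintegral_image (φ := fun r => (pdt ψ t r)^2 * r)
        hcont (fun x => by positivity) (fun x => ?_) hab]
      · exact lintegral_mono_set ((image_exp_Ioo_subset hR hb).trans
          (Ioo_subset_Ioo_left (Real.exp_pos a).le))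
      · have h1 := (hp _ (hmem (t, x))).2.2.2.1
        simp only [clampTime_of_mem htT] at h1 ⊢
        rw [h1, two_mul, Real.exp_add]
        ring
  · simp [clampTime]
  · have h1 := (hp _ (hmem (0, x))).2.2.2.1
    simp only at h1 ⊢
    rw [← h1]
    simp [clampTime]
  · have h1 := (hp _ (hmem (0, x))).2.2.2.2.1
    simp only at h1 ⊢
    rw [← h1]
    simp [clampTime]

lemma HLnormSqOn_Ioc_le {f f' w φ₀ φ₁ : ℝ → ℝ} {R ε η : ℝ} (hR : 0 < R)
    (hf : ∀ x, HasDerivAt f (f' x) x) (hf' : Continuous f') (hw : Continuous w)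
    (hφ₀ : ∀ x, φ₀ (Real.exp x) = f x) (hφ₁ : ∀ x, φ₁ (Real.exp x) = w x)
    (hε : ∀ a ≤ Real.log R, ∫ x in a..(Real.log R), Real.exp (2 * x) * w x ^ 2 ≤ ε)
    (hη : ∀ a ≤ Real.log R, logEnergy f f' a (Real.log R) ≤ η) :
    HLnormSqOn φ₀ φ₁ (Ioc 0 R) ≤ ENNReal.ofReal (ε + η) := by
  have hfc : Continuous f := continuous_iff_continuousAt.2 fun x => (hf x).continuousAt
  have hB : ∀ a ≤ Real.log R,
      ∫ x in a..(Real.log R), (Real.exp (2 * x) * w x ^ 2 + (f' x ^ 2 + f x ^ 2)) ≤ ε + η := by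
    intro a ha
    rw [intervalIntegral.integral_add (Continuous.intervalIntegrable (by fun_prop) _ _)
      (Continuous.intervalIntegrable (by fun_prop) _ _)]
    exact add_le_add (hε a ha) (hη a ha)
  refine le_trans (le_of_eq ?_) (setLIntegral_Iic_le_of_intervalIntegral_le (by fun_prop)
    (fun x => by positivity) hB)
  rw [HLnormSqOn, ← image_exp_Iic_log hR, lintegral_image_exp measurableSet_Iic]
  refine lintegral_congr fun x => ?_
  have hd : deriv φ₀ (Real.exp x) = f' x / Real.exp x := by
    have h1 : HasDerivAt (fun ρ => f (Real.log ρ)) (f' x / Real.exp x) (Real.exp x) :=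
      hasDerivAt_comp_log (Real.exp_pos x) (by rw [Real.log_exp]; exact hf x)
    refine (h1.congr_of_eventuallyEq ?_).deriv
    filter_upwards [lt_mem_nhds (Real.exp_pos x)] with ρ hρ
    rw [← hφ₀, Real.exp_log hρ]
  rw [hd, hφ₀, hφ₁, two_mul, Real.exp_add]
  congr 1
  have := (Real.exp_pos x).ne'
  field_simp
  ring

lemma bubbleSum_eq_sum_harmonicMap {g : ℝ → ℝ} (hg : ContDiff ℝ 3 g) (L : List (Bubble g)) (n : ℕ)
    (x : ℝ) :
    bubbleSum L n x = ∑ j : Fin L.length, (((L[j].harmonicMap hg).Q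
      (Real.exp x / Real.exp (L[j].x n))) - (L[j].harmonicMap hg).Qinf) := by
  rw [bubbleSum, ← Fin.sum_univ_fun_getElem]
  refine Finset.sum_congr rfl fun j _ => ?_
  simp only [Bubble.harmonicMap, ← Real.exp_sub, Real.log_exp]
  rfl

/-- Passage from an ultrafilter to a subsequence. -/
lemma BubbleChain.exists_strictMono {g : ℝ → ℝ} {𝒰 : Ultrafilter ℕ} (h𝒰 : (𝒰 : Filter ℕ) ≤ atTop)
    {b : ℕ → ℝ} {ℓ : ℝ} {L : List (Bubble g)} (h : BubbleChain 𝒰 b ℓ L) {e : ℕ → ℝ≥0∞}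
    (he : Tendsto e 𝒰 (𝓝 0)) :
    ∃ (τ : ℕ → ℕ) (l : Filter ℕ), StrictMono τ ∧ Tendsto τ atTop l ∧ BubbleChain l b ℓ L ∧
      Tendsto e l (𝓝 0) := by
  obtain ⟨l', h1, h2, h3⟩ := h.exists_isCountablyGenerated
  set l := l' ⊓ atTop ⊓ comap e (𝓝 0) with hl
  have hle : (𝒰 : Filter ℕ) ≤ l := le_inf (le_inf h1 h𝒰) he.le_comap
  have : l.NeBot := neBot_of_le hle
  obtain ⟨τ₀, hτ₀⟩ := exists_seq_tendsto l
  obtain ⟨θ, hθ, hτ⟩ := strictMono_subseq_of_tendsto_atTop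
    (hτ₀.mono_right (inf_le_left.trans inf_le_right))
  exact ⟨τ₀ ∘ θ, l, hτ, hτ₀.comp hθ.tendsto_atTop, h3.of_le (inf_le_left.trans inf_le_left),
    tendsto_comap.mono_left inf_le_right⟩

/-- bubble decomposition with `H × L²` convergence of the error: under
the additional assumption (A3), the error in the bubble decomposition at time `0`
converges to `0` in the full `H × L²([0,R])` norm. -/
theorem bubble_decomposition_H_convergence
    (g : ℝ → ℝ) (hg : ContDiff ℝ 3 g) (hA1 : A1 g) (hA2 : A2 g) (hA3 : A3 g)
    (R E : ℝ) (hR : 0 < R) (hE : 0 < E) (ℓ : ℝ) (hℓ : g ℓ = 0)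
    (ψ : ℕ → ℝ → ℝ → ℝ)
    (hwm : ∀ n, IsWaveMapOn g (ψ n) (Icc (-1) 1))
    (hen : ∀ n, ∀ t ∈ Icc (-1:ℝ) 1,
      energyOn g (ψ n t) (pdt (ψ n) t) (Ioi 0) ≤ ENNReal.ofReal E)
    (hval : Tendsto (fun n => ψ n 0 R) atTop (𝓝 ℓ))
    (hkin : Tendsto (fun n => ⨆ μ ∈ Ioc (0:ℝ) 1, ENNReal.ofReal (1/μ) *
        ∫⁻ t in Icc (-μ) μ, ∫⁻ r in Ioo 0 R, ENNReal.ofReal ((pdt (ψ n) t r)^2 * r))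
      atTop (𝓝 0))
    (hsmall : ∀ t ∈ Icc (-1:ℝ) 1, ∀ r : ℝ, 0 < r →
      Tendsto (fun n => energyOn g (ψ n t) (pdt (ψ n) t) (Ioo r R)) atTop (𝓝 0)) :
    ∃ σ : ℕ → ℕ, StrictMono σ ∧
    ∃ (J : ℕ) (lam : Fin J → ℕ → ℝ) (Q : Fin J → HarmonicMap g),
      -- positive scales, ordered: `0 < λ_{J,n} ≪ ⋯ ≪ λ_{1,n} ≪ 1`
      (∀ j n, 0 < lam j n) ∧
      (∀ hJ : 0 < J, Tendsto (fun n => lam ⟨0, hJ⟩ n) atTop (𝓝 0)) ∧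
      (∀ (j : Fin J) (hj : (j : ℕ) + 1 < J),
        Tendsto (fun n => lam ⟨(j : ℕ) + 1, hj⟩ n / lam j n) atTop (𝓝 0)) ∧
      -- `Q_{j+1}(∞) = Q_j(0)` and `Q₁(∞) = ℓ`
      (∀ (j : Fin J) (hj : (j : ℕ) + 1 < J), (Q ⟨(j : ℕ) + 1, hj⟩).Qinf = (Q j).Q0) ∧
      (∀ hJ : 0 < J, (Q ⟨0, hJ⟩).Qinf = ℓ) ∧
      -- `H × L²([0,R])` convergence of the error at time `0`
      Tendsto (fun n =>
        HLnormSqOn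
          (fun r => ψ (σ n) 0 r - ℓ - ∑ j : Fin J, ((Q j).Q (r / lam j n) - (Q j).Qinf))
          (pdt (ψ (σ n)) 0)
          (Ioc 0 R)) atTop (𝓝 0) := by
  set κ : ℕ → ℝ≥0∞ := fun n => ⨆ μ ∈ Ioc (0:ℝ) 1, ENNReal.ofReal (1/μ) *
    ∫⁻ t in Icc (-μ) μ, ∫⁻ r in Ioo 0 R, ENNReal.ofReal ((pdt (ψ n) t r)^2 * r) with hκ
  obtain ⟨N, hN⟩ := eventually_atTop.1 (hkin.eventually (gt_mem_nhds ENNReal.zero_lt_top))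
  have hNle : ∀ n, κ (n + N) < ⊤ := fun n => hN _ (Nat.le_add_left N n)
  set ε : ℕ → ℝ := fun n => (κ (n + N)).toReal + 1 / ((n : ℝ) + 1) with hε_def
  have hε0 : ∀ n, 0 < ε n := fun n => add_pos_of_nonneg_of_pos ENNReal.toReal_nonneg
    Nat.one_div_pos_of_nat
  have hε : Tendsto ε atTop (𝓝 0) := by
    have h1 : Tendsto (fun n => (κ (n + N)).toReal) atTop (𝓝 0) := by
      simpa [Function.comp_def] using (ENNReal.tendsto_toReal ENNReal.zero_ne_top).comp
        ((tendsto_add_atTop_iff_nat N).2 hkin)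
    simpa [hε_def] using h1.add (tendsto_one_div_add_atTop_nhds_zero_nat (𝕜 := ℝ))
  have hex : ∀ n, ∃ S : WaveSol g (1 / 2) (Real.log R) E (ε n),
      (∀ x, S.u (0, x) = ψ (n + N) 0 (Real.exp x)) ∧
      (∀ x, S.ut (0, x) = pdt (ψ (n + N)) 0 (Real.exp x)) ∧
      ∀ x, S.ux (0, x) = Real.exp x * pdr (ψ (n + N)) 0 (Real.exp x) := fun n =>
    (hwm (n + N)).exists_waveSol hg.continuous hR hE.le (hε0 n).le (hen (n + N)) fun μ hμ => by
      refine (le_iSup₂ (f := fun μ (_ : μ ∈ Ioc (0:ℝ) 1) => ENNReal.ofReal (1/μ) *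
        ∫⁻ t in Icc (-μ) μ, ∫⁻ r in Ioo 0 R,
          ENNReal.ofReal ((pdt (ψ (n + N)) t r)^2 * r)) μ hμ).trans ?_
      refine (ENNReal.le_ofReal_iff_toReal_le (hNle n).ne (hε0 n).le).2 ?_
      exact le_add_of_nonneg_right Nat.one_div_pos_of_nat.le
  choose S hSu hSut hSux using hex
  have hval' : Tendsto (fun n => (S n).u (0, Real.log R)) atTop (𝓝 ℓ) := by
    simpa only [hSu, Real.exp_log hR] using (tendsto_add_atTop_iff_nat N).2 hval
  obtain ⟨M, hM⟩ : ∃ M, ∀ n x, |(S n).u (0, x)| ≤ M := by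
    obtain ⟨m, hm⟩ := (Metric.isBounded_range_of_tendsto _ hval').exists_norm_le
    exact exists_uniform_bound hg.continuous hA1 (fun n x => (S n).dx_u 0 x)
      (fun n => (S n).continuous_ux_zero)
      (fun n a b hab => (S n).integral_energy_zero_le hg.continuous hab)
      (fun n => hm _ (mem_range_self n))
  have hℓM : |ℓ| ≤ M := le_of_tendsto hval'.abs (Eventually.of_forall fun n => hM n _)
  obtain ⟨C, hC1, hQ⟩ := exists_quadBound hg hA3 M
  set 𝒰 : Ultrafilter ℕ := hyperfilter ℕ
  have h𝒰 : (𝒰 : Filter ℕ) ≤ atTop := Nat.hyperfilter_le_atTop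
  have hconc : ∀ A, 0 ≤ A → ∀ η > 0, ∀ᶠ n in (𝒰 : Filter ℕ),
      ∫ x in (Real.log R - A)..(Real.log R), ((S n).ux (0, x) ^ 2 + g ((S n).u (0, x)) ^ 2) ≤ η := by
    intro A hA η hη
    have h1 := (tendsto_add_atTop_iff_nat N).2
      (hsmall 0 (by norm_num) (Real.exp (Real.log R - A)) (Real.exp_pos _))
    filter_upwards [h𝒰 (h1.eventually (ge_mem_nhds (ENNReal.ofReal_pos.2 hη)))] with n hn
    have h2 := hg.continuous
    have h3 := (S n).continuous_u_zero
    have h4 := (S n).continuous_ux_zero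
    rw [← ENNReal.ofReal_le_ofReal_iff hη.le]
    refine le_trans ?_ hn
    rw [ofReal_intervalIntegral_eq_lintegral_image (φ := fun r =>
      ((deriv (ψ (n + N) 0) r) ^ 2 + g (ψ (n + N) 0 r) ^ 2 / r ^ 2) * r) (by fun_prop)
      (fun x => by positivity) (fun x => ?_) (by linarith)]
    · refine (lintegral_mono_set (image_exp_Ioo_subset hR le_rfl)).trans
        (setLIntegral_mono' measurableSet_Ioo fun r hr => ENNReal.ofReal_le_ofReal ?_)
      have hr0 : 0 < r := (Real.exp_pos _).trans hr.1
      exact mul_le_mul_of_nonneg_right (by linarith [sq_nonneg (pdt (ψ (n + N)) 0 r)]) hr0.le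
    · have hx := (Real.exp_pos x).ne'
      rw [hSu, hSux, pdr]
      field_simp
  obtain ⟨L, hL, hLerr⟩ := (WaveSol.bubblingSeq S hg hε0 (hε.mono_left h𝒰) hM hC1
    hQ).exists_bubbleChain_of_concentration h𝒰 hg.continuous hA1 hA2 hC1 hQ hℓ hℓM (Real.log R)
    (hval'.mono_left h𝒰) hconc
  have herr : Tendsto (fun n => HLnormSqOn (fun r => ψ (n + N) 0 r - ℓ - ∑ j : Fin L.length,
      ((L[j].harmonicMap hg).Q (r / Real.exp (L[j].x n)) - (L[j].harmonicMap hg).Qinf))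
      (pdt (ψ (n + N)) 0) (Ioc 0 R)) 𝒰 (𝓝 0) := by
    refine ENNReal.tendsto_nhds_zero.2 fun δ hδ => ?_
    obtain ⟨η, hη0, hηδ⟩ := ENNReal.lt_iff_exists_nnreal_btwn.1 hδ
    have hη : (0 : ℝ) < η := by exact_mod_cast hη0
    filter_upwards [hLerr (η / 2) (by positivity),
      h𝒰 (hε.eventually (ge_mem_nhds (half_pos hη)))] with n hn hεn
    refine le_trans (HLnormSqOn_Ioc_le (w := fun x => (S n).ut (0, x)) hR (fun x => ?_) ?_ ?_
      (fun x => ?_) (fun x => (hSut n x).symm)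
      (fun a ha => (S n).integral_ut_zero_sq_le ha le_rfl) hn) ?_
    · exact (((S n).dx_u 0 x).sub_const ℓ).sub (hasDerivAt_bubbleSum L n x)
    · exact (S n).continuous_ux_zero.sub (continuous_bubbleSum' L n)
    · exact (S n).cut.comp (by fun_prop)
    · rw [hSu, bubbleSum_eq_sum_harmonicMap hg]
    · refine le_trans ?_ hηδ.le
      rw [← ENNReal.ofReal_coe_nnreal]
      exact ENNReal.ofReal_le_ofReal (by linarith)
  obtain ⟨τ, l, hτ, hτl, hchain, hlerr⟩ := hL.exists_strictMono h𝒰 herr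
  refine ⟨fun n => τ n + N, fun a b hab => Nat.add_lt_add_right (hτ hab) N, L.length,
    fun j n => Real.exp (L[j].x (τ n)), fun j => L[j].harmonicMap hg,
    fun j n => Real.exp_pos _, fun hJ => ?_, fun j hj => ?_, fun j hj => ?_, fun hJ => ?_,
    hlerr.comp hτl⟩
  · cases L with
    | nil => simp at hJ
    | cons β L =>
      refine Real.tendsto_exp_atBot.comp ?_
      have h1 := tendsto_atBot_add_const_left atTop (Real.log R)
        (tendsto_neg_atTop_atBot.comp (hchain.1.comp hτl))
      refine h1.congr fun n => ?_
      simp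
  · have h1 := tendsto_neg_atTop_atBot.comp ((hchain.tendsto_sub j hj).1.comp hτl)
    refine (Real.tendsto_exp_atBot.comp h1).congr fun n => ?_
    simp [← Real.exp_sub]
  · exact (hchain.tendsto_sub j hj).2
  · cases L with
    | nil => simp at hJ
    | cons β L => exact hchain.2.1
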